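/- For every basepoint x₀ in the complement X₂ = ℙ² ∖ C⁽²⁾, the fundamental group π₁(X₂, x₀) is isomorphic to the group G₂ with presentation ⟨a, b | b² = (ab)⁴⟩. -/

import Mathlib

noncomputable section

open MvPolynomial

/-- the complex projective plane -/
abbrev P2 := Projectivization ℂ (Fin 3 → ℂ)

instance : TopologicalSpace P2 :=
  inferInstanceAs (TopologicalSpace (Quotient (projectivizationSetoid ℂ (Fin 3 → ℂ))))

/-- the zero locus in ℙ² of a homogeneous polynomial F: the set of points all of whose
representative vectors are zeros of F -/
def VV (F : MvPolynomial (Fin 3) ℂ) : Set P2 :=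
  {P | ∀ (v : Fin 3 → ℂ) (h : v ≠ 0), Projectivization.mk ℂ v h = P → eval v F = 0}

/-- the singular locus of the curve {F = 0}: points at which all three partial
derivatives of F vanish (at every representative vector) -/
def SingLoc (F : MvPolynomial (Fin 3) ℂ) : Set P2 :=
  {P | ∀ (v : Fin 3 → ℂ) (h : v ≠ 0), Projectivization.mk ℂ v h = P →
    ∀ i : Fin 3, eval v (pderiv i F) = 0}

/-- the conic F₁ = 8z²−20yz+36xz+17y²−18xy -/
def F₁ : MvPolynomial (Fin 3) ℂ :=
  8 * X 2 ^ 2 - 20 * X 1 * X 2 + 36 * X 0 * X 2 + 17 * X 1 ^ 2 - 18 * X 0 * X 1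

/-- the quartic Q₁ = 8x²z²−16xy²z+52x²yz−36x³z−37x²y²+18x³y−y⁴+20xy³ -/
def Q₁ : MvPolynomial (Fin 3) ℂ :=
  8 * X 0 ^ 2 * X 2 ^ 2 - 16 * X 0 * X 1 ^ 2 * X 2 + 52 * X 0 ^ 2 * X 1 * X 2
    - 36 * X 0 ^ 3 * X 2 - 37 * X 0 ^ 2 * X 1 ^ 2 + 18 * X 0 ^ 3 * X 1
    - X 1 ^ 4 + 20 * X 0 * X 1 ^ 3

/-- the conic F₂ = 3x²+2xy+108z² -/
def F₂ : MvPolynomial (Fin 3) ℂ :=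
  3 * X 0 ^ 2 + 2 * X 0 * X 1 + 108 * X 2 ^ 2

/-- the quartic Q₂ = 2xy³+3x²y²+108y²z²−x⁴ -/
def Q₂ : MvPolynomial (Fin 3) ℂ :=
  2 * X 0 * X 1 ^ 3 + 3 * X 0 ^ 2 * X 1 ^ 2 + 108 * X 1 ^ 2 * X 2 ^ 2 - X 0 ^ 4

/-- generator a of the free group on two generators -/
def ga : FreeGroup (Fin 2) := FreeGroup.of 0
/-- generator b of the free group on two generators -/
def gb : FreeGroup (Fin 2) := FreeGroup.of 1

/-- relators of G₁: a²(ab)² and ab²a⁻¹b⁻² -/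
def rels1 : Set (FreeGroup (Fin 2)) := {ga ^ 2 * (ga * gb) ^ 2, ga * gb ^ 2 * ga⁻¹ * (gb ^ 2)⁻¹}

/-- the group G₁ = ⟨a, b | a²(ab)² = 1, ab²a⁻¹b⁻² = 1⟩ -/
abbrev G1 := PresentedGroup rels1

/-- relator of G₂: b²((ab)⁴)⁻¹, i.e. the relation b² = (ab)⁴ -/
def rels2 : Set (FreeGroup (Fin 2)) := {gb ^ 2 * ((ga * gb) ^ 4)⁻¹}

/-- the group G₂ = ⟨a, b | b² = (ab)⁴⟩ -/
abbrev G2 := PresentedGroup rels2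

section Transport

open Set Topology

variable {T : Type*} [TopologicalSpace T] {x₀ : T}

/-- A homotopy class of paths transports a family `C` of classes issuing from `x₀`. -/
def Transports (C : ∀ p : T, Path.Homotopic.Quotient x₀ p → Prop) {p q : T}
    (d : Path.Homotopic.Quotient p q) : Prop :=
  ∀ c, C p c ↔ C q (c.trans d)

/-- Paths inside `W` with endpoints in `V` transport the family `C`. -/
def TransportsIn (C : ∀ p : T, Path.Homotopic.Quotient x₀ p → Prop) (V W : Set T) : Prop :=
  ∀ ⦃p q : T⦄, p ∈ V → q ∈ V → ∀ δ : Path p q, (∀ t, δ t ∈ W) →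
    Transports C (Path.Homotopic.Quotient.mk δ)

variable {C : ∀ p : T, Path.Homotopic.Quotient x₀ p → Prop} {p q r : T}

namespace Transports

open Path.Homotopic.Quotient

theorem refl (p : T) : Transports C (Path.Homotopic.Quotient.refl p) := fun c => by
  rw [trans_refl]

theorem trans {d : Path.Homotopic.Quotient p q} {e : Path.Homotopic.Quotient q r}
    (hd : Transports C d) (he : Transports C e) : Transports C (d.trans e) := fun c => by
  rw [← trans_assoc, ← he, ← hd]

theorem symm {d : Path.Homotopic.Quotient p q} (hd : Transports C d) :
    Transports C d.symm := fun c => by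
  rw [hd, trans_assoc, symm_trans, trans_refl]

theorem of_trans_right {d : Path.Homotopic.Quotient p q} {e : Path.Homotopic.Quotient q r}
    (h : Transports C (d.trans e)) (he : Transports C e) : Transports C d := by
  have := h.trans he.symm
  rwa [trans_assoc, trans_symm, trans_refl] at this

theorem of_trans_left {d : Path.Homotopic.Quotient p q} {e : Path.Homotopic.Quotient q r}
    (h : Transports C (d.trans e)) (hd : Transports C d) : Transports C e := by
  have := hd.symm.trans h
  rwa [← trans_assoc, symm_trans, refl_trans] at this

end Transports

theorem TransportsIn.mono {V V' W W' : Set T} (h : TransportsIn C V W) (hV : V' ⊆ V)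
    (hW : W' ⊆ W) : TransportsIn C V' W' :=
  fun _ _ hp hq δ hδ => h (hV hp) (hV hq) δ fun t => hW (hδ t)

theorem mk_subpath_trans (δ : Path p q) (s t u : unitInterval) :
    (Path.Homotopic.Quotient.mk (δ.subpath s t)).trans
      (Path.Homotopic.Quotient.mk (δ.subpath t u)) =
      Path.Homotopic.Quotient.mk (δ.subpath s u) := by
  rw [← Path.Homotopic.Quotient.mk_trans, Path.Homotopic.Quotient.eq]
  exact ⟨Path.Homotopy.subpathTransSubpath δ s t u⟩

theorem subpath_mem {W : Set T} (δ : Path p q) {s t : unitInterval} (hst : s ≤ t)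
    (h : ∀ u ∈ Icc s t, δ u ∈ W) (v : unitInterval) : δ.subpath s t v ∈ W := by
  have : δ.subpath s t v ∈ range (δ.subpath s t) := ⟨v, rfl⟩
  rw [Path.range_subpath_of_le δ s t hst] at this
  obtain ⟨u, hu, hu'⟩ := this
  exact hu' ▸ h u hu

theorem exists_path_of_mem_closure [LocallyPathConnectedSpace T] {V U : Set T} {x : T}
    (hx : x ∈ closure V) (hU : IsOpen U) (hxU : x ∈ U) :
    ∃ v ∈ V, ∃ ε : Path x v, ∀ t, ε t ∈ U := by
  have ho : IsOpen (pathComponentIn U x) := hU.pathComponentIn x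
  obtain ⟨v, hv, hvV⟩ := mem_closure_iff.1 hx _ ho (mem_pathComponentIn_self hxU)
  obtain ⟨ε, hε⟩ := hv
  exact ⟨v, hvV, ε, hε⟩

theorem transports_cast {p' q' : T} (hp : p' = p) (hq : q' = q) {δ : Path p q} :
    Transports C (Path.Homotopic.Quotient.mk (δ.cast hp hq)) ↔
      Transports C (Path.Homotopic.Quotient.mk δ) := by
  subst hp hq
  rfl

theorem mem_trans_path {W : Set T} {δ : Path p q} {ε : Path q r} (hδ : ∀ t, δ t ∈ W)
    (hε : ∀ t, ε t ∈ W) (t : unitInterval) : δ.trans ε t ∈ W := by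
  rw [Path.trans_apply]
  split_ifs
  · exact hδ _
  · exact hε _

/-- Transport along paths is a local property. -/
theorem TransportsIn.of_local [LocallyPathConnectedSpace T] {V W : Set T} (hVW : W ⊆ closure V)
    (h : ∀ x ∈ W, ∃ N, IsOpen N ∧ x ∈ N ∧ TransportsIn C V N) : TransportsIn C V W := by
  intro p q hp hq δ hδ
  choose! N hNo hN hNC using h
  obtain ⟨t, ht0, htm, ⟨n, hn⟩, ht⟩ := exists_monotone_Icc_subset_open_cover_unitInterval
    (c := fun s : unitInterval => δ ⁻¹' N (δ s)) (fun s => (hNo _ (hδ s)).preimage δ.continuous)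
    (fun s _ => mem_iUnion.2 ⟨s, hN _ (hδ s)⟩)
  have key : ∀ k : ℕ, ∀ O : Set T, IsOpen O → δ (t k) ∈ O → ∃ v ∈ V, ∃ ε : Path (δ (t k)) v,
      (∀ s, ε s ∈ O) ∧ Transports C ((Path.Homotopic.Quotient.mk (δ.subpath 0 (t k))).trans
        (Path.Homotopic.Quotient.mk ε)) := by
    intro k
    induction k with
    | zero =>
      intro O hO hO'
      refine ⟨δ (t 0), by rw [ht0, δ.source]; exact hp, Path.refl _, fun _ => hO', ?_⟩
      rw [ht0, Path.subpath_self, Path.Homotopic.Quotient.mk_refl,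
        Path.Homotopic.Quotient.refl_trans]
      exact Transports.refl _
    | succ k ih =>
      intro O hO hO'
      obtain ⟨s, hs⟩ := ht k
      have hle : t k ≤ t (k + 1) := htm (Nat.le_succ k)
      obtain ⟨v, hv, ε, hε, hT⟩ := ih _ (hNo _ (hδ s)) (hs ⟨le_rfl, hle⟩)
      obtain ⟨v', hv', ε', hε'⟩ := exists_path_of_mem_closure (hVW (hδ (t (k + 1))))
        (hO.inter (hNo _ (hδ s))) ⟨hO', hs ⟨hle, le_rfl⟩⟩
      refine ⟨v', hv', ε', fun s => (hε' s).1, ?_⟩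
      have h1 := hNC _ (hδ s) hv hv' (ε.symm.trans ((δ.subpath (t k) (t (k + 1))).trans ε'))
        (mem_trans_path (fun s => hε _) (mem_trans_path
          (subpath_mem δ hle fun u hu => hs hu) fun s => (hε' s).2))
      have h2 := hT.trans h1
      simp only [Path.Homotopic.Quotient.mk_trans, Path.Homotopic.Quotient.mk_symm] at h2
      rw [Path.Homotopic.Quotient.trans_assoc, ← Path.Homotopic.Quotient.trans_assoc
        (Path.Homotopic.Quotient.mk ε), Path.Homotopic.Quotient.trans_symm,
        Path.Homotopic.Quotient.refl_trans, ← Path.Homotopic.Quotient.trans_assoc,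
        mk_subpath_trans] at h2
      exact h2
  obtain ⟨v, hv, ε, hε, hT⟩ := key n _ (hNo _ (hδ 1)) (by rw [hn n le_rfl]; exact hN _ (hδ 1))
  have h1 : Transports C (Path.Homotopic.Quotient.mk ε) :=
    hNC _ (hδ 1) (by rw [hn n le_rfl, δ.target]; exact hq) hv ε hε
  have h2 := hT.of_trans_right h1
  rw [hn n le_rfl, Path.subpath_zero_one, transports_cast] at h2
  exact h2

end Transport

section Charts

open Set Topology

variable {E E' T : Type*} [TopologicalSpace E] [TopologicalSpace E'] [TopologicalSpace T]

/-- `φ` restricts to an open embedding of the open set `O`. -/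
structure IsChart (φ : E → T) (O : Set E) : Prop where
  isOpen : IsOpen O
  continuousOn : ContinuousOn φ O
  injOn : InjOn φ O
  isOpen_image : ∀ S ⊆ O, IsOpen S → IsOpen (φ '' S)

namespace IsChart

variable {φ : E → T} {O : Set E}

theorem mono (h : IsChart φ O) {O' : Set E} (hO : O' ⊆ O) (ho : IsOpen O') : IsChart φ O' :=
  ⟨ho, h.continuousOn.mono hO, h.injOn.mono hO, fun S hS => h.isOpen_image S (hS.trans hO)⟩

theorem comp (h : IsChart φ O) {ψ : E' → E} {O' : Set E'} (hψ : IsChart ψ O')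
    (hm : MapsTo ψ O' O) : IsChart (φ ∘ ψ) O' where
  isOpen := hψ.isOpen
  continuousOn := h.continuousOn.comp hψ.continuousOn hm
  injOn := h.injOn.comp hψ.injOn hm
  isOpen_image S hS hSo := by
    rw [image_comp]
    exact h.isOpen_image _ ((image_mono hS).trans hm.image_subset) (hψ.isOpen_image S hS hSo)

theorem of_inverse {O : Set E} {ψ : E → E'} {R : Set E'} {g : E' → E} (hO : IsOpen O)
    (hR : IsOpen R) (hψ : ContinuousOn ψ O) (hg : ContinuousOn g R) (hm : MapsTo ψ O R)
    (hgψ : ∀ p ∈ O, g (ψ p) = p) (hψg : ∀ q ∈ R, g q ∈ O → ψ (g q) = q) : IsChart ψ O where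
  isOpen := hO
  continuousOn := hψ
  injOn := fun p hp q hq h => by rw [← hgψ p hp, h, hgψ q hq]
  isOpen_image S hS hSo := by
    have : ψ '' S = R ∩ g ⁻¹' S := by
      ext q
      constructor
      · rintro ⟨p, hp, rfl⟩
        exact ⟨hm (hS hp), by rw [mem_preimage, hgψ p (hS hp)]; exact hp⟩
      · rintro ⟨hq, hq'⟩
        exact ⟨g q, hq', hψg q hq (hS hq')⟩
    rw [this]
    exact hg.isOpen_inter_preimage hR hSo

theorem exists_inverse [Nonempty E] (h : IsChart φ O) :
    ∃ g : T → E, ContinuousOn g (φ '' O) ∧ ∀ p ∈ O, g (φ p) = p := by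
  have hg := h.injOn.leftInvOn_invFunOn
  refine ⟨Function.invFunOn φ O, ?_, hg⟩
  rintro _ ⟨p, hp, rfl⟩
  rw [ContinuousWithinAt, hg hp]
  intro S hS
  obtain ⟨S', hS', hSo, hpS⟩ := mem_nhds_iff.1 hS
  have h1 : φ '' (S' ∩ O) ∈ 𝓝[φ '' O] (φ p) := mem_nhdsWithin_of_mem_nhds
    ((h.isOpen_image _ inter_subset_right (hSo.inter h.isOpen)).mem_nhds ⟨p, ⟨hpS, hp⟩, rfl⟩)
  refine Filter.mem_map.2 (Filter.mem_of_superset h1 ?_)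
  rintro _ ⟨q, hq, rfl⟩
  rw [mem_preimage, hg hq.2]
  exact hS' hq.1

end IsChart

theorem mk_map_eq_mk_map {Y T : Type*} [TopologicalSpace Y] [TopologicalSpace T]
    [SimplyConnectedSpace Y] (f : C(Y, T)) {a b : Y} (γ γ' : Path a b) :
    Path.Homotopic.Quotient.mk (γ.map f.continuous) =
      Path.Homotopic.Quotient.mk (γ'.map f.continuous) :=
  Path.Homotopic.Quotient.eq.2 ((SimplyConnectedSpace.paths_homotopic γ γ').map f)

theorem Convex.simplyConnectedSpace' {E : Type*} [AddCommGroup E] [TopologicalSpace E]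
    [IsTopologicalAddGroup E] [Module ℝ E] [ContinuousSMul ℝ E] {N : Set E} (hN : Convex ℝ N)
    (hne : N.Nonempty) : SimplyConnectedSpace N :=
  have := hN.contractibleSpace hne
  inferInstance

section Vector

variable {E T : Type*} [TopologicalSpace T] [AddCommGroup E] [TopologicalSpace E]
    [IsTopologicalAddGroup E] [Module ℝ E] [ContinuousSMul ℝ E] {φ : E → T} {O : Set E}

theorem IsChart.mk_eq_mk (h : IsChart φ O) {N : Set E} (hNO : N ⊆ O) (hN : Convex ℝ N)
    {p q : T} (δ δ' : Path p q) (hδ : ∀ t, δ t ∈ φ '' N) (hδ' : ∀ t, δ' t ∈ φ '' N) :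
    Path.Homotopic.Quotient.mk δ = Path.Homotopic.Quotient.mk δ' := by
  obtain ⟨g, hg, hgφ⟩ := h.exists_inverse
  have hgN : ∀ x ∈ φ '' N, g x ∈ N := by
    rintro _ ⟨y, hy, rfl⟩
    rw [hgφ y (hNO hy)]
    exact hy
  have hφg : ∀ x ∈ φ '' N, φ (g x) = x := by
    rintro _ ⟨y, hy, rfl⟩
    rw [hgφ y (hNO hy)]
  have := hN.simplyConnectedSpace' ⟨g p, hgN p (by simpa using hδ 0)⟩
  have hp : g p ∈ N := hgN p (by simpa using hδ 0)
  have hq : g q ∈ N := hgN q (by simpa using hδ 1)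
  have lift : ∀ δ : Path p q, (∀ t, δ t ∈ φ '' N) →
      ∃ γ : Path (⟨g p, hp⟩ : N) ⟨g q, hq⟩, ∀ t, (γ t : E) = g (δ t) := by
    intro δ hδ
    refine ⟨{ toFun := fun t => ⟨g (δ t), hgN _ (hδ t)⟩
              continuous_toFun := ?_
              source' := by simp
              target' := by simp }, fun t => rfl⟩
    refine Continuous.subtype_mk ?_ _
    exact hg.comp_continuous δ.continuous fun t => image_mono hNO (hδ t)
  obtain ⟨γ, hγ⟩ := lift δ hδ
  obtain ⟨γ', hγ'⟩ := lift δ' hδ'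
  have hc : Continuous fun x : N => φ x := (h.continuousOn.mono hNO).comp_continuous
    continuous_subtype_val fun x => x.2
  have key := mk_map_eq_mk_map ⟨fun x : N => φ x, hc⟩ γ γ'
  have e1 : ∀ (δ : Path p q) (γ : Path (⟨g p, hp⟩ : N) ⟨g q, hq⟩), (∀ t, δ t ∈ φ '' N) →
      (∀ t, (γ t : E) = g (δ t)) →
      δ = (γ.map hc).cast (by simp [hφg p (by simpa using hδ 0)])
        (by simp [hφg q (by simpa using hδ 1)]) := by
    intro δ γ hδ hγ
    ext t
    simp [hγ, hφg _ (hδ t)]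
  rw [e1 δ γ hδ hγ, e1 δ' γ' hδ' hγ', Path.Homotopic.Quotient.mk_cast,
    Path.Homotopic.Quotient.mk_cast]
  exact congrArg (fun d => Path.Homotopic.Quotient.cast d _ _) key

theorem IsChart.exists_path (h : IsChart φ O) {N : Set E} (hNO : N ⊆ O) (hN : Convex ℝ N)
    {a b : E} (ha : a ∈ N) (hb : b ∈ N) : ∃ δ : Path (φ a) (φ b), ∀ t, δ t ∈ φ '' N := by
  have : PathConnectedSpace N := by
    have := hN.simplyConnectedSpace' ⟨a, ha⟩
    infer_instance
  obtain ⟨γ⟩ := PathConnectedSpace.joined (⟨a, ha⟩ : N) ⟨b, hb⟩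
  have hc : Continuous fun x : N => φ x := (h.continuousOn.mono hNO).comp_continuous
    continuous_subtype_val fun x => x.2
  exact ⟨γ.map hc, fun t => ⟨γ t, (γ t).2, rfl⟩⟩

variable {x₀ : T} {C : ∀ p : T, Path.Homotopic.Quotient x₀ p → Prop} {V W : Set T}

theorem TransportsIn.of_crossing (h : IsChart φ O) {N Np Nm : Set E} (hNO : N ⊆ O)
    (hN : Convex ℝ N) (hNp : Convex ℝ Np) (hNm : Convex ℝ Nm) (hNpN : Np ⊆ N) (hNmN : Nm ⊆ N)
    (hW : TransportsIn C V W) (hpW : φ '' Np ⊆ W) (hmW : φ '' Nm ⊆ W)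
    (hV : ∀ p ∈ N, φ p ∈ V → p ∈ Np ∪ Nm) {a b : E} (ha : a ∈ Np) (hb : b ∈ Nm)
    (haV : φ a ∈ V) (hbV : φ b ∈ V) {δ₀ : Path (φ a) (φ b)} (hδ₀ : ∀ t, δ₀ t ∈ φ '' N)
    (hT : Transports C (Path.Homotopic.Quotient.mk δ₀)) : TransportsIn C V (φ '' N) := by
  have half : ∀ S ⊆ N, Convex ℝ S → φ '' S ⊆ W → ∀ {p q : E}, p ∈ S → q ∈ S → φ p ∈ V →
      φ q ∈ V → ∀ δ : Path (φ p) (φ q), (∀ t, δ t ∈ φ '' N) →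
      Transports C (Path.Homotopic.Quotient.mk δ) := by
    intro S hSN hS hSW p q hp hq hpV hqV δ hδ
    obtain ⟨ε, hε⟩ := h.exists_path (hSN.trans hNO) hS hp hq
    rw [h.mk_eq_mk hNO hN δ ε hδ fun t => image_mono hSN (hε t)]
    exact hW hpV hqV ε fun t => hSW (hε t)
  have cross : ∀ {p q : E}, p ∈ Np → q ∈ Nm → φ p ∈ V → φ q ∈ V → ∀ δ : Path (φ p) (φ q),
      (∀ t, δ t ∈ φ '' N) → Transports C (Path.Homotopic.Quotient.mk δ) := by
    intro p q hp hq hpV hqV δ hδ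
    obtain ⟨ε, hε⟩ := h.exists_path hNO hN (hNpN hp) (hNpN ha)
    obtain ⟨ε', hε'⟩ := h.exists_path hNO hN (hNmN hb) (hNmN hq)
    rw [h.mk_eq_mk hNO hN δ (ε.trans (δ₀.trans ε')) hδ
      (mem_trans_path hε (mem_trans_path hδ₀ hε')), Path.Homotopic.Quotient.mk_trans,
      Path.Homotopic.Quotient.mk_trans]
    exact (half Np hNpN hNp hpW hp ha hpV haV ε hε).trans
      (hT.trans (half Nm hNmN hNm hmW hb hq hbV hqV ε' hε'))
  intro p q hp hq δ hδ
  obtain ⟨p', hp', rfl⟩ : p ∈ φ '' N := by simpa using hδ 0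
  obtain ⟨q', hq', rfl⟩ : q ∈ φ '' N := by simpa using hδ 1
  rcases hV p' hp' hp with h1 | h1 <;> rcases hV q' hq' hq with h2 | h2
  · exact half Np hNpN hNp hpW h1 h2 hp hq δ hδ
  · exact cross h1 h2 hp hq δ hδ
  · have := (cross h2 h1 hq hp δ.symm fun t => hδ _).symm
    rwa [← Path.Homotopic.Quotient.mk_symm, Path.symm_symm] at this
  · exact half Nm hNmN hNm hmW h1 h2 hp hq δ hδ

end Vector

section Normed

variable {E T : Type*} [TopologicalSpace T] [NormedAddCommGroup E] [NormedSpace ℝ E]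
  {φ : E → T} {O : Set E} {x₀ : T} {C : ∀ p : T, Path.Homotopic.Quotient x₀ p → Prop}
  {V W : Set T}

theorem ContinuousLinearMap.exists_near_pos {f : E →L[ℝ] ℝ} (hf : f ≠ 0) {p : E} (hp : f p = 0)
    {N : Set E} (hN : IsOpen N) (hpN : p ∈ N) : ∃ a ∈ N, 0 < f a := by
  obtain ⟨v, hv⟩ : ∃ v, 0 < f v := by
    obtain ⟨v, hv⟩ : ∃ v, f v ≠ 0 := by
      by_contra! h
      exact hf (ContinuousLinearMap.ext h)
    rcases hv.lt_or_gt with h | h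
    · exact ⟨-v, by simpa using h⟩
    · exact ⟨v, h⟩
  have hc : Filter.Tendsto (fun s : ℝ => p + s • v) (𝓝[>] 0) (𝓝 p) := by
    have : Continuous fun s : ℝ => p + s • v := by fun_prop
    have h0 := this.tendsto 0
    simp only [zero_smul, add_zero] at h0
    exact h0.mono_left nhdsWithin_le_nhds
  obtain ⟨s, hs, hs0⟩ := ((hc.eventually (hN.mem_nhds hpN)).and self_mem_nhdsWithin).exists
  exact ⟨_, hs, by simpa [hp, hv] using hs0⟩

theorem IsChart.exists_pos_mem (h : IsChart φ O) {f : E →L[ℝ] ℝ} (hf : f ≠ 0)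
    (hd : φ '' O ⊆ closure V) {p : E} (hp : f p = 0) {N : Set E} (hN : IsOpen N) (hNO : N ⊆ O)
    (hpN : p ∈ N) : ∃ a ∈ N, 0 < f a ∧ φ a ∈ V := by
  obtain ⟨a, ha, ha'⟩ := ContinuousLinearMap.exists_near_pos hf hp hN hpN
  have ho : IsOpen (φ '' (N ∩ {q | 0 < f q})) := h.isOpen_image _
    (inter_subset_left.trans hNO) (hN.inter (isOpen_lt continuous_const f.continuous))
  obtain ⟨_, ⟨b, hb, rfl⟩, hbV⟩ := mem_closure_iff.1 (hd ⟨a, hNO ha, rfl⟩) _ ho ⟨a, ⟨ha, ha'⟩, rfl⟩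
  exact ⟨b, hb.1, hb.2, hbV⟩

/-- Transport in `W` extends across a connected cut as soon as one path crossing the cut
transports. -/
theorem TransportsIn.union_chart [LocallyPathConnectedSpace T] (h : IsChart φ O)
    {f : E →L[ℝ] ℝ} (hf : f ≠ 0) (hK : IsPreconnected {p ∈ O | f p = 0})
    (hW : TransportsIn C V W) (hWo : IsOpen W) (hWV : W ⊆ closure V)
    (hOW : ∀ p ∈ O, f p ≠ 0 → φ p ∈ W) (hV : ∀ p ∈ O, φ p ∈ V → f p ≠ 0)
    (hd : φ '' O ⊆ closure V) {P Q : T} (g : Path P Q)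
    (hg : Transports C (Path.Homotopic.Quotient.mk g)) {s₀ : unitInterval} (hs0 : 0 < s₀)
    (hs1 : s₀ < 1) {p₀ : E} (hp₀ : p₀ ∈ O) (hfp₀ : f p₀ = 0) (hgp₀ : φ p₀ = g s₀)
    (hlt : ∀ s < s₀, g s ∈ V ∧ g s ∈ W ∧ ∀ a ∈ O, φ a = g s → 0 < f a)
    (hgt : ∀ s > s₀, g s ∈ V ∧ g s ∈ W ∧ ∀ a ∈ O, φ a = g s → f a < 0) :
    TransportsIn C V (W ∪ φ '' O) := by
  have pos_conv : ∀ (p : E) (ε : ℝ), Convex ℝ (Metric.ball p ε ∩ {q | 0 < f q}) := fun p ε =>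
    (convex_ball p ε).inter (convex_halfSpace_gt f.toLinearMap.isLinear 0)
  have neg_conv : ∀ (p : E) (ε : ℝ), Convex ℝ (Metric.ball p ε ∩ {q | f q < 0}) := fun p ε =>
    (convex_ball p ε).inter (convex_halfSpace_lt f.toLinearMap.isLinear 0)
  have ballCross : ∀ {p : E} {ε : ℝ}, Metric.ball p ε ⊆ O → ∀ {a b : E},
      a ∈ Metric.ball p ε → b ∈ Metric.ball p ε → 0 < f a → f b < 0 → φ a ∈ V → φ b ∈ V →
      ∀ δ₀ : Path (φ a) (φ b), (∀ t, δ₀ t ∈ φ '' Metric.ball p ε) →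
      Transports C (Path.Homotopic.Quotient.mk δ₀) →
      TransportsIn C V (φ '' Metric.ball p ε) := by
    intro p ε hpO a b ha hb hfa hfb haV hbV δ₀ hδ₀ hT
    refine TransportsIn.of_crossing h hpO (convex_ball p ε) (pos_conv p ε) (neg_conv p ε)
      inter_subset_left inter_subset_left hW ?_ ?_ ?_ ⟨ha, hfa⟩ ⟨hb, hfb⟩ haV hbV hδ₀ hT
    · rintro _ ⟨q, hq, rfl⟩
      exact hOW q (hpO hq.1) hq.2.ne'
    · rintro _ ⟨q, hq, rfl⟩
      exact hOW q (hpO hq.1) hq.2.ne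
    · intro q hq hqV
      rcases (hV q (hpO hq) hqV).lt_or_gt with h1 | h1
      · exact Or.inr ⟨hq, h1⟩
      · exact Or.inl ⟨hq, h1⟩
  have hprec := isPreconnected_iff_preconnectedSpace.1 hK
  let u : Set {p // p ∈ {p ∈ O | f p = 0}} :=
    {p | ∃ N, IsOpen N ∧ p.1 ∈ N ∧ N ⊆ O ∧ TransportsIn C V (φ '' N)}
  have huo : IsOpen u := by
    rw [isOpen_iff_mem_nhds]
    rintro p ⟨N, hN, hpN, hNO, hT⟩
    filter_upwards [continuous_subtype_val.continuousAt.preimage_mem_nhds (hN.mem_nhds hpN)]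
      with q hq
    exact ⟨N, hN, hq, hNO, hT⟩
  have huc : IsClosed u := by
    rw [← closure_subset_iff_isClosed]
    intro p hp
    obtain ⟨ε, hε, hpO⟩ := Metric.isOpen_iff.1 h.isOpen p.1 p.2.1
    have ho : IsOpen (Subtype.val ⁻¹' Metric.ball p.1 ε : Set {p // p ∈ {p ∈ O | f p = 0}}) :=
      Metric.isOpen_ball.preimage continuous_subtype_val
    obtain ⟨p', hp', N, hN, hp'N, hNO, hT⟩ :=
      mem_closure_iff.1 hp _ ho (Metric.mem_ball_self hε)
    obtain ⟨ε', hε', hsub⟩ := Metric.isOpen_iff.1 (hN.inter Metric.isOpen_ball) p'.1 ⟨hp'N, hp'⟩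
    obtain ⟨a, ha, hfa, haV⟩ := h.exists_pos_mem hf hd p'.2.2 Metric.isOpen_ball
      (hsub.trans (inter_subset_left.trans hNO)) (Metric.mem_ball_self hε')
    obtain ⟨b, hb, hfb, hbV⟩ := h.exists_pos_mem (neg_ne_zero.2 hf) hd
      (by simp [p'.2.2]) Metric.isOpen_ball
      (hsub.trans (inter_subset_left.trans hNO)) (Metric.mem_ball_self hε')
    obtain ⟨δ₀, hδ₀⟩ := h.exists_path (hsub.trans (inter_subset_left.trans hNO))
      (convex_ball _ _) ha hb
    refine ⟨_, Metric.isOpen_ball, Metric.mem_ball_self hε, hpO, ballCross hpO (hsub ha).2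
      (hsub hb).2 hfa (by simpa using hfb) haV hbV δ₀
      (fun t => image_mono (hsub.trans inter_subset_right) (hδ₀ t))
      (hT haV hbV δ₀ fun t => image_mono (hsub.trans inter_subset_left) (hδ₀ t))⟩
  have hune : u.Nonempty := by
    refine ⟨⟨p₀, hp₀, hfp₀⟩, ?_⟩
    obtain ⟨ε, hε, hpO⟩ := Metric.isOpen_iff.1 h.isOpen p₀ hp₀
    have hbo : IsOpen (φ '' Metric.ball p₀ ε) := h.isOpen_image _ hpO Metric.isOpen_ball
    have hnb : g ⁻¹' (φ '' Metric.ball p₀ ε) ∈ 𝓝 s₀ := (hbo.preimage g.continuous).mem_nhds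
      ⟨p₀, Metric.mem_ball_self hε, hgp₀⟩
    obtain ⟨s₁, hs₁, h₁⟩ := exists_Ioc_subset_of_mem_nhds hnb ⟨0, hs0⟩
    obtain ⟨s₂, hs₂, h₂⟩ := exists_Ico_subset_of_mem_nhds hnb ⟨1, hs1⟩
    obtain ⟨s₁', h₁', h₁''⟩ := exists_between hs₁
    obtain ⟨s₂', h₂', h₂''⟩ := exists_between hs₂
    have hsub : ∀ s ∈ Icc s₁' s₂', g s ∈ φ '' Metric.ball p₀ ε := by
      intro s hs
      rcases le_total s s₀ with h0 | h0
      · exact h₁ ⟨h₁'.trans_le hs.1, h0⟩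
      · exact h₂ ⟨h0, hs.2.trans_lt h₂''⟩
    have hle := (h₁''.trans h₂').le
    obtain ⟨a, ha, hag⟩ := hsub s₁' ⟨le_rfl, hle⟩
    obtain ⟨b, hb, hbg⟩ := hsub s₂' ⟨hle, le_rfl⟩
    have t1 : Transports C (Path.Homotopic.Quotient.mk (g.subpath 0 s₁')) :=
      hW (hlt 0 hs0).1 (hlt _ h₁'').1 _
        (subpath_mem g unitInterval.nonneg' fun s hs => (hlt s (hs.2.trans_lt h₁'')).2.1)
    have t2 : Transports C (Path.Homotopic.Quotient.mk (g.subpath s₂' 1)) :=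
      hW (hgt _ h₂').1 (hgt 1 hs1).1 _
        (subpath_mem g unitInterval.le_one' fun s hs => (hgt s (h₂'.trans_le hs.1)).2.1)
    have t3 : Transports C (Path.Homotopic.Quotient.mk (g.subpath s₁' s₂')) := by
      refine Transports.of_trans_right (e := Path.Homotopic.Quotient.mk (g.subpath s₂' 1)) ?_ t2
      rw [mk_subpath_trans]
      refine Transports.of_trans_left (d := Path.Homotopic.Quotient.mk (g.subpath 0 s₁')) ?_ t1
      rw [mk_subpath_trans, Path.subpath_zero_one, transports_cast]
      exact hg
    refine ⟨_, Metric.isOpen_ball, Metric.mem_ball_self hε, hpO, ballCross hpO ha hb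
      ((hlt _ h₁'').2.2 a (hpO ha) hag) ((hgt _ h₂').2.2 b (hpO hb) hbg)
      (hag ▸ (hlt _ h₁'').1) (hbg ▸ (hgt _ h₂').1) ((g.subpath s₁' s₂').cast hag hbg)
      (subpath_mem g hle hsub) ((transports_cast hag hbg).2 t3)⟩
  have hu := IsClopen.eq_univ ⟨huc, huo⟩ hune
  refine TransportsIn.of_local (union_subset hWV hd) ?_
  rintro x (hx | ⟨p, hp, rfl⟩)
  · exact ⟨W, hWo, hx, hW⟩
  · by_cases hfp : f p = 0
    · obtain ⟨N, hN, hpN, hNO, hT⟩ : (⟨p, hp, hfp⟩ : {p // p ∈ {p ∈ O | f p = 0}}) ∈ u :=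
        hu ▸ mem_univ _
      exact ⟨_, h.isOpen_image N hNO hN, ⟨p, hpN, rfl⟩, hT⟩
    · exact ⟨W, hWo, hOW p hp hfp, hW⟩

end Normed

end Charts

section Complement

open Set Topology

/-- The complement of the sextic. -/
abbrev Cpl : Type := ↥(VV (F₂ * Q₂))ᶜ

/-- The conic in rescaled coordinates. -/
def conic (v : ℂ × ℂ × ℂ) : ℂ := 3 * v.1 ^ 2 + 2 * v.1 * v.2.1 + v.2.2 ^ 2

/-- The cone over the complement of the sextic, in rescaled coordinates. -/
def cone : Set (ℂ × ℂ × ℂ) := {v | conic v ≠ 0 ∧ v.2.1 ^ 2 * conic v ≠ v.1 ^ 4}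

theorem continuous_conic : Continuous conic := by
  unfold conic
  fun_prop

theorem isOpen_cone : IsOpen cone := by
  have := continuous_conic
  exact (isOpen_ne_fun this continuous_const).inter
    (isOpen_ne_fun (by fun_prop : Continuous fun v : ℂ × ℂ × ℂ => v.2.1 ^ 2 * conic v)
      (by fun_prop))

/-- A square root of 108. -/
def rt : ℂ := ((Real.sqrt 108 : ℝ) : ℂ)

theorem rt_sq : rt ^ 2 = 108 := by
  unfold rt
  norm_cast
  exact Real.sq_sqrt (by norm_num)

theorem rt_ne_zero : rt ≠ 0 := by
  intro h
  have := rt_sq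
  rw [h] at this
  norm_num at this

/-- The homogeneous coordinate vector belonging to rescaled coordinates. -/
def toVec (v : ℂ × ℂ × ℂ) : Fin 3 → ℂ := ![v.1, v.2.1, v.2.2 / rt]

theorem eval_toVec (v : ℂ × ℂ × ℂ) :
    eval (toVec v) (F₂ * Q₂) = conic v * (v.2.1 ^ 2 * conic v - v.1 ^ 4) := by
  have h : (v.2.2 / rt) ^ 2 * 108 = v.2.2 ^ 2 := by
    rw [div_pow, rt_sq]
    ring
  simp only [F₂, Q₂, toVec, conic, map_mul, map_add, map_sub, map_pow, map_ofNat, eval_X,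
    Matrix.cons_val_zero, Matrix.cons_val_one, Matrix.cons_val]
  rw [← h]
  ring

theorem eval_toVec_ne_zero {v : ℂ × ℂ × ℂ} : eval (toVec v) (F₂ * Q₂) ≠ 0 ↔ v ∈ cone := by
  rw [eval_toVec, mul_ne_zero_iff, sub_ne_zero]
  rfl

theorem toVec_ne_zero {v : ℂ × ℂ × ℂ} (hv : v ∈ cone) : toVec v ≠ 0 := by
  intro h
  have h0 := congrFun h 0
  have h1 := congrFun h 1
  have h2 := congrFun h 2
  simp only [toVec, Pi.zero_apply, Matrix.cons_val_zero, Matrix.cons_val_one, Matrix.cons_val,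
    div_eq_zero_iff, rt_ne_zero, or_false] at h0 h1 h2
  refine hv.1 ?_
  simp [conic, h0, h1, h2]

theorem base_mem_cone : ((1, 0, 0) : ℂ × ℂ × ℂ) ∈ cone := by
  simp [cone, conic]

open Classical in
/-- The point of the complement with given rescaled homogeneous coordinates. -/
def pt (v : ℂ × ℂ × ℂ) : Cpl :=
  if h : v ∈ cone then
    ⟨Projectivization.mk ℂ (toVec v) (toVec_ne_zero h), fun hV =>
      eval_toVec_ne_zero.2 h (hV _ (toVec_ne_zero h) rfl)⟩
  else ⟨Projectivization.mk ℂ (toVec (1, 0, 0)) (toVec_ne_zero base_mem_cone), fun hV =>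
      eval_toVec_ne_zero.2 base_mem_cone (hV _ (toVec_ne_zero base_mem_cone) rfl)⟩

theorem coe_pt {v : ℂ × ℂ × ℂ} (h : v ∈ cone) :
    (pt v : P2) = Projectivization.mk ℂ (toVec v) (toVec_ne_zero h) := by
  rw [pt, dif_pos h]

theorem continuous_toVec : Continuous toVec := by
  refine continuous_pi fun i => ?_
  fin_cases i <;> simp [toVec] <;> fun_prop

theorem continuous_mk : Continuous fun v : {v : Fin 3 → ℂ // v ≠ 0} =>
    (Projectivization.mk ℂ v.1 v.2 : P2) :=
  continuous_quotient_mk'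

theorem isOpen_of_isOpen_mk {S : Set P2}
    (h : IsOpen {v : {v : Fin 3 → ℂ // v ≠ 0} | Projectivization.mk ℂ v.1 v.2 ∈ S}) : IsOpen S :=
  h

theorem continuousOn_pt : ContinuousOn pt cone := by
  rw [continuousOn_iff_continuous_domRestrict, continuous_induced_rng]
  have : Continuous fun v : cone => (⟨toVec v, toVec_ne_zero v.2⟩ : {v : Fin 3 → ℂ // v ≠ 0}) :=
    (continuous_toVec.comp continuous_subtype_val).subtype_mk _
  convert continuous_mk.comp this using 1
  ext v
  simp [coe_pt v.2]

/-- Rescaled coordinates of a vector. -/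
def ofVec (w : Fin 3 → ℂ) : ℂ × ℂ × ℂ := (w 0, w 1, w 2 * rt)

theorem toVec_ofVec (w : Fin 3 → ℂ) : toVec (ofVec w) = w := by
  ext i
  fin_cases i <;> simp [toVec, ofVec, rt_ne_zero]

theorem pt_surjective (p : Cpl) : ∃ v ∈ cone, pt v = p := by
  obtain ⟨P, hP⟩ := p
  simp only [mem_compl_iff, VV, mem_ofPred_eq, not_forall] at hP
  obtain ⟨w, hw, rfl, he⟩ := hP
  have hc : ofVec w ∈ cone := by
    rw [← eval_toVec_ne_zero, toVec_ofVec]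
    exact he
  refine ⟨ofVec w, hc, Subtype.ext ?_⟩
  simp [coe_pt hc, toVec_ofVec]

theorem pt_eq_pt {v w : ℂ × ℂ × ℂ} (hv : v ∈ cone) (hw : w ∈ cone) :
    pt v = pt w ↔ ∃ c : ℂ, c ≠ 0 ∧ w = c • v := by
  rw [Subtype.ext_iff, coe_pt hv, coe_pt hw, eq_comm, Projectivization.mk_eq_mk_iff']
  constructor
  · rintro ⟨c, hc⟩
    have h0 := congrFun hc 0
    have h1 := congrFun hc 1
    have h2 := congrFun hc 2
    simp only [toVec, Pi.smul_apply, smul_eq_mul, Matrix.cons_val_zero, Matrix.cons_val_one,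
      Matrix.cons_val] at h0 h1 h2
    refine ⟨c, ?_, ?_⟩
    · rintro rfl
      exact toVec_ne_zero hw (by rw [← hc, zero_smul])
    · have hr := rt_ne_zero
      refine Prod.ext h0.symm (Prod.ext h1.symm ?_)
      field_simp at h2
      exact h2.symm
  · rintro ⟨c, -, rfl⟩
    refine ⟨c, ?_⟩
    ext i
    fin_cases i <;> simp [toVec, mul_div_assoc]

theorem conic_smul (c : ℂ) (v : ℂ × ℂ × ℂ) : conic (c • v) = c ^ 2 * conic v := by
  simp [conic]
  ring

theorem smul_mem_cone {c : ℂ} (hc : c ≠ 0) {v : ℂ × ℂ × ℂ} (hv : v ∈ cone) : c • v ∈ cone := by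
  refine ⟨?_, ?_⟩
  · rw [conic_smul]
    exact mul_ne_zero (pow_ne_zero _ hc) hv.1
  · rw [conic_smul]
    intro h
    refine hv.2 (mul_left_cancel₀ (pow_ne_zero 4 hc) ?_)
    simp only [Prod.smul_fst, Prod.smul_snd, smul_eq_mul] at h
    linear_combination h

theorem isOpen_image_pt {S : Set (ℂ × ℂ × ℂ)} (hS : S ⊆ cone) (ho : IsOpen S) :
    IsOpen (pt '' S) := by
  have h1 : IsOpen {w : Fin 3 → ℂ | ∃ c : ℂ, c ≠ 0 ∧ c • ofVec w ∈ S} := by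
    have : {w : Fin 3 → ℂ | ∃ c : ℂ, c ≠ 0 ∧ c • ofVec w ∈ S} =
        ⋃ c : {c : ℂ // c ≠ 0}, {w | c.1 • ofVec w ∈ S} := by
      ext w
      simp
    rw [this]
    refine isOpen_iUnion fun c => ho.preimage ?_
    unfold ofVec
    fun_prop
  have h2 : IsOpen (Subtype.val '' (pt '' S) : Set P2) := by
    refine isOpen_of_isOpen_mk ?_
    convert h1.preimage continuous_subtype_val using 1
    ext ⟨w, hw⟩
    simp only [mem_image, exists_exists_and_eq_and, mem_ofPred_eq, mem_preimage]
    constructor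
    · rintro ⟨v, hv, h⟩
      rw [coe_pt (hS hv), eq_comm, Projectivization.mk_eq_mk_iff'] at h
      obtain ⟨c, rfl⟩ := h
      have hc : c ≠ 0 := by
        rintro rfl
        exact hw (zero_smul _ _)
      refine ⟨c⁻¹, inv_ne_zero hc, ?_⟩
      convert hv using 1
      refine Prod.ext ?_ (Prod.ext ?_ ?_) <;> simp [ofVec, toVec, hc]
      field_simp [rt_ne_zero]
    · rintro ⟨c, hc, h⟩
      refine ⟨_, h, ?_⟩
      rw [coe_pt (hS h), Projectivization.mk_eq_mk_iff']
      refine ⟨c, ?_⟩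
      ext i
      fin_cases i <;> simp [ofVec, toVec]
      field_simp [rt_ne_zero]
  convert h2.preimage continuous_subtype_val using 1
  exact (preimage_image_eq _ Subtype.val_injective).symm

end Complement

section AffineCharts

open Set Topology Complex

instance : LocallyPathConnectedSpace Cpl := by
  have hopen : IsOpenMap fun v : cone => pt v := fun S hS => by
    have := isOpen_image_pt (S := Subtype.val '' S) (by simp)
      (isOpen_cone.isOpenMap_subtype_val S hS)
    rwa [image_image] at this
  have hq : IsQuotientMap fun v : cone => pt v :=
    IsOpenQuotientMap.isQuotientMap ⟨fun p => by
      obtain ⟨v, hv, h⟩ := pt_surjective p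
      exact ⟨⟨v, hv⟩, h⟩, continuousOn_pt.domRestrict, hopen⟩
  have := isOpen_cone.locallyPathConnectedSpace
  exact hq.locallyPathConnectedSpace

/-- The affine chart `x ≠ 0`. -/
def aff₁ (p : ℂ × ℂ) : Cpl := pt (1, p)

/-- The affine chart `y ≠ 0`. -/
def aff₂ (p : ℂ × ℂ) : Cpl := pt (p.1, 1, p.2)

/-- The domain of `aff₁`. -/
def dom₁ : Set (ℂ × ℂ) := {p | (1, p) ∈ cone}

/-- The domain of `aff₂`. -/
def dom₂ : Set (ℂ × ℂ) := {p | (p.1, 1, p.2) ∈ cone}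

theorem mem_dom₁ {p : ℂ × ℂ} : p ∈ dom₁ ↔
    3 + 2 * p.1 + p.2 ^ 2 ≠ 0 ∧ p.1 ^ 2 * (3 + 2 * p.1 + p.2 ^ 2) ≠ 1 := by
  simp [dom₁, cone, conic]

theorem mem_dom₂ {p : ℂ × ℂ} : p ∈ dom₂ ↔
    3 * p.1 ^ 2 + 2 * p.1 + p.2 ^ 2 ≠ 0 ∧ 3 * p.1 ^ 2 + 2 * p.1 + p.2 ^ 2 ≠ p.1 ^ 4 := by
  simp [dom₂, cone, conic]

theorem isChart_aff₁ : IsChart aff₁ dom₁ where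
  isOpen := isOpen_cone.preimage (by fun_prop)
  continuousOn := continuousOn_pt.comp (by fun_prop : Continuous fun p : ℂ × ℂ => ((1 : ℂ), p)
    ).continuousOn fun p hp => hp
  injOn := fun p hp q hq h => by
    obtain ⟨c, -, hc⟩ := (pt_eq_pt hp hq).1 h
    have h1 : (1 : ℂ) = c * 1 := congrArg Prod.fst hc
    rw [mul_one] at h1
    rw [← h1, one_smul] at hc
    exact (congrArg Prod.snd hc).symm
  isOpen_image S hS hSo := by
    have ho : IsOpen {v : ℂ × ℂ × ℂ | v.1 ≠ 0 ∧ v.1⁻¹ • v.2 ∈ S} := by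
      have hc : ContinuousOn (fun v : ℂ × ℂ × ℂ => v.1⁻¹ • v.2) {v | v.1 ≠ 0} :=
        (continuousOn_fst.inv₀ fun v hv => hv).smul continuousOn_snd
      exact hc.isOpen_inter_preimage (isOpen_ne_fun (by fun_prop) (by fun_prop)) hSo
    have hsub : {v : ℂ × ℂ × ℂ | v.1 ≠ 0 ∧ v.1⁻¹ • v.2 ∈ S} ⊆ cone := fun v hv => by
      have := smul_mem_cone hv.1 (hS hv.2)
      convert this using 1
      simp [hv.1]
    convert isOpen_image_pt hsub ho using 1
    apply Subset.antisymm
    · rintro _ ⟨p, hp, rfl⟩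
      exact ⟨(1, p), by simpa using hp, rfl⟩
    · rintro _ ⟨v, hv, rfl⟩
      refine ⟨_, hv.2, ?_⟩
      rw [aff₁, pt_eq_pt (hS hv.2) (hsub hv)]
      exact ⟨v.1, hv.1, by simp [hv.1]⟩

theorem isChart_aff₂ : IsChart aff₂ dom₂ where
  isOpen := isOpen_cone.preimage (by fun_prop)
  continuousOn := continuousOn_pt.comp (by fun_prop : Continuous fun p : ℂ × ℂ =>
    ((p.1, (1 : ℂ), p.2) : ℂ × ℂ × ℂ)).continuousOn fun p hp => hp
  injOn := fun p hp q hq h => by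
    obtain ⟨c, -, hc⟩ := (pt_eq_pt hp hq).1 h
    have h1 : (1 : ℂ) = c * 1 := congrArg (fun v => v.2.1) hc
    rw [mul_one] at h1
    rw [← h1, one_smul] at hc
    exact Prod.ext (congrArg Prod.fst hc).symm (congrArg (fun v => v.2.2) hc).symm
  isOpen_image S hS hSo := by
    have ho : IsOpen {v : ℂ × ℂ × ℂ | v.2.1 ≠ 0 ∧ v.2.1⁻¹ • (v.1, v.2.2) ∈ S} := by
      have hc : ContinuousOn (fun v : ℂ × ℂ × ℂ => v.2.1⁻¹ • (v.1, v.2.2)) {v | v.2.1 ≠ 0} :=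
        (ContinuousOn.inv₀ (by fun_prop) fun v hv => hv).smul (by fun_prop)
      exact hc.isOpen_inter_preimage (isOpen_ne_fun (by fun_prop) (by fun_prop)) hSo
    have hsub : {v : ℂ × ℂ × ℂ | v.2.1 ≠ 0 ∧ v.2.1⁻¹ • (v.1, v.2.2) ∈ S} ⊆ cone := fun v hv => by
      have := smul_mem_cone hv.1 (hS hv.2)
      convert this using 1
      simp [hv.1]
    convert isOpen_image_pt hsub ho using 1
    apply Subset.antisymm
    · rintro _ ⟨p, hp, rfl⟩
      exact ⟨(p.1, 1, p.2), by simpa using hp, rfl⟩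
    · rintro _ ⟨v, hv, rfl⟩
      refine ⟨_, hv.2, ?_⟩
      rw [aff₂, pt_eq_pt (hS hv.2) (hsub hv)]
      exact ⟨v.2.1, hv.1, by simp [hv.1]⟩

theorem aff₁_eq_aff₂ {y z : ℂ} (hy : y ≠ 0) (h : (y, z) ∈ dom₁) :
    aff₁ (y, z) = aff₂ (1 / y, z / y) ∧ (1 / y, z / y) ∈ dom₂ := by
  have h2 : y⁻¹ • ((1, y, z) : ℂ × ℂ × ℂ) = (1 / y, 1, z / y) := by
    simp [hy, div_eq_inv_mul]
  have h3 : (1 / y, z / y) ∈ dom₂ := by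
    have := smul_mem_cone (inv_ne_zero hy) h
    rwa [h2] at this
  refine ⟨?_, h3⟩
  rw [aff₁, aff₂, pt_eq_pt h h3]
  exact ⟨y⁻¹, inv_ne_zero hy, h2.symm⟩

theorem aff₂_eq_aff₁ {x z : ℂ} (hx : x ≠ 0) (h : (x, z) ∈ dom₂) :
    aff₂ (x, z) = aff₁ (1 / x, z / x) ∧ (1 / x, z / x) ∈ dom₁ := by
  have h2 : x⁻¹ • ((x, 1, z) : ℂ × ℂ × ℂ) = (1, 1 / x, z / x) := by
    simp [hx, div_eq_inv_mul]
  have h3 : (1 / x, z / x) ∈ dom₁ := by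
    have := smul_mem_cone (inv_ne_zero hx) h
    rwa [h2] at this
  refine ⟨?_, h3⟩
  rw [aff₁, aff₂, pt_eq_pt h h3]
  exact ⟨x⁻¹, inv_ne_zero hx, h2.symm⟩

theorem mem_image_aff (p : Cpl) :
    p ∈ aff₁ '' dom₁ ∨ ∃ z : ℂ, z ≠ 0 ∧ (0, z) ∈ dom₂ ∧ aff₂ (0, z) = p := by
  obtain ⟨⟨x, y, z⟩, hv, rfl⟩ := pt_surjective p
  by_cases hx : x = 0
  · subst hx
    right
    have hz : z ≠ 0 := by
      rintro rfl
      exact hv.1 (by simp [conic])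
    have hy : y ≠ 0 := by
      rintro rfl
      exact hv.2 (by simp [conic])
    have hc : y⁻¹ • ((0, y, z) : ℂ × ℂ × ℂ) = (0, 1, z / y) := by
      simp [hy, div_eq_inv_mul]
    have hm : ((0, z / y) : ℂ × ℂ) ∈ dom₂ := by
      have := smul_mem_cone (inv_ne_zero hy) hv
      rwa [hc] at this
    refine ⟨z / y, div_ne_zero hz hy, hm, ?_⟩
    rw [aff₂, eq_comm, pt_eq_pt hv hm]
    exact ⟨_, inv_ne_zero hy, hc.symm⟩
  · left
    have hc : x⁻¹ • ((x, y, z) : ℂ × ℂ × ℂ) = (1, y / x, z / x) := by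
      simp [hx, div_eq_inv_mul]
    have hm : ((y / x, z / x) : ℂ × ℂ) ∈ dom₁ := by
      have := smul_mem_cone (inv_ne_zero hx) hv
      rwa [hc] at this
    refine ⟨_, hm, ?_⟩
    rw [aff₁, eq_comm, pt_eq_pt hv hm]
    exact ⟨_, inv_ne_zero hx, hc.symm⟩

theorem aff₁_ne_aff₂ {p : ℂ × ℂ} (hp : p ∈ dom₁) {z : ℂ} (hz : (0, z) ∈ dom₂) :
    aff₁ p ≠ aff₂ (0, z) := by
  intro h
  obtain ⟨c, hc, h'⟩ := (pt_eq_pt hp hz).1 h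
  have : (0 : ℂ) = c * 1 := congrArg Prod.fst h'
  exact hc (by simpa using this.symm)

/-- The principal square root. -/
def csq (w : ℂ) : ℂ := w ^ (2⁻¹ : ℂ)

theorem csq_sq (w : ℂ) : csq w ^ 2 = w := by
  rw [csq]
  exact_mod_cast cpow_nat_inv_pow w (two_ne_zero)

theorem csq_sq_of_re_pos {w : ℂ} (hw : 0 < w.re) : csq (w ^ 2) = w := by
  rw [csq]
  exact Complex.sq_cpow_two_inv hw

theorem continuousAt_csq {w : ℂ} (hw : w ∈ slitPlane) : ContinuousAt csq w :=
  continuousAt_id.cpow continuousAt_const hw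

theorem re_csq_pos {w : ℂ} (hw : w ∈ slitPlane) : 0 < (csq w).re := by
  have h0 : w ≠ 0 := slitPlane_ne_zero hw
  rw [csq, cpow_def_of_ne_zero h0, exp_re]
  have h1 : (log w * 2⁻¹).im = arg w / 2 := by
    have : (2⁻¹ : ℂ) = ((2⁻¹ : ℝ) : ℂ) := by push_cast; rfl
    rw [this, im_mul_ofReal, log_im]
    ring
  refine mul_pos (Real.exp_pos _) (Real.cos_pos_of_mem_Ioo ⟨?_, ?_⟩) <;> rw [h1]
  · linarith [neg_pi_lt_arg w]
  · have : arg w < Real.pi := lt_of_le_of_ne (arg_le_pi w) (mem_slitPlane_iff_arg.1 hw).1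
    linarith

/-- The inverse of the double plane `(y, z) ↦ (y, 3 + 2y + z²)` on a half-space. -/
def sheet₀ (s : ℝ) (p : ℂ × ℂ) : ℂ × ℂ := (p.1, s * I * csq (3 + 2 * p.1 - p.2))

/-- The two branches of the inverse of the double plane, with values in the complement. -/
def sheet (s : ℝ) (p : ℂ × ℂ) : Cpl := aff₁ (sheet₀ s p)

/-- The domain of `sheet`. -/
def sheetDom : Set (ℂ × ℂ) := {p | p.2 ≠ 0 ∧ p.1 ^ 2 * p.2 ≠ 1 ∧ 3 + 2 * p.1 - p.2 ∈ slitPlane}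

theorem isOpen_sheetDom : IsOpen sheetDom :=
  (isOpen_ne_fun (by fun_prop) (by fun_prop)).inter
    ((isOpen_ne_fun (by fun_prop) (by fun_prop)).inter (isOpen_slitPlane.preimage (by fun_prop)))

theorem continuousOn_sheet₀ (s : ℝ) :
    ContinuousOn (sheet₀ s) {p | 3 + 2 * p.1 - p.2 ∈ slitPlane} := by
  intro p hp
  have h1 : ContinuousAt (fun p : ℂ × ℂ => csq (3 + 2 * p.1 - p.2)) p :=
    ContinuousAt.comp (f := fun p : ℂ × ℂ => 3 + 2 * p.1 - p.2) (continuousAt_csq hp)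
      (by fun_prop)
  exact (continuousAt_fst.prodMk (continuousAt_const.mul h1)).continuousWithinAt

theorem sheet₀_conic {s : ℝ} (hs : s ^ 2 = 1) (p : ℂ × ℂ) :
    3 + 2 * (sheet₀ s p).1 + (sheet₀ s p).2 ^ 2 = p.2 := by
  have h1 : (s : ℂ) ^ 2 = 1 := by exact_mod_cast hs
  simp only [sheet₀, mul_pow, h1, I_sq, csq_sq]
  ring

theorem sheet₀_im (s : ℝ) (p : ℂ × ℂ) :
    (sheet₀ s p).2.im = s * (csq (3 + 2 * p.1 - p.2)).re := by
  simp [sheet₀]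

theorem sheet₀_im_pos {s : ℝ} (hs : s ^ 2 = 1) {p : ℂ × ℂ}
    (hp : 3 + 2 * p.1 - p.2 ∈ slitPlane) : 0 < s * (sheet₀ s p).2.im := by
  rw [sheet₀_im, ← mul_assoc, ← sq, hs, one_mul]
  exact re_csq_pos hp

theorem sheet₀_conic_self {s : ℝ} (hs : s ^ 2 = 1) {q : ℂ × ℂ} (hq : 0 < s * q.2.im) :
    sheet₀ s (q.1, 3 + 2 * q.1 + q.2 ^ 2) = q := by
  have h1 : (s : ℂ) ^ 2 = 1 := by exact_mod_cast hs
  refine Prod.ext rfl ?_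
  have h2 : 3 + 2 * q.1 - (3 + 2 * q.1 + q.2 ^ 2) = (-I * s * q.2) ^ 2 := by
    rw [mul_pow, mul_pow, h1, neg_sq, I_sq]
    ring
  have h3 : 0 < (-I * s * q.2).re := by simpa using hq
  simp only [sheet₀]
  rw [h2, csq_sq_of_re_pos h3]
  linear_combination -s ^ 2 * q.2 * I_sq + q.2 * h1

theorem slit_of_im {s : ℝ} {q : ℂ × ℂ} (hq : 0 < s * q.2.im) :
    3 + 2 * q.1 - (3 + 2 * q.1 + q.2 ^ 2) ∈ slitPlane := by
  have h0 : q.2.im ≠ 0 := by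
    rintro h
    rw [h, mul_zero] at hq
    exact hq.false
  rw [show 3 + 2 * q.1 - (3 + 2 * q.1 + q.2 ^ 2) = -q.2 ^ 2 by ring, mem_slitPlane_iff]
  by_cases h : q.2.re = 0
  · left
    simp [sq, h, mul_self_pos.2 h0]
  · right
    simp [sq, h0, h, mul_comm q.2.im, ← two_mul]

theorem sheet₀_mem {s : ℝ} (hs : s ^ 2 = 1) {p : ℂ × ℂ} (hp : p ∈ sheetDom) :
    sheet₀ s p ∈ dom₁ := by
  rw [mem_dom₁, sheet₀_conic hs]
  exact ⟨hp.1, hp.2.1⟩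

theorem isChart_sheet₀ {s : ℝ} (hs : s ^ 2 = 1) : IsChart (sheet₀ s) sheetDom :=
  IsChart.of_inverse (R := {q | 0 < s * q.2.im}) (g := fun q => (q.1, 3 + 2 * q.1 + q.2 ^ 2))
    isOpen_sheetDom (isOpen_lt (by fun_prop) (by fun_prop))
    ((continuousOn_sheet₀ s).mono fun p hp => hp.2.2) (by fun_prop)
    (fun p hp => sheet₀_im_pos hs hp.2.2)
    (fun p hp => Prod.ext rfl (sheet₀_conic hs p))
    (fun q hq _ => sheet₀_conic_self hs hq)

theorem isChart_sheet {s : ℝ} (hs : s ^ 2 = 1) : IsChart (sheet s) sheetDom :=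
  isChart_aff₁.comp (isChart_sheet₀ hs) fun _ hp => sheet₀_mem hs hp

theorem sheet_eq_sheet {s s' : ℝ} (hs : s ^ 2 = 1) (hs' : s' ^ 2 = 1) {p q : ℂ × ℂ}
    (hp : p ∈ sheetDom) (hq : q ∈ sheetDom) (h : sheet s p = sheet s' q) : s = s' ∧ p = q := by
  have h0 := isChart_aff₁.injOn (sheet₀_mem hs hp) (sheet₀_mem hs' hq) h
  have h1 : p.2 = q.2 := by
    rw [← sheet₀_conic hs p, h0, sheet₀_conic hs' q]
  have h1 : p = q := Prod.ext (show (sheet₀ s p).1 = (sheet₀ s' q).1 from congrArg Prod.fst h0) h1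
  refine ⟨?_, h1⟩
  have h2 := sheet₀_im_pos hs hp.2.2
  have h3 := sheet₀_im_pos hs' hq.2.2
  rw [h0] at h2
  have h4 : s = 1 ∨ s = -1 := mul_self_eq_one_iff.1 (by rwa [← sq])
  have h5 : s' = 1 ∨ s' = -1 := mul_self_eq_one_iff.1 (by rwa [← sq])
  rcases h4 with rfl | rfl <;> rcases h5 with rfl | rfl <;> first | rfl | (exfalso; linarith)

theorem exists_sheet {s : ℝ} (hs : s ^ 2 = 1) {q : ℂ × ℂ} (hq : q ∈ dom₁) (h : 0 < s * q.2.im) :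
    ∃ p ∈ sheetDom, sheet₀ s p = q := by
  refine ⟨(q.1, 3 + 2 * q.1 + q.2 ^ 2), ?_, sheet₀_conic_self hs h⟩
  exact ⟨(mem_dom₁.1 hq).1, (mem_dom₁.1 hq).2, slit_of_im h⟩

end AffineCharts

section Lifts

open Set Topology

variable {E T : Type*} [TopologicalSpace E] [TopologicalSpace T]

/-- The class `d` is represented by the image under `f` of a path from `y` to `y'` inside `S`. -/
def LiftsIn (f : E → T) (S : Set E) (y y' : E) {p q : T} (d : Path.Homotopic.Quotient p q) :
    Prop :=
  ∃ γ : Path y y', (∀ t, γ t ∈ S) ∧ ∃ δ : Path p q, (∀ t, δ t = f (γ t)) ∧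
    Path.Homotopic.Quotient.mk δ = d

namespace LiftsIn

variable {f : E → T} {S : Set E} {y y' y'' : E} {p q r : T}

theorem trans {d : Path.Homotopic.Quotient p q} {e : Path.Homotopic.Quotient q r}
    (hd : LiftsIn f S y y' d) (he : LiftsIn f S y' y'' e) : LiftsIn f S y y'' (d.trans e) := by
  obtain ⟨γ, hγ, δ, hδ, rfl⟩ := hd
  obtain ⟨γ', hγ', δ', hδ', rfl⟩ := he
  refine ⟨γ.trans γ', mem_trans_path hγ hγ', δ.trans δ', fun t => ?_,
    Path.Homotopic.Quotient.mk_trans _ _⟩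
  rw [Path.trans_apply, Path.trans_apply]
  split_ifs
  · exact hδ _
  · exact hδ' _

theorem symm {d : Path.Homotopic.Quotient p q} (hd : LiftsIn f S y y' d) :
    LiftsIn f S y' y d.symm := by
  obtain ⟨γ, hγ, δ, hδ, rfl⟩ := hd
  exact ⟨γ.symm, fun t => hγ _, δ.symm, fun t => hδ _, Path.Homotopic.Quotient.mk_symm _⟩

theorem refl (hy : y ∈ S) (hp : f y = p) :
    LiftsIn f S y y (Path.Homotopic.Quotient.refl p) :=
  ⟨Path.refl y, fun _ => hy, Path.refl p, fun _ => hp.symm, rfl⟩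

theorem of_path {δ : Path p q} (γ : C(unitInterval, E)) (hγ : ∀ t, γ t ∈ S)
    (h : ∀ t, δ t = f (γ t)) (h0 : γ 0 = y) (h1 : γ 1 = y') :
    LiftsIn f S y y' (Path.Homotopic.Quotient.mk δ) :=
  ⟨⟨γ, h0, h1⟩, hγ, δ, h, rfl⟩

theorem unique (hS : IsSimplyConnected S) (hf : ContinuousOn f S)
    {d e : Path.Homotopic.Quotient p q} (hd : LiftsIn f S y y' d) (he : LiftsIn f S y y' e) :
    d = e := by
  have := hS.simplyConnectedSpace
  obtain ⟨γ, hγ, δ, hδ, rfl⟩ := hd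
  obtain ⟨γ', hγ', δ', hδ', rfl⟩ := he
  obtain rfl : f y = p := by simpa using (hδ 0).symm
  obtain rfl : f y' = q := by simpa using (hδ 1).symm
  let F : C(S, T) := ⟨S.domRestrict f, hf.domRestrict⟩
  let a : S := ⟨y, by simpa using hγ 0⟩
  let b : S := ⟨y', by simpa using hγ 1⟩
  let κ : Path a b := ⟨⟨fun t => ⟨γ t, hγ t⟩, by fun_prop⟩, by simp [a], by simp [b]⟩
  let κ' : Path a b := ⟨⟨fun t => ⟨γ' t, hγ' t⟩, by fun_prop⟩, by simp [a], by simp [b]⟩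
  have h := mk_map_eq_mk_map F κ κ'
  have h1 : δ = κ.map F.continuous := Path.ext (funext hδ)
  have h2 : δ' = κ'.map F.continuous := Path.ext (funext hδ')
  rw [h1, h2]
  exact h

theorem exists_of_mem (hS : IsSimplyConnected S) (hf : ContinuousOn f S) (hy : y ∈ S)
    (hy' : y' ∈ S) : ∃ d : Path.Homotopic.Quotient (f y) (f y'), LiftsIn f S y y' d := by
  have := hS.simplyConnectedSpace
  obtain ⟨γ⟩ := PathConnectedSpace.joined (⟨y, hy⟩ : S) ⟨y', hy'⟩
  exact ⟨_, γ.map continuous_subtype_val, fun t => (γ t).2,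
    ⟨⟨fun t => f (γ t), hf.comp_continuous (by fun_prop) fun t => (γ t).2⟩, by simp, by simp⟩,
    fun t => rfl, rfl⟩

end LiftsIn

end Lifts

section LogCover

open Set Topology Complex

/-- The part of the base of the double plane over which the conic has a single-valued meridian. -/
def baseDom : Set (ℂ × ℂ) :=
  {p | p.2 ≠ 0 ∧ 1 - p.1 ^ 2 * p.2 ∈ slitPlane ∧ 3 + 2 * p.1 - p.2 ∈ slitPlane}

theorem baseDom_subset : baseDom ⊆ sheetDom := fun p hp =>
  ⟨hp.1, fun h => slitPlane_ne_zero hp.2.1 (by rw [h, sub_self]), hp.2.2⟩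

theorem isOpen_baseDom : IsOpen baseDom :=
  (isOpen_ne_fun (by fun_prop) (by fun_prop)).inter
    ((isOpen_slitPlane.preimage (by fun_prop)).inter (isOpen_slitPlane.preimage (by fun_prop)))

/-- The map unwinding the meridian of the conic. -/
def expMap (p : ℂ × ℂ) : ℂ × ℂ := (p.1, exp p.2)

theorem continuous_expMap : Continuous expMap := by
  unfold expMap
  fun_prop

/-- The infinite cyclic cover of `baseDom`. -/
def logDom : Set (ℂ × ℂ) := expMap ⁻¹' baseDom

theorem shrink_mem_logDom {p : ℂ × ℂ} (hp : p ∈ logDom) {s : ℝ} (hs : 0 ≤ s) :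
    ((Real.exp (-s) : ℂ) * p.1, p.2 - s) ∈ logDom := by
  have he : exp (p.2 - s) = (Real.exp (-s) : ℝ) * exp p.2 := by
    rw [ofReal_exp, ← exp_add]
    push_cast
    ring_nf
  have h0 : 0 < Real.exp (-s) := Real.exp_pos _
  have h1 : Real.exp (-s) ≤ 1 := Real.exp_le_one_iff.2 (by linarith)
  refine ⟨exp_ne_zero _, ?_, ?_⟩
  · have h3 : Real.exp (-s) ^ 3 ≤ 1 := pow_le_one₀ h0.le h1
    have := starConvex_one_slitPlane hp.2.1 (sub_nonneg.2 h3) (pow_pos h0 3).le (by ring)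
    simp only [expMap, he]
    convert this using 1
    simp only [real_smul, expMap]
    push_cast
    ring
  · have := starConvex_ofReal_slitPlane (x := 3) (by norm_num) hp.2.2 (sub_nonneg.2 h1) h0.le
      (by ring)
    simp only [expMap, he]
    convert this using 1
    simp only [real_smul, expMap]
    push_cast
    ring

theorem small_mem_logDom {p : ℂ × ℂ} (h1 : ‖p.1‖ < 1 / 4) (h2 : p.2.re < 0) : p ∈ logDom := by
  have hn : ‖exp p.2‖ < 1 := by rwa [norm_exp, Real.exp_lt_one_iff]
  have h3 : ‖p.1‖ ^ 2 ≤ 1 := pow_le_one₀ (norm_nonneg _) (by linarith)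
  refine ⟨exp_ne_zero _, ?_, Or.inl ?_⟩
  · rw [sub_eq_add_neg]
    apply mem_slitPlane_of_norm_lt_one
    rw [norm_neg, norm_mul, norm_pow]
    exact (mul_le_of_le_one_left (norm_nonneg _) h3).trans_lt hn
  · have h4 := (abs_le.1 (abs_re_le_norm p.1)).1
    have h5 := re_le_norm (exp p.2)
    simp only [expMap, sub_re, add_re, mul_re, re_ofNat, im_ofNat]
    linarith

theorem isSimplyConnected_logDom : IsSimplyConnected logDom := by
  have hb : ((0, -1) : ℂ × ℂ) ∈ logDom := small_mem_logDom (by simp) (by simp)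
  let S : ℂ × ℂ → ℝ := fun p => ‖p.1‖ + |p.2.re| + 2
  have hS : ∀ p, 0 ≤ S p := fun p => by positivity
  have hSc : Continuous S := by fun_prop
  let e : ℂ × ℂ → ℂ × ℂ := fun p => ((Real.exp (-S p) : ℂ) * p.1, p.2 - S p)
  have hec : Continuous e := by fun_prop
  have he1 : ∀ p, ‖(e p).1‖ < 1 / 4 := fun p => by
    have h1 : (4 : ℝ) < Real.exp 2 := by
      have := Real.add_one_lt_exp (x := 1) one_ne_zero
      rw [show (2 : ℝ) = 1 + 1 by norm_num, Real.exp_add]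
      nlinarith
    have h2 : ‖p.1‖ < Real.exp (‖p.1‖ + |p.2.re|) := by
      have := Real.add_one_le_exp (‖p.1‖ + |p.2.re|)
      have := abs_nonneg p.2.re
      linarith
    simp only [e, norm_mul, norm_real, Real.norm_eq_abs, Real.abs_exp]
    rw [Real.exp_neg, inv_mul_lt_iff₀ (Real.exp_pos _), Real.exp_add]
    nlinarith [norm_nonneg p.1]
  have he2 : ∀ p, (e p).2.re < 0 := fun p => by
    have := le_abs_self p.2.re
    have := norm_nonneg p.1
    simp only [e, S, sub_re, ofReal_re]
    linarith
  let f : C(logDom, logDom) := ⟨fun p => ⟨e p, small_mem_logDom (he1 _) (he2 _)⟩, by fun_prop⟩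
  have H1 : (ContinuousMap.id logDom).Homotopic f :=
    ⟨⟨⟨fun u => ⟨((Real.exp (-(u.1 * S u.2) : ℝ) : ℂ) * u.2.1.1, u.2.1.2 - (u.1 * S u.2 : ℝ)),
      shrink_mem_logDom u.2.2 (mul_nonneg u.1.2.1 (hS _))⟩, by fun_prop⟩,
      fun p => by simp, fun p => by simp [f, e]⟩⟩
  have H2 : f.Homotopic (ContinuousMap.const _ ⟨(0, -1), hb⟩) :=
    ⟨⟨⟨fun u => ⟨(1 - (u.1 : ℝ)) • e u.2 + (u.1 : ℝ) • (0, -1), by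
      have hc : Convex ℝ {p : ℂ × ℂ | ‖p.1‖ < 1 / 4 ∧ p.2.re < 0} := by
        have h1 : Convex ℝ {p : ℂ × ℂ | ‖p.1‖ < 1 / 4} := fun p hp q hq a b ha hb hab =>
          mem_ball_zero_iff.1 (convex_ball (0 : ℂ) (1 / 4) (mem_ball_zero_iff.2 hp)
            (mem_ball_zero_iff.2 hq) ha hb hab)
        exact h1.inter (convex_halfSpace_lt (LinearMap.isLinear (reLm ∘ₗ LinearMap.snd ℝ ℂ ℂ)) 0)
      have := hc (show e u.2 ∈ _ from ⟨he1 _, he2 _⟩)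
        (show ((0, -1) : ℂ × ℂ) ∈ _ from ⟨by simp, by simp⟩) (sub_nonneg.2 u.1.2.2) u.1.2.1
        (by ring)
      exact small_mem_logDom this.1 this.2⟩, by fun_prop⟩,
      fun p => by simp [f], fun p => by simp⟩⟩
  have : ContractibleSpace logDom :=
    (contractible_iff_id_nullhomotopic _).2 ⟨_, H1.trans H2⟩
  exact SimplyConnectedSpace.ofContractible logDom

/-- The sheet pulled back to the cyclic cover. -/
def logSheet (s : ℝ) (p : ℂ × ℂ) : Cpl := sheet s (expMap p)

theorem continuousOn_logSheet {s : ℝ} (hs : s ^ 2 = 1) : ContinuousOn (logSheet s) logDom :=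
  (isChart_sheet hs).continuousOn.comp continuous_expMap.continuousOn fun _ hp => baseDom_subset hp

end LogCover

section Loops

open Set Topology Complex
open scoped Real

/-- The point of the unit circle with argument `θ`. -/
def cis (θ : ℝ) : ℂ := exp (θ * I)

@[fun_prop]
theorem continuous_cis : Continuous cis := by
  unfold cis
  fun_prop

theorem cis_re (θ : ℝ) : (cis θ).re = Real.cos θ := exp_ofReal_mul_I_re θ

theorem cis_im (θ : ℝ) : (cis θ).im = Real.sin θ := exp_ofReal_mul_I_im θ

theorem norm_cis (θ : ℝ) : ‖cis θ‖ = 1 := norm_exp_ofReal_mul_I θ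

theorem cis_ne_zero (θ : ℝ) : cis θ ≠ 0 := exp_ne_zero _

theorem cis_zero : cis 0 = 1 := by simp [cis]

theorem cis_add (θ φ : ℝ) : cis (θ + φ) = cis θ * cis φ := by
  simp [cis, add_mul, exp_add]

theorem cis_pi : cis π = -1 := by simp [cis]

theorem cis_two_pi : cis (2 * π) = 1 := by
  rw [two_mul, cis_add, cis_pi]
  norm_num

theorem cis_neg_mul (θ : ℝ) : cis (-θ) * cis θ = 1 := by
  rw [← cis_add, neg_add_cancel, cis_zero]

theorem cis_int (k : ℤ) (θ : ℝ) : cis (θ + k * (2 * π)) = cis θ := by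
  have h : exp ((k * (2 * π) : ℝ) * I) = 1 := by
    rw [← exp_int_mul_two_pi_mul_I k]
    push_cast
    ring_nf
  rw [cis_add]
  simp only [cis] at *
  rw [h, mul_one]

theorem exp_ofReal_add (a θ : ℝ) : exp (a + θ * I) = Real.exp a * cis θ := by
  rw [exp_add, cis, ofReal_exp]

/-- The base point of a sheet. -/
def basePt (s : ℝ) : Cpl := sheet s (64, -64)

/-- A loop on a sheet, over a loop in the line `y = 64`. -/
def sheetPath {s : ℝ} (hs : s ^ 2 = 1) (F : C(ℝ, ℂ)) (hm : ∀ θ, (64, F θ) ∈ sheetDom)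
    (h0 : F 0 = -64) (h1 : F (2 * π) = -64) : Path (basePt s) (basePt s) where
  toFun t := sheet s (64, F (2 * π * t))
  continuous_toFun := (isChart_sheet hs).continuousOn.comp_continuous (by fun_prop) fun t => hm _
  source' := by simp [basePt, h0]
  target' := by simp [basePt, h1]

theorem sheetDom_of_norm_le {F : ℂ} (h0 : F ≠ 0) (h1 : 64 ^ 2 * F ≠ 1) (h : ‖F‖ ≤ 64) :
    ((64, F) : ℂ × ℂ) ∈ sheetDom := by
  refine ⟨h0, h1, Or.inl ?_⟩
  have := re_le_norm F
  simp only [sub_re, add_re, mul_re, re_ofNat, im_ofNat]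
  linarith

/-- The conic along the meridian of the quartic. -/
def mF : C(ℝ, ℂ) := ⟨fun θ => -64 * cis θ, by fun_prop⟩

/-- The modulus of the conic along its meridian. -/
def bRad (θ : ℝ) : ℝ := (1 + 1 / 2 ^ 19 + (1 - 1 / 2 ^ 19) * Real.cos θ) / 2

/-- The conic along its meridian. -/
def bF : C(ℝ, ℂ) := ⟨fun θ => -64 * bRad θ * cis θ, by unfold bRad; fun_prop⟩

theorem bRad_pos (θ : ℝ) : 0 < bRad θ := by
  have := Real.neg_one_le_cos θ
  unfold bRad
  linarith

theorem bRad_le (θ : ℝ) : bRad θ ≤ 1 := by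
  have := Real.cos_le_one θ
  unfold bRad
  linarith

theorem norm_mF (θ : ℝ) : ‖mF θ‖ = 64 := by simp [mF, norm_cis]

theorem norm_bF (θ : ℝ) : ‖bF θ‖ ≤ 64 := by
  have := bRad_le θ
  simp only [bF, ContinuousMap.coe_mk, norm_mul, norm_neg, norm_cis, norm_real, Real.norm_eq_abs,
    abs_of_pos (bRad_pos θ), RCLike.norm_ofNat]
  linarith

theorem mF_mem (θ : ℝ) : (64, mF θ) ∈ sheetDom := by
  have h := norm_mF θ
  refine sheetDom_of_norm_le (fun h0 => ?_) (fun h1 => ?_) h.le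
  · rw [h0] at h
    norm_num at h
  · have h1 := congrArg norm h1
    rw [norm_mul, h] at h1
    norm_num at h1

theorem bF_mem_baseDom (θ : ℝ) : (64, bF θ) ∈ baseDom := by
  have h0 : bF θ ≠ 0 := by
    simp [bF, (bRad_pos θ).ne', cis_ne_zero]
  refine ⟨h0, ?_, ?_⟩
  · have e : 1 - 64 ^ 2 * bF θ = ((1 : ℝ) : ℂ) + ((2 ^ 18 * bRad θ : ℝ) : ℂ) * cis θ := by
      simp only [bF, ContinuousMap.coe_mk]
      push_cast
      ring
    rw [e, mem_slitPlane_iff, add_re, add_im, re_ofReal_mul, im_ofReal_mul, cis_re, cis_im,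
      ofReal_re, ofReal_im, zero_add]
    by_contra! h
    have h1 := bRad_pos θ
    have hs : Real.sin θ = 0 := by
      rcases mul_eq_zero.1 h.2 with h2 | h2
      · linarith
      · exact h2
    have hc := Real.sin_sq_add_cos_sq θ
    rw [hs] at hc
    have hc : (Real.cos θ - 1) * (Real.cos θ + 1) = 0 := by linarith
    rcases mul_eq_zero.1 hc with h2 | h2
    · rw [sub_eq_zero.1 h2] at h
      linarith
    · rw [eq_neg_of_add_eq_zero_left h2, bRad, eq_neg_of_add_eq_zero_left h2] at h
      norm_num at h
  · have := re_le_norm (bF θ)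
    have := norm_bF θ
    left
    simp only [sub_re, add_re, mul_re, re_ofNat, im_ofNat]
    linarith

/-- The meridian of the quartic. -/
def mPath {s : ℝ} (hs : s ^ 2 = 1) : Path (basePt s) (basePt s) :=
  sheetPath hs mF mF_mem (by simp [mF, cis_zero]) (by simp [mF, cis_two_pi])

/-- The meridian of the conic. -/
def bPath {s : ℝ} (hs : s ^ 2 = 1) : Path (basePt s) (basePt s) :=
  sheetPath hs bF (fun θ => baseDom_subset (bF_mem_baseDom θ))
    (by simp [bF, cis_zero, bRad]) (by simp [bF, cis_two_pi, bRad])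

/-- The lifts of the base point to the cyclic cover. -/
def logPt (k : ℤ) : ℂ × ℂ := (64, (Real.log 64 : ℝ) + ((π + k * (2 * π) : ℝ) : ℂ) * I)

theorem bPath_liftsIn {s : ℝ} (hs : s ^ 2 = 1) (k : ℤ) :
    LiftsIn (logSheet s) logDom (logPt k) (logPt (k + 1))
      (Path.Homotopic.Quotient.mk (bPath hs)) := by
  let γ : C(unitInterval, ℂ × ℂ) := ⟨fun t => (64, (Real.log 64 + Real.log (bRad (2 * π * t)) : ℝ) +
    ((π + (2 * π * t) + k * (2 * π) : ℝ) : ℂ) * I), by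
      have : Continuous fun t : unitInterval => Real.log (bRad (2 * π * t)) :=
        (by unfold bRad; fun_prop : Continuous fun t : unitInterval => bRad (2 * π * t)).log
          fun t => (bRad_pos _).ne'
      fun_prop⟩
  have h : ∀ t, expMap (γ t) = (64, bF (2 * π * t)) := fun t => by
    simp only [expMap, γ, ContinuousMap.coe_mk, bF]
    rw [exp_ofReal_add, cis_int, cis_add, cis_pi, Real.exp_add, Real.exp_log (by norm_num),
      Real.exp_log (bRad_pos _)]
    push_cast
    ring_nf
  refine LiftsIn.of_path γ (fun t => ?_) (fun t => ?_) ?_ ?_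
  · rw [logDom, mem_preimage, h]
    exact bF_mem_baseDom _
  · rw [logSheet, h]
    rfl
  · simp only [γ, logPt, bRad, ContinuousMap.coe_mk]
    norm_num
  · simp only [γ, logPt, bRad, ContinuousMap.coe_mk]
    norm_num
    ring

/-- A simply connected neighbourhood of the point at infinity where the conic touches the
quartic, minus the curve, unwound around the conic. -/
def wDom : Set (ℂ × ℂ) :=
  {p | (Real.log (1 / 128) < p.1.re ∧ p.1.re < Real.log (3 / 64)) ∧ ‖p.2‖ ^ 2 < 5 / 64}

/-- The map from `wDom` to the complement. -/
def wMap (p : ℂ × ℂ) : Cpl := aff₂ ((csq (1 + 3 * (exp p.1 - p.2 ^ 2)) - 1) / 3, p.2)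

theorem isSimplyConnected_wDom : IsSimplyConnected wDom := by
  have h1 : Convex ℝ {p : ℂ × ℂ | ‖p.2‖ ^ 2 < 5 / 64} := by
    have : {p : ℂ × ℂ | ‖p.2‖ ^ 2 < 5 / 64} = {p : ℂ × ℂ | ‖p.2‖ < Real.sqrt (5 / 64)} := by
      ext p
      exact (Real.lt_sqrt (norm_nonneg _)).symm
    rw [this]
    exact fun p hp q hq a b ha hb hab =>
      mem_ball_zero_iff.1 (convex_ball (0 : ℂ) _ (mem_ball_zero_iff.2 hp)
        (mem_ball_zero_iff.2 hq) ha hb hab)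
  have hl : IsLinearMap ℝ fun p : ℂ × ℂ => p.1.re :=
    LinearMap.isLinear (reLm ∘ₗ LinearMap.fst ℝ ℂ ℂ)
  have hc : Convex ℝ wDom :=
    ((convex_halfSpace_gt hl _).inter (convex_halfSpace_lt hl _)).inter h1
  refine hc.simplyConnectedSpace' ⟨((Real.log (1 / 64) : ℝ), 0), ⟨?_, ?_⟩, by simp⟩
  · exact Real.log_lt_log (by norm_num) (by norm_num)
  · exact Real.log_lt_log (by norm_num) (by norm_num)

theorem wDom_mem {p : ℂ × ℂ} (hp : p ∈ wDom) :
    1 + 3 * (exp p.1 - p.2 ^ 2) ∈ slitPlane ∧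
      ((csq (1 + 3 * (exp p.1 - p.2 ^ 2)) - 1) / 3, p.2) ∈ dom₂ := by
  obtain ⟨⟨h1, h2⟩, h3⟩ := hp
  have h4 : 1 / 128 < ‖exp p.1‖ := by
    rwa [norm_exp, ← Real.log_lt_iff_lt_exp (by norm_num)]
  have h5 : ‖exp p.1‖ < 3 / 64 := by
    rwa [norm_exp, ← Real.lt_log_iff_exp_lt (by norm_num)]
  set w := exp p.1 - p.2 ^ 2 with hw
  have h6 : ‖w‖ < 1 / 8 := by
    have := norm_sub_le (exp p.1) (p.2 ^ 2)
    rw [norm_pow] at this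
    linarith
  have h7 : 1 + 3 * w ∈ slitPlane := by
    apply mem_slitPlane_of_norm_lt_one
    rw [norm_mul, RCLike.norm_ofNat]
    linarith
  refine ⟨h7, ?_⟩
  set x := (csq (1 + 3 * w) - 1) / 3 with hx
  have h8 : csq (1 + 3 * w) = 3 * x + 1 := by
    rw [hx]
    ring
  have h9 : x * (3 * x + 2) = w := by
    have := csq_sq (1 + 3 * w)
    rw [h8] at this
    linear_combination this / 3
  have h10 : ‖x‖ ≤ ‖w‖ := by
    have h11 := re_csq_pos h7
    have h12 := re_le_norm (3 * x + 2)
    rw [h8] at h11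
    rw [← h9, norm_mul]
    refine le_mul_of_one_le_right (norm_nonneg _) (le_trans ?_ h12)
    simp only [add_re, mul_re, re_ofNat, im_ofNat, one_re] at h11 ⊢
    linarith
  have h13 : 3 * x ^ 2 + 2 * x + p.2 ^ 2 = exp p.1 := by
    rw [hw] at h9
    linear_combination h9
  rw [mem_dom₂]
  simp only [h13]
  refine ⟨exp_ne_zero _, fun h => ?_⟩
  rw [h, norm_pow] at h4
  have : ‖x‖ ^ 4 ≤ (1 / 8) ^ 4 := by gcongr; linarith
  norm_num at this
  linarith

theorem continuousOn_wMap : ContinuousOn wMap wDom := by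
  refine isChart_aff₂.continuousOn.comp (f := fun p : ℂ × ℂ =>
    ((csq (1 + 3 * (exp p.1 - p.2 ^ 2)) - 1) / 3, p.2)) (fun p hp => ?_)
    fun p hp => (wDom_mem hp).2
  have h1 : ContinuousAt (fun p : ℂ × ℂ => csq (1 + 3 * (exp p.1 - p.2 ^ 2))) p :=
    ContinuousAt.comp (f := fun p : ℂ × ℂ => 1 + 3 * (exp p.1 - p.2 ^ 2))
      (continuousAt_csq (wDom_mem hp).1) (by fun_prop)
  exact (((h1.sub continuousAt_const).div_const 3).prodMk continuousAt_snd).continuousWithinAt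

theorem wMap_eq {s : ℝ} (hs : s ^ 2 = 1) {y F l : ℂ} (hm : (y, F) ∈ sheetDom) (hy : ‖y‖ = 64)
    (h1 : 64 ≤ ‖F‖) (h2 : ‖F‖ ≤ 128) (hl : exp l = F / y ^ 2) :
    (l, (sheet₀ s (y, F)).2 / y) ∈ wDom ∧ wMap (l, (sheet₀ s (y, F)).2 / y) = sheet s (y, F) := by
  have hy0 : y ≠ 0 := by
    rintro rfl
    norm_num at hy
  have hc := sheet₀_conic hs (y, F)
  have hz : sheet₀ s (y, F) = (y, (sheet₀ s (y, F)).2) := rfl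
  have hd := sheet₀_mem hs hm
  rw [sheet]
  rw [hz] at hc hd ⊢
  set z := (sheet₀ s (y, F)).2 with hzd
  have hn : ‖exp l‖ = ‖F‖ / 64 ^ 2 := by rw [hl, norm_div, norm_pow, hy]
  rw [norm_exp] at hn
  constructor
  · refine ⟨⟨?_, ?_⟩, ?_⟩
    · rw [Real.log_lt_iff_lt_exp (by norm_num), hn]
      linarith
    · rw [Real.lt_log_iff_exp_lt (by norm_num), hn]
      linarith
    · have h3 : z ^ 2 = F - 3 - 2 * y := by linear_combination hc
      have h4 : ‖F - 3 - 2 * y‖ ≤ 128 + 3 + 2 * 64 := by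
        refine (norm_sub_le _ _).trans (add_le_add ((norm_sub_le _ _).trans ?_) ?_)
        · rw [RCLike.norm_ofNat]
          linarith
        · rw [norm_mul, hy, RCLike.norm_ofNat]
      simp only
      rw [norm_div, div_pow, ← norm_pow, h3, hy]
      linarith
  · rw [(aff₁_eq_aff₂ hy0 hd).1, wMap]
    have h5 : 1 + 3 * (exp l - (z / y) ^ 2) = (1 + 3 * (1 / y)) ^ 2 := by
      rw [hl]
      field_simp
      linear_combination -3 * hc
    have h6 : 0 < (1 + 3 * (1 / y)).re := by
      have h7 : ‖3 * (1 / y)‖ < 1 := by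
        rw [norm_mul, norm_div, hy, RCLike.norm_ofNat]
        norm_num
      have := (abs_le.1 (abs_re_le_norm (3 * (1 / y)))).1
      rw [add_re, one_re]
      linarith
    simp only
    rw [h5, csq_sq_of_re_pos h6]
    congr 2
    ring

end Loops

section Relation

open Set Topology Complex
open scoped Real

/-- The lifts of the base point to `wDom`. -/
def wPt (s : ℝ) (k : ℤ) : ℂ × ℂ :=
  ((-Real.log 64 : ℝ) + ((π + k * (2 * π) : ℝ) : ℂ) * I, (sheet₀ s (64, -64)).2 / 64)

theorem mPath_liftsIn {s : ℝ} (hs : s ^ 2 = 1) (k : ℤ) :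
    LiftsIn wMap wDom (wPt s k) (wPt s (k + 1)) (Path.Homotopic.Quotient.mk (mPath hs)) := by
  have hc : Continuous fun t : unitInterval => (sheet₀ s (64, mF (2 * π * t))).2 :=
    continuous_snd.comp ((continuousOn_sheet₀ s).comp_continuous
      (by fun_prop : Continuous fun t : unitInterval => ((64, mF (2 * π * t)) : ℂ × ℂ))
      fun t => (mF_mem _).2.2)
  let γ : C(unitInterval, ℂ × ℂ) := ⟨fun t => ((-Real.log 64 : ℝ) +
    ((π + (2 * π * t) + k * (2 * π) : ℝ) : ℂ) * I, (sheet₀ s (64, mF (2 * π * t))).2 / 64), by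
      fun_prop⟩
  have h : ∀ t, γ t ∈ wDom ∧ wMap (γ t) = sheet s (64, mF (2 * π * t)) := fun t => by
    refine wMap_eq hs (mF_mem _) (by simp) (norm_mF _).ge (by rw [norm_mF]; norm_num) ?_
    rw [exp_ofReal_add, cis_int, cis_add, cis_pi, Real.exp_neg, Real.exp_log (by norm_num)]
    simp only [mF, ContinuousMap.coe_mk]
    push_cast
    ring
  refine LiftsIn.of_path γ (fun t => (h t).1) (fun t => (h t).2.symm) ?_ ?_
  · simp [γ, wPt, mF, cis_zero]
  · simp only [γ, wPt, mF, ContinuousMap.coe_mk, Icc.coe_one, mul_one, cis_two_pi]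
    push_cast
    ring_nf

/-- The modulus of the conic along the loop proving the relation. -/
def etaRad (θ : ℝ) : ℝ := (3 - Real.cos θ) / 2

theorem etaRad_pos (θ : ℝ) : 0 < etaRad θ := by
  have := Real.cos_le_one θ
  unfold etaRad
  linarith

theorem one_le_etaRad (θ : ℝ) : 1 ≤ etaRad θ := by
  have := Real.cos_le_one θ
  unfold etaRad
  linarith

theorem etaRad_le (θ : ℝ) : etaRad θ ≤ 2 := by
  have := Real.neg_one_le_cos θ
  unfold etaRad
  linarith

/-- A loop in the base of the double plane which is at the same time the square of the meridian
of the conic and the fourth power of the meridian of the quartic. -/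
def etaFun : C(ℝ, ℂ × ℂ) := ⟨fun θ => (64 * cis (-θ), -64 * etaRad θ * cis (2 * θ)), by
  unfold etaRad
  fun_prop⟩

theorem etaFun_mem (θ : ℝ) : etaFun θ ∈ baseDom := by
  have hs := Real.sin_sq_add_cos_sq θ
  refine ⟨by simp [etaFun, (etaRad_pos θ).ne', cis_ne_zero], ?_, ?_⟩
  · have h : 1 - (etaFun θ).1 ^ 2 * (etaFun θ).2 = ((1 + 64 ^ 3 * etaRad θ : ℝ) : ℂ) := by
      have := cis_neg_mul θ
      simp only [etaFun, ContinuousMap.coe_mk]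
      rw [two_mul, cis_add]
      push_cast
      linear_combination (64 ^ 3 * etaRad θ) * (1 + cis (-θ) * cis θ) * this
    rw [h, ofReal_mem_slitPlane]
    have := etaRad_pos θ
    positivity
  · have h : 3 + 2 * (etaFun θ).1 - (etaFun θ).2 =
        ((3 : ℝ) : ℂ) + ((128 : ℝ) : ℂ) * cis (-θ) + ((64 * etaRad θ : ℝ) : ℂ) * cis (2 * θ) := by
      simp only [etaFun, ContinuousMap.coe_mk]
      push_cast
      ring
    rw [h, mem_slitPlane_iff]
    simp only [add_re, add_im, re_ofReal_mul, im_ofReal_mul, cis_re, cis_im, ofReal_re, ofReal_im,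
      Real.cos_neg, Real.sin_neg, Real.cos_two_mul, Real.sin_two_mul, zero_add]
    by_contra! h
    obtain ⟨h1, h2⟩ := h
    simp only [etaRad] at h1 h2
    have h3 : Real.sin θ * ((Real.cos θ - 1) * (Real.cos θ - 2)) = 0 := by
      linear_combination -h2 / 64
    have h4 : (Real.cos θ - 1) * (Real.cos θ + 1) = 0 := by
      rcases mul_eq_zero.1 h3 with h4 | h4
      · rw [h4] at hs
        linear_combination hs
      · rcases mul_eq_zero.1 h4 with h5 | h5
        · rw [h5, zero_mul]
        · linarith [Real.cos_le_one θ]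
    rcases mul_eq_zero.1 h4 with h5 | h5
    · rw [sub_eq_zero.1 h5] at h1
      norm_num at h1
    · rw [eq_neg_of_add_eq_zero_left h5] at h1
      norm_num at h1

theorem etaFun_zero : etaFun 0 = (64, -64) := by
  simp [etaFun, cis_zero, etaRad]
  norm_num

theorem etaFun_two_pi : etaFun (2 * π) = (64, -64) := by
  have h1 : cis (-(2 * π)) = 1 := by
    have := cis_int (-1) 0
    simpa [cis_zero] using this
  have h2 : cis (2 * (2 * π)) = 1 := by
    have := cis_int 2 0
    simpa [cis_zero] using this
  simp [etaFun, h1, h2, etaRad]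
  norm_num

theorem continuousOn_sheet {s : ℝ} (hs : s ^ 2 = 1) : ContinuousOn (sheet s) sheetDom :=
  (isChart_sheet hs).continuousOn

/-- The loop `etaFun` on a sheet. -/
def etaPath {s : ℝ} (hs : s ^ 2 = 1) : Path (basePt s) (basePt s) where
  toFun t := sheet s (etaFun (2 * π * t))
  continuous_toFun := (continuousOn_sheet hs).comp_continuous (by fun_prop) fun t =>
    baseDom_subset (etaFun_mem _)
  source' := by simp [basePt, etaFun_zero]
  target' := by simp [basePt, etaFun_two_pi]

theorem etaPath_liftsIn_logDom {s : ℝ} (hs : s ^ 2 = 1) :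
    LiftsIn (logSheet s) logDom (logPt 0) (logPt 2)
      (Path.Homotopic.Quotient.mk (etaPath hs)) := by
  let γ : C(unitInterval, ℂ × ℂ) := ⟨fun t => (64 * cis (-(2 * π * t)),
    (Real.log 64 + Real.log (etaRad (2 * π * t)) : ℝ) +
    ((π + 2 * (2 * π * t) : ℝ) : ℂ) * I), by
      have : Continuous fun t : unitInterval => Real.log (etaRad (2 * π * t)) :=
        (by unfold etaRad; fun_prop : Continuous fun t : unitInterval => etaRad (2 * π * t)).log
          fun t => (etaRad_pos _).ne'
      fun_prop⟩
  have h : ∀ t, expMap (γ t) = etaFun (2 * π * t) := fun t => by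
    simp only [expMap, γ, ContinuousMap.coe_mk, etaFun]
    rw [exp_ofReal_add, cis_add, cis_pi, Real.exp_add, Real.exp_log (by norm_num),
      Real.exp_log (etaRad_pos _)]
    push_cast
    ring_nf
  refine LiftsIn.of_path γ (fun t => ?_) (fun t => ?_) ?_ ?_
  · rw [logDom, mem_preimage, h]
    exact etaFun_mem _
  · rw [logSheet, h]
    rfl
  · simp only [γ, logPt, etaRad, ContinuousMap.coe_mk]
    norm_num [cis_zero]
  · have h1 : cis (-(2 * π)) = 1 := by
      have := cis_int (-1) 0
      simpa [cis_zero] using this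
    simp only [γ, logPt, etaRad, ContinuousMap.coe_mk]
    norm_num [h1]

theorem etaPath_liftsIn_wDom {s : ℝ} (hs : s ^ 2 = 1) :
    LiftsIn wMap wDom (wPt s 0) (wPt s 4) (Path.Homotopic.Quotient.mk (etaPath hs)) := by
  have hc : Continuous fun t : unitInterval => (sheet₀ s (etaFun (2 * π * t))).2 :=
    continuous_snd.comp ((continuousOn_sheet₀ s).comp_continuous
      (by fun_prop : Continuous fun t : unitInterval => etaFun (2 * π * t))
      fun t => (etaFun_mem _).2.2)
  have he : ∀ t : unitInterval, (etaFun (2 * π * t)).1 ≠ 0 := fun t => by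
    simp [etaFun, cis_ne_zero]
  let γ : C(unitInterval, ℂ × ℂ) := ⟨fun t => ((-Real.log 64 + Real.log (etaRad (2 * π * t)) : ℝ) +
    ((π + 4 * (2 * π * t) : ℝ) : ℂ) * I,
    (sheet₀ s (etaFun (2 * π * t))).2 / (etaFun (2 * π * t)).1), by
      have : Continuous fun t : unitInterval => Real.log (etaRad (2 * π * t)) :=
        (by unfold etaRad; fun_prop : Continuous fun t : unitInterval => etaRad (2 * π * t)).log
          fun t => (etaRad_pos _).ne'
      have h2 : Continuous fun t : unitInterval =>
        (sheet₀ s (etaFun (2 * π * t))).2 / (etaFun (2 * π * t)).1 := hc.div (by fun_prop) he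
      fun_prop⟩
  have h : ∀ t, γ t ∈ wDom ∧ wMap (γ t) = sheet s (etaFun (2 * π * t)) := fun t => by
    have hn : ‖(etaFun (2 * π * t)).2‖ = 64 * etaRad (2 * π * t) := by
      simp [etaFun, norm_cis, abs_of_pos (etaRad_pos (2 * π * t))]
    refine wMap_eq (y := (etaFun (2 * π * t)).1) (F := (etaFun (2 * π * t)).2) hs
      (baseDom_subset (etaFun_mem _)) (by simp [etaFun, norm_cis])
      (by linarith [one_le_etaRad (2 * π * t)]) (by linarith [etaRad_le (2 * π * t)]) ?_
    rw [eq_div_iff (pow_ne_zero 2 (he t)), exp_ofReal_add, cis_add, cis_pi, Real.exp_add,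
      Real.exp_neg, Real.exp_log (by norm_num), Real.exp_log (etaRad_pos _)]
    simp only [etaFun, ContinuousMap.coe_mk]
    have h4 : cis (4 * (2 * π * t)) = cis (2 * (2 * π * t)) * (cis (2 * π * t)) ^ 2 := by
      rw [sq, ← cis_add, ← cis_add]
      ring_nf
    have := cis_neg_mul (2 * π * t)
    rw [h4]
    push_cast
    linear_combination (-64 * etaRad (2 * π * t) * cis (2 * (2 * π * t))) *
      (1 + cis (-(2 * π * t)) * cis (2 * π * t)) * this
  refine LiftsIn.of_path γ (fun t => (h t).1) (fun t => (h t).2.symm) ?_ ?_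
  · simp only [γ, wPt, ContinuousMap.coe_mk, Icc.coe_zero, mul_zero, etaFun_zero, etaRad]
    norm_num
  · simp only [γ, wPt, ContinuousMap.coe_mk, Icc.coe_one, mul_one, etaFun_two_pi, etaRad]
    norm_num

/-- The meridian of the quartic, as an element of the fundamental group. -/
def mElt {s : ℝ} (hs : s ^ 2 = 1) : FundamentalGroup Cpl (basePt s) :=
  FundamentalGroup.fromPath (Path.Homotopic.Quotient.mk (mPath hs))

/-- The meridian of the conic, as an element of the fundamental group. -/
def bElt {s : ℝ} (hs : s ^ 2 = 1) : FundamentalGroup Cpl (basePt s) :=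
  FundamentalGroup.fromPath (Path.Homotopic.Quotient.mk (bPath hs))

theorem LiftsIn.mul {E T : Type*} [TopologicalSpace E] [TopologicalSpace T] {f : E → T} {S : Set E}
    {y y' y'' : E} {p : T} {d e : FundamentalGroup T p} (hd : LiftsIn f S y y' d.toPath)
    (he : LiftsIn f S y' y'' e.toPath) : LiftsIn f S y y'' (e * d).toPath :=
  hd.trans he

theorem bElt_sq {s : ℝ} (hs : s ^ 2 = 1) : bElt hs ^ 2 = mElt hs ^ 4 := by
  have hb : LiftsIn (logSheet s) logDom (logPt 0) (logPt 2) (bElt hs * bElt hs).toPath :=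
    (bPath_liftsIn hs 0).mul (d := bElt hs) (e := bElt hs) (bPath_liftsIn hs 1)
  have hm : LiftsIn wMap wDom (wPt s 0) (wPt s 4)
      (mElt hs * (mElt hs * (mElt hs * mElt hs))).toPath :=
    (((mPath_liftsIn hs 0).mul (d := mElt hs) (e := mElt hs) (mPath_liftsIn hs 1)).mul
      (e := mElt hs) (mPath_liftsIn hs 2)).mul (e := mElt hs) (mPath_liftsIn hs 3)
  have h1 := hb.unique isSimplyConnected_logDom (continuousOn_logSheet hs)
    (etaPath_liftsIn_logDom hs)
  have h2 := hm.unique isSimplyConnected_wDom continuousOn_wMap (etaPath_liftsIn_wDom hs)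
  have h3 : bElt hs * bElt hs = mElt hs * (mElt hs * (mElt hs * mElt hs)) := h1.trans h2.symm
  rw [sq, h3]
  simp only [pow_succ, pow_zero, one_mul, mul_assoc]

end Relation

section Bridge

open Set Topology Complex
open scoped Real

theorem one_sq_eq : (1 : ℝ) ^ 2 = 1 := one_pow 2

theorem neg_one_sq_eq : (-1 : ℝ) ^ 2 = 1 := by norm_num

/-- A path from one sheet to the other over a point of the line `y = 64`, moving `y` once around
the origin and keeping `y ^ 2 * F` constant. -/
def bridge₀ (φ : ℝ) (F : ℂ) : ℂ × ℂ :=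
  (64 * cis (-φ), I * cis (-(φ / 2)) * csq (128 + (3 - F * cis (2 * φ)) * cis φ))

theorem cis_half_sq (φ : ℝ) : cis (-(φ / 2)) ^ 2 = cis (-φ) := by
  rw [sq, ← cis_add]
  ring_nf

theorem cis_two_mul (φ : ℝ) : cis (2 * φ) = cis φ ^ 2 := by
  rw [two_mul, cis_add, sq]

theorem bridge₀_sq (φ : ℝ) (F : ℂ) :
    (bridge₀ φ F).2 ^ 2 = -(128 * cis (-φ) + 3 - F * cis (2 * φ)) := by
  simp only [bridge₀, mul_pow, cis_half_sq, csq_sq, I_sq]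
  linear_combination (F * cis (2 * φ) - 3) * cis_neg_mul φ

theorem bridge₀_conic (φ : ℝ) (F : ℂ) :
    3 + 2 * (bridge₀ φ F).1 + (bridge₀ φ F).2 ^ 2 = F * cis (2 * φ) := by
  rw [bridge₀_sq]
  simp only [bridge₀]
  ring

theorem bridge₀_mul (φ : ℝ) (F : ℂ) :
    (bridge₀ φ F).1 ^ 2 * (3 + 2 * (bridge₀ φ F).1 + (bridge₀ φ F).2 ^ 2) = 64 ^ 2 * F := by
  rw [bridge₀_conic, cis_two_mul]
  simp only [bridge₀]
  linear_combination 64 ^ 2 * F * (1 + cis (-φ) * cis φ) * cis_neg_mul φ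

theorem bridge₀_mem {F : ℂ} (hF : ((64, F) : ℂ × ℂ) ∈ sheetDom) (φ : ℝ) :
    bridge₀ φ F ∈ dom₁ := by
  rw [mem_dom₁, bridge₀_mul, bridge₀_conic]
  exact ⟨mul_ne_zero hF.1 (cis_ne_zero _), hF.2.1⟩

theorem bridge₀_slit {F : ℂ} (hF : ‖F‖ ≤ 64) (φ : ℝ) :
    128 + (3 - F * cis (2 * φ)) * cis φ ∈ slitPlane := by
  left
  have h1 : ‖(3 - F * cis (2 * φ)) * cis φ‖ ≤ 3 + 64 := by
    rw [norm_mul, norm_cis, mul_one]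
    refine (norm_sub_le _ _).trans ?_
    rw [norm_mul, norm_cis, RCLike.norm_ofNat]
    linarith
  have h2 := (abs_le.1 (abs_re_le_norm ((3 - F * cis (2 * φ)) * cis φ))).1
  rw [add_re, re_ofNat]
  linarith

theorem bridge₀_zero (F : ℂ) : bridge₀ 0 F = sheet₀ 1 (64, F) := by
  simp only [bridge₀, sheet₀]
  norm_num [cis_zero]
  ring_nf

theorem bridge₀_two_pi (F : ℂ) : bridge₀ (2 * π) F = sheet₀ (-1) (64, F) := by
  have h1 : cis (-(2 * π)) = 1 := by simpa [cis_zero] using cis_int (-1) 0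
  have h2 : cis (2 * (2 * π)) = 1 := by simpa [cis_zero] using cis_int 2 0
  have h3 : cis (-π) = -1 := by
    have := cis_int (-1) π
    rw [cis_pi] at this
    rw [← this]
    congr 1
    push_cast
    ring
  simp only [bridge₀, sheet₀, h1, h2, cis_two_pi, mul_div_cancel_left₀ π two_ne_zero, h3]
  push_cast
  ring_nf

theorem continuous_bridge₀ {F : C(ℝ, ℂ)} (hF : ∀ θ, ‖F θ‖ ≤ 64) :
    Continuous fun u : ℝ × ℝ => bridge₀ u.1 (F u.2) := by
  have h : Continuous fun u : ℝ × ℝ => csq (128 + (3 - F u.2 * cis (2 * u.1)) * cis u.1) :=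
    continuous_iff_continuousAt.2 fun u => ContinuousAt.comp
      (f := fun u : ℝ × ℝ => 128 + (3 - F u.2 * cis (2 * u.1)) * cis u.1)
      (continuousAt_csq (bridge₀_slit (hF _) _)) (by fun_prop)
  unfold bridge₀
  fun_prop

/-- The base point of the first sheet lies over a point of `sheetDom`. -/
theorem base_mem_sheetDom : ((64, -64) : ℂ × ℂ) ∈ sheetDom := by
  simpa [mF, cis_zero] using mF_mem 0

theorem continuous_bridge₀_base : Continuous fun φ : ℝ => bridge₀ φ (-64) :=
  (continuous_bridge₀ (F := ContinuousMap.const ℝ (-64)) (by simp)).comp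
    (by fun_prop : Continuous fun φ : ℝ => (φ, (0 : ℝ)))

/-- The path joining the base points of the two sheets. -/
def bridge : Path (basePt 1) (basePt (-1)) where
  toFun t := aff₁ (bridge₀ (2 * π * t) (-64))
  continuous_toFun := isChart_aff₁.continuousOn.comp_continuous
    (continuous_bridge₀_base.comp (by fun_prop)) fun t => bridge₀_mem base_mem_sheetDom _
  source' := by simp [basePt, bridge₀_zero, sheet]
  target' := by simp [basePt, bridge₀_two_pi, sheet]

open Path.Homotopic.Quotient in
theorem sheetPath_trans_bridge (F : C(ℝ, ℂ)) (hm : ∀ θ, (64, F θ) ∈ sheetDom)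
    (h0 : F 0 = -64) (h1 : F (2 * π) = -64) (hF : ∀ θ, ‖F θ‖ ≤ 64) :
    (mk (sheetPath one_sq_eq F hm h0 h1)).trans (mk bridge) =
      (mk bridge).trans (mk (sheetPath neg_one_sq_eq F hm h0 h1)) := by
  let f : ℝ × ℝ → Cpl := fun u => aff₁ (bridge₀ u.1 (F u.2))
  have hf : ContinuousOn f univ := (isChart_aff₁.continuousOn.comp_continuous
    (continuous_bridge₀ hF) fun u => bridge₀_mem (hm _) _).continuousOn
  have hS : IsSimplyConnected (univ : Set (ℝ × ℝ)) :=
    convex_univ.simplyConnectedSpace' ⟨0, trivial⟩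
  have e1 : LiftsIn f univ (0, 0) (0, 2 * π) (mk (sheetPath one_sq_eq F hm h0 h1)) :=
    LiftsIn.of_path ⟨fun t => (0, 2 * π * t), by fun_prop⟩ (fun _ => trivial)
      (fun t => by simp [f, bridge₀_zero, sheetPath, sheet]) (by simp) (by simp)
  have e2 : LiftsIn f univ (0, 2 * π) (2 * π, 2 * π) (mk bridge) :=
    LiftsIn.of_path ⟨fun t => (2 * π * t, 2 * π), by fun_prop⟩ (fun _ => trivial)
      (fun t => by
        show aff₁ (bridge₀ (2 * π * t) (-64)) = aff₁ (bridge₀ (2 * π * t) (F (2 * π)))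
        rw [h1]) (by simp) (by simp)
  have e3 : LiftsIn f univ (0, 0) (2 * π, 0) (mk bridge) :=
    LiftsIn.of_path ⟨fun t => (2 * π * t, 0), by fun_prop⟩ (fun _ => trivial)
      (fun t => by
        show aff₁ (bridge₀ (2 * π * t) (-64)) = aff₁ (bridge₀ (2 * π * t) (F 0))
        rw [h0]) (by simp) (by simp)
  have e4 : LiftsIn f univ (2 * π, 0) (2 * π, 2 * π) (mk (sheetPath neg_one_sq_eq F hm h0 h1)) :=
    LiftsIn.of_path ⟨fun t => (2 * π, 2 * π * t), by fun_prop⟩ (fun _ => trivial)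
      (fun t => by simp [f, bridge₀_two_pi, sheetPath, sheet]) (by simp) (by simp)
  exact (e1.trans e2).unique hS hf (e3.trans e4)

open Path.Homotopic.Quotient in
theorem bPath_trans_bridge : (mk (bPath one_sq_eq)).trans (mk bridge) =
    (mk bridge).trans (mk (bPath neg_one_sq_eq)) :=
  sheetPath_trans_bridge _ _ _ _ norm_bF

open Path.Homotopic.Quotient in
theorem mPath_trans_bridge : (mk (mPath one_sq_eq)).trans (mk bridge) =
    (mk bridge).trans (mk (mPath neg_one_sq_eq)) :=
  sheetPath_trans_bridge _ _ _ _ fun θ => (norm_mF θ).le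

theorem bridge₀_im_ne_zero {φ : ℝ} (h : Real.sin φ ≠ 0) : (bridge₀ φ (-64)).2.im ≠ 0 := by
  intro h0
  have h1 : ((bridge₀ φ (-64)).2 ^ 2).im = 0 := by simp [sq, h0]
  have e : -(128 * cis (-φ) + 3 - -64 * cis (2 * φ)) =
      ((-128 : ℝ) : ℂ) * cis (-φ) - ((3 : ℝ) : ℂ) - ((64 : ℝ) : ℂ) * cis (2 * φ) := by
    push_cast
    ring
  rw [bridge₀_sq, e] at h1
  simp only [sub_im, im_ofReal_mul, cis_im, ofReal_im, Real.sin_neg, Real.sin_two_mul] at h1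
  have h2 : Real.sin φ * (1 - Real.cos φ) = 0 := by linear_combination h1 / 128
  rcases mul_eq_zero.1 h2 with h3 | h3
  · exact h h3
  · have := Real.sin_sq_add_cos_sq φ
    rw [show Real.cos φ = 1 by linarith] at this
    exact h (pow_eq_zero_iff two_ne_zero |>.1 (by linarith))

theorem sheet₀_im_base (s : ℝ) (hs : s ^ 2 = 1) : 0 < s * (sheet₀ s (64, -64)).2.im :=
  sheet₀_im_pos hs base_mem_sheetDom.2.2

theorem bridge₀_im_pos {φ : ℝ} (h0 : 0 ≤ φ) (h1 : φ < π) : 0 < (bridge₀ φ (-64)).2.im := by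
  have hb : 0 < (bridge₀ 0 (-64)).2.im := by
    have := sheet₀_im_base 1 one_sq_eq
    rwa [one_mul, ← bridge₀_zero] at this
  by_contra! hn
  obtain ⟨x, hx, hx0⟩ := intermediate_value_Icc' h0
    (f := fun φ : ℝ => (bridge₀ φ (-64)).2.im)
    (continuous_im.comp (continuous_snd.comp continuous_bridge₀_base)).continuousOn ⟨hn, hb.le⟩
  have hx1 : 0 < x := hx.1.lt_of_ne fun h => by
    subst h
    exact hb.ne' hx0
  exact bridge₀_im_ne_zero (Real.sin_pos_of_pos_of_lt_pi hx1 (hx.2.trans_lt h1)).ne' hx0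

theorem bridge₀_im_neg {φ : ℝ} (h0 : π < φ) (h1 : φ ≤ 2 * π) : (bridge₀ φ (-64)).2.im < 0 := by
  have hb : (bridge₀ (2 * π) (-64)).2.im < 0 := by
    have := sheet₀_im_base (-1) neg_one_sq_eq
    rw [← bridge₀_two_pi] at this
    linarith
  by_contra! hn
  obtain ⟨x, hx, hx0⟩ := intermediate_value_Icc' h1
    (f := fun φ : ℝ => (bridge₀ φ (-64)).2.im)
    (continuous_im.comp (continuous_snd.comp continuous_bridge₀_base)).continuousOn ⟨hb.le, hn⟩
  have hx1 : x < 2 * π := hx.2.lt_of_ne fun h => by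
    subst h
    exact hb.ne hx0
  have : 0 < Real.sin (x - π) :=
    Real.sin_pos_of_pos_of_lt_pi (by linarith [hx.1]) (by linarith)
  rw [Real.sin_sub_pi] at this
  exact bridge₀_im_ne_zero (by linarith) hx0

theorem bridge₀_im_pi : (bridge₀ π (-64)).2.im = 0 := by
  have h1 : cis (-(π / 2)) = -I := by
    refine Complex.ext ?_ ?_ <;> simp [cis_re, cis_im]
  have h2 : (128 + (3 - -64 * cis (2 * π)) * cis π : ℂ) = ((61 : ℝ) : ℂ) := by
    rw [cis_two_pi, cis_pi]
    norm_num
  have h3 : csq ((61 : ℝ) : ℂ) = ((61 ^ (2⁻¹ : ℝ) : ℝ) : ℂ) := by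
    rw [csq, ofReal_cpow (by norm_num)]
    norm_num
  simp only [bridge₀, h1, h2, h3]
  simp [-ofReal_ofNat]

/-- The part of the complement covered by the two sheets over `baseDom`. -/
def sheets : Set Cpl := sheet 1 '' baseDom ∪ sheet (-1) '' baseDom

theorem sheet_mem_sheets {s : ℝ} (hs : s ^ 2 = 1) {p : ℂ × ℂ} (hp : p ∈ baseDom) :
    sheet s p ∈ sheets := by
  have h4 : s = 1 ∨ s = -1 := mul_self_eq_one_iff.1 (by rwa [← sq])
  rcases h4 with rfl | rfl
  · exact Or.inl ⟨p, hp, rfl⟩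
  · exact Or.inr ⟨p, hp, rfl⟩

theorem mem_sheets {P : Cpl} : P ∈ sheets ↔ ∃ s : ℝ, s ^ 2 = 1 ∧ ∃ p ∈ baseDom, sheet s p = P := by
  constructor
  · rintro (⟨p, hp, rfl⟩ | ⟨p, hp, rfl⟩)
    · exact ⟨1, one_sq_eq, p, hp, rfl⟩
    · exact ⟨-1, neg_one_sq_eq, p, hp, rfl⟩
  · rintro ⟨s, hs, p, hp, rfl⟩
    exact sheet_mem_sheets hs hp

theorem aff₁_mem_sheets {q : ℂ × ℂ} (hq : q ∈ dom₁) :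
    aff₁ q ∈ sheets ↔ q.2.im ≠ 0 ∧ 1 - q.1 ^ 2 * (3 + 2 * q.1 + q.2 ^ 2) ∈ slitPlane := by
  rw [mem_sheets]
  constructor
  · rintro ⟨s, hs, p, hp, h⟩
    have h0 := isChart_aff₁.injOn (sheet₀_mem hs (baseDom_subset hp)) hq h
    rw [← h0, sheet₀_conic hs]
    exact ⟨fun h => by simpa [h] using sheet₀_im_pos hs hp.2.2, hp.2.1⟩
  · rintro ⟨h1, h2⟩
    obtain ⟨s, hs, h3⟩ : ∃ s : ℝ, s ^ 2 = 1 ∧ 0 < s * q.2.im := by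
      rcases lt_or_gt_of_ne h1 with h | h
      · exact ⟨-1, neg_one_sq_eq, by linarith⟩
      · exact ⟨1, one_sq_eq, by linarith⟩
    obtain ⟨p, hp, rfl⟩ := exists_sheet hs hq h3
    rw [sheet₀_conic hs] at h2
    exact ⟨s, hs, p, ⟨hp.1, h2, hp.2.2⟩, rfl⟩

theorem sheet_mem_sheets_iff {s : ℝ} (hs : s ^ 2 = 1) {p : ℂ × ℂ} (hp : p ∈ sheetDom) :
    sheet s p ∈ sheets ↔ 1 - p.1 ^ 2 * p.2 ∈ slitPlane := by
  rw [sheet, aff₁_mem_sheets (sheet₀_mem hs hp), sheet₀_conic hs]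
  exact ⟨fun h => h.2, fun h => ⟨fun h0 => by simpa [h0] using sheet₀_im_pos hs hp.2.2, h⟩⟩

theorem bridge₀_mem_sheets {φ : ℝ} (h : (bridge₀ φ (-64)).2.im ≠ 0) :
    aff₁ (bridge₀ φ (-64)) ∈ sheets := by
  rw [aff₁_mem_sheets (bridge₀_mem base_mem_sheetDom φ), bridge₀_mul]
  exact ⟨h, Or.inl (by norm_num)⟩

end Bridge

section Reached

open Set Topology Complex FundamentalGroup
open scoped Real

/-- The subgroup generated by the two meridians. -/
def meridianGroup : Subgroup (FundamentalGroup Cpl (basePt 1)) :=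
  Subgroup.closure {mElt one_sq_eq, bElt one_sq_eq}

/-- The class of a loop lies in the subgroup generated by the two meridians. -/
def IsWord (c : Path.Homotopic.Quotient (basePt 1) (basePt 1)) : Prop :=
  fromPath c ∈ meridianGroup

theorem quotient_symm_refl {T : Type*} [TopologicalSpace T] (p : T) :
    (Path.Homotopic.Quotient.refl p).symm = Path.Homotopic.Quotient.refl p := by
  rw [← Path.Homotopic.Quotient.mk_refl, ← Path.Homotopic.Quotient.mk_symm, Path.refl_symm]

theorem quotient_symm_trans {T : Type*} [TopologicalSpace T] {p q r : T}
    (c : Path.Homotopic.Quotient p q) (d : Path.Homotopic.Quotient q r) :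
    (c.trans d).symm = d.symm.trans c.symm := by
  induction c using Path.Homotopic.Quotient.ind
  induction d using Path.Homotopic.Quotient.ind
  rw [← Path.Homotopic.Quotient.mk_trans, ← Path.Homotopic.Quotient.mk_symm, Path.trans_symm,
    Path.Homotopic.Quotient.mk_trans,
    Path.Homotopic.Quotient.mk_symm, Path.Homotopic.Quotient.mk_symm]

theorem quotient_symm_symm {T : Type*} [TopologicalSpace T] {p q : T}
    (c : Path.Homotopic.Quotient p q) : c.symm.symm = c := by
  induction c using Path.Homotopic.Quotient.ind
  rw [← Path.Homotopic.Quotient.mk_symm, ← Path.Homotopic.Quotient.mk_symm, Path.symm_symm]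

theorem IsWord.refl : IsWord (Path.Homotopic.Quotient.refl _) := meridianGroup.one_mem

theorem IsWord.trans {c d : Path.Homotopic.Quotient (basePt 1) (basePt 1)} (hc : IsWord c)
    (hd : IsWord d) : IsWord (c.trans d) :=
  meridianGroup.mul_mem hd hc

theorem IsWord.symm {c : Path.Homotopic.Quotient (basePt 1) (basePt 1)} (hc : IsWord c) :
    IsWord c.symm :=
  meridianGroup.inv_mem hc

theorem isWord_trans_iff {c d : Path.Homotopic.Quotient (basePt 1) (basePt 1)} (hd : IsWord d) :
    IsWord (c.trans d) ↔ IsWord c :=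
  meridianGroup.mul_mem_cancel_left (x := fromPath d) (y := fromPath c) hd

theorem isWord_mPath : IsWord (Path.Homotopic.Quotient.mk (mPath one_sq_eq)) :=
  Subgroup.subset_closure (Or.inl rfl)

theorem isWord_bPath : IsWord (Path.Homotopic.Quotient.mk (bPath one_sq_eq)) :=
  Subgroup.subset_closure (Or.inr rfl)

open scoped Classical in
/-- The class of a path from the base point of the first sheet to that of any sheet. -/
def link {s : ℝ} (hs : s ^ 2 = 1) : Path.Homotopic.Quotient (basePt 1) (basePt s) :=
  if h : s = 1 then h ▸ Path.Homotopic.Quotient.refl _ else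
    (show s = -1 from (mul_self_eq_one_iff.1 (by rwa [← sq])).resolve_left h) ▸
      Path.Homotopic.Quotient.mk bridge

theorem link_one : link one_sq_eq = Path.Homotopic.Quotient.refl _ := by simp [link]

theorem link_neg_one : link neg_one_sq_eq = Path.Homotopic.Quotient.mk bridge := by
  rw [link, dif_neg (by norm_num)]

theorem link_trans_bPath {s : ℝ} (hs : s ^ 2 = 1) :
    (link hs).trans (Path.Homotopic.Quotient.mk (bPath hs)) =
      (Path.Homotopic.Quotient.mk (bPath one_sq_eq)).trans (link hs) := by
  have h4 : s = 1 ∨ s = -1 := mul_self_eq_one_iff.1 (by rwa [← sq])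
  rcases h4 with rfl | rfl
  · rw [link_one, Path.Homotopic.Quotient.refl_trans, Path.Homotopic.Quotient.trans_refl]
  · rw [link_neg_one, bPath_trans_bridge]

theorem link_trans_mPath {s : ℝ} (hs : s ^ 2 = 1) :
    (link hs).trans (Path.Homotopic.Quotient.mk (mPath hs)) =
      (Path.Homotopic.Quotient.mk (mPath one_sq_eq)).trans (link hs) := by
  have h4 : s = 1 ∨ s = -1 := mul_self_eq_one_iff.1 (by rwa [← sq])
  rcases h4 with rfl | rfl
  · rw [link_one, Path.Homotopic.Quotient.refl_trans, Path.Homotopic.Quotient.trans_refl]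
  · rw [link_neg_one, mPath_trans_bridge]

theorem isWord_conj {s : ℝ} (hs : s ^ 2 = 1) {d : Path.Homotopic.Quotient (basePt s) (basePt s)}
    {e : Path.Homotopic.Quotient (basePt 1) (basePt 1)} (he : IsWord e)
    (h : (link hs).trans d = e.trans (link hs)) :
    IsWord (((link hs).trans d).trans (link hs).symm) := by
  rwa [h, Path.Homotopic.Quotient.trans_assoc, Path.Homotopic.Quotient.trans_symm,
    Path.Homotopic.Quotient.trans_refl]

theorem logPt_mem (k : ℤ) : logPt k ∈ logDom := by
  obtain ⟨γ, h, -⟩ := bPath_liftsIn one_sq_eq k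
  simpa using h 0

theorem logSheet_logPt (s : ℝ) (k : ℤ) : logSheet s (logPt k) = basePt s := by
  have : expMap (logPt k) = (64, -64) := by
    refine Prod.ext rfl ?_
    show exp ((Real.log 64 : ℝ) + ((π + k * (2 * π) : ℝ) : ℂ) * I) = -64
    rw [exp_add, ← ofReal_exp, Real.exp_log (by norm_num)]
    have h2 : exp (((π + k * (2 * π) : ℝ) : ℂ) * I) = cis (π + k * (2 * π)) := rfl
    have h3 : cis (π + k * (2 * π)) = -1 := by
      have := cis_int k π
      rw [cis_pi] at this
      rw [← this]
    rw [h2, h3]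
    norm_num
  rw [logSheet, this, basePt]

theorem exists_liftsIn_logPt {s : ℝ} (hs : s ^ 2 = 1) (k : ℤ) :
    ∃ e : Path.Homotopic.Quotient (basePt s) (basePt s),
      LiftsIn (logSheet s) logDom (logPt 0) (logPt k) e ∧
        IsWord (((link hs).trans e).trans (link hs).symm) := by
  have hb := isWord_conj hs isWord_bPath (link_trans_bPath hs)
  have key : ∀ d e : Path.Homotopic.Quotient (basePt s) (basePt s),
      ((link hs).trans (d.trans e)).trans (link hs).symm =
        (((link hs).trans d).trans (link hs).symm).trans
          (((link hs).trans e).trans (link hs).symm) := fun d e => by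
    simp only [Path.Homotopic.Quotient.trans_assoc]
    rw [← Path.Homotopic.Quotient.trans_assoc (link hs).symm (link hs),
      Path.Homotopic.Quotient.symm_trans, Path.Homotopic.Quotient.refl_trans]
  have key' : ((link hs).trans (Path.Homotopic.Quotient.mk (bPath hs)).symm).trans (link hs).symm =
      (((link hs).trans (Path.Homotopic.Quotient.mk (bPath hs))).trans (link hs).symm).symm := by
    simp only [quotient_symm_trans, quotient_symm_symm, Path.Homotopic.Quotient.trans_assoc]
  induction k with
  | zero =>
    refine ⟨Path.Homotopic.Quotient.refl _, LiftsIn.refl (logPt_mem 0) (logSheet_logPt s 0), ?_⟩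
    rw [Path.Homotopic.Quotient.trans_refl, Path.Homotopic.Quotient.trans_symm]
    exact IsWord.refl
  | succ n ih =>
    obtain ⟨e, he, hw⟩ := ih
    refine ⟨_, he.trans (bPath_liftsIn hs n), ?_⟩
    rw [key]
    exact hw.trans hb
  | pred n ih =>
    obtain ⟨e, he, hw⟩ := ih
    have h := (bPath_liftsIn hs (-(n : ℤ) - 1)).symm
    rw [sub_add_cancel] at h
    refine ⟨_, he.trans h, ?_⟩
    rw [key, key']
    exact hw.trans hb.symm

/-- The path classes obtained by following a word in the meridians, passing to a sheet, and
staying in that sheet. -/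
def Reached (P : Cpl) (c : Path.Homotopic.Quotient (basePt 1) P) : Prop :=
  ∃ (s : ℝ) (hs : s ^ 2 = 1) (a : ℂ × ℂ) (d : Path.Homotopic.Quotient (basePt s) P),
    LiftsIn (logSheet s) logDom (logPt 0) a d ∧ IsWord ((c.trans d.symm).trans (link hs).symm)

theorem LiftsIn.mem_right {E T : Type*} [TopologicalSpace E] [TopologicalSpace T] {f : E → T}
    {S : Set E} {y y' : E} {p q : T} {d : Path.Homotopic.Quotient p q}
    (h : LiftsIn f S y y' d) : y' ∈ S ∧ f y' = q := by
  obtain ⟨γ, h, δ, hδ, -⟩ := h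
  exact ⟨by simpa using h 1, by simpa using (hδ 1).symm⟩

theorem LiftsIn.shift {s : ℝ} {a a' : ℂ × ℂ} {P Q : Cpl} {d : Path.Homotopic.Quotient P Q}
    (h : LiftsIn (logSheet s) logDom a a' d) (k : ℤ) :
    LiftsIn (logSheet s) logDom (a + (0, k * (2 * π * I))) (a' + (0, k * (2 * π * I))) d := by
  obtain ⟨γ, h, δ, hδ, e⟩ := h
  have key : ∀ q : ℂ × ℂ, expMap (q + (0, k * (2 * π * I))) = expMap q := fun q => by
    simp [expMap, exp_add, exp_int_mul_two_pi_mul_I]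
  refine ⟨⟨⟨fun t => γ t + (0, k * (2 * π * I)), by fun_prop⟩, by simp, by simp⟩, fun t => ?_, δ,
    fun t => ?_, e⟩
  · have : expMap (γ t) ∈ baseDom := h t
    rwa [← key] at this
  · rw [hδ, logSheet, logSheet, ← key (γ t)]
    rfl

theorem reached_iff {s : ℝ} (hs : s ^ 2 = 1) {a : ℂ × ℂ} {P : Cpl}
    {d : Path.Homotopic.Quotient (basePt s) P} (hd : LiftsIn (logSheet s) logDom (logPt 0) a d)
    (c : Path.Homotopic.Quotient (basePt 1) P) :
    Reached P c ↔ IsWord ((c.trans d.symm).trans (link hs).symm) := by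
  refine ⟨?_, fun h => ⟨s, hs, a, d, hd, h⟩⟩
  rintro ⟨s', hs', a', d', hd', h⟩
  obtain ⟨rfl, h1⟩ := sheet_eq_sheet hs hs' (baseDom_subset hd.mem_right.1)
    (baseDom_subset hd'.mem_right.1) (hd.mem_right.2.trans hd'.mem_right.2.symm)
  have h2 : a'.1 = a.1 := (congrArg Prod.fst h1).symm
  obtain ⟨k, hk⟩ := exp_eq_exp_iff_exists_int.1 (congrArg Prod.snd h1).symm
  have ha : a + (0, k * (2 * π * I)) = a' := Prod.ext (by simp [h2]) (by simp [hk])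
  have hz : logPt 0 + (0, k * (2 * π * I)) = logPt k := by
    refine Prod.ext (by simp [logPt]) ?_
    simp only [logPt, Prod.snd_add]
    push_cast
    ring
  have hd2 := hd.shift k
  rw [ha, hz] at hd2
  obtain ⟨e, he, hw⟩ := exists_liftsIn_logPt hs k
  have h3 := (hd'.trans hd2.symm).unique isSimplyConnected_logDom (continuousOn_logSheet hs) he
  rw [← h3] at hw
  have h4 : (c.trans d.symm).trans (link hs).symm =
      ((c.trans d'.symm).trans (link hs).symm).trans
        (((link hs).trans (d'.trans d.symm)).trans (link hs).symm) := by
    simp only [Path.Homotopic.Quotient.trans_assoc]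
    rw [← Path.Homotopic.Quotient.trans_assoc (link hs).symm (link hs),
      Path.Homotopic.Quotient.symm_trans, Path.Homotopic.Quotient.refl_trans,
      ← Path.Homotopic.Quotient.trans_assoc d'.symm d', Path.Homotopic.Quotient.symm_trans,
      Path.Homotopic.Quotient.refl_trans]
  rw [h4]
  exact h.trans hw

theorem reached_of_liftsIn {s : ℝ} (hs : s ^ 2 = 1) {a a' : ℂ × ℂ} {P Q : Cpl}
    {d : Path.Homotopic.Quotient P Q} (hd : LiftsIn (logSheet s) logDom a a' d) :
    Transports Reached d := fun c => by
  have ha : a ∈ logDom ∧ logSheet s a = P := ⟨hd.symm.mem_right.1, hd.symm.mem_right.2⟩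
  obtain ⟨ha, rfl⟩ := ha
  obtain ⟨e, he⟩ : ∃ e : Path.Homotopic.Quotient (basePt s) (logSheet s a),
      LiftsIn (logSheet s) logDom (logPt 0) a e := by
    rw [← logSheet_logPt s 0]
    exact LiftsIn.exists_of_mem isSimplyConnected_logDom (continuousOn_logSheet hs) (logPt_mem 0) ha
  rw [reached_iff hs he, reached_iff hs (he.trans hd), quotient_symm_trans]
  simp only [Path.Homotopic.Quotient.trans_assoc]
  rw [← Path.Homotopic.Quotient.trans_assoc d d.symm, Path.Homotopic.Quotient.trans_symm,
    Path.Homotopic.Quotient.refl_trans]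

theorem reached_base {s : ℝ} (hs : s ^ 2 = 1) (c : Path.Homotopic.Quotient (basePt 1) (basePt s)) :
    Reached (basePt s) c ↔ IsWord (c.trans (link hs).symm) := by
  rw [reached_iff hs (LiftsIn.refl (logPt_mem 0) (logSheet_logPt s 0))]
  rw [quotient_symm_refl,
    Path.Homotopic.Quotient.trans_refl]

theorem transports_mPath {s : ℝ} (hs : s ^ 2 = 1) :
    Transports Reached (Path.Homotopic.Quotient.mk (mPath hs)) := fun c => by
  rw [reached_base hs, reached_base hs]
  have h : ((c.trans (Path.Homotopic.Quotient.mk (mPath hs))).trans (link hs).symm) =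
      (c.trans (link hs).symm).trans
        (((link hs).trans (Path.Homotopic.Quotient.mk (mPath hs))).trans (link hs).symm) := by
    simp only [Path.Homotopic.Quotient.trans_assoc]
    rw [← Path.Homotopic.Quotient.trans_assoc (link hs).symm (link hs),
      Path.Homotopic.Quotient.symm_trans, Path.Homotopic.Quotient.refl_trans]
  rw [h, isWord_trans_iff (isWord_conj hs isWord_mPath (link_trans_mPath hs))]

theorem transports_bridge : Transports Reached (Path.Homotopic.Quotient.mk bridge) := fun c => by
  rw [reached_base one_sq_eq, reached_base neg_one_sq_eq, link_one, link_neg_one,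
    Path.Homotopic.Quotient.trans_assoc, Path.Homotopic.Quotient.trans_symm]
  rw [quotient_symm_refl]

theorem isOpen_sheets : IsOpen sheets :=
  ((isChart_sheet one_sq_eq).isOpen_image _ baseDom_subset isOpen_baseDom).union
    ((isChart_sheet neg_one_sq_eq).isOpen_image _ baseDom_subset isOpen_baseDom)

theorem transportsIn_sheets : TransportsIn Reached sheets sheets := by
  refine TransportsIn.of_local subset_closure fun P hP => ?_
  obtain ⟨s, hs, p₀, hp₀, rfl⟩ := mem_sheets.1 hP
  let O : Set (ℂ × ℂ) := baseDom ∩ {p | p.2 / p₀.2 ∈ slitPlane}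
  have hO : IsOpen O := isOpen_baseDom.inter (isOpen_slitPlane.preimage (by fun_prop))
  have hOs : O ⊆ sheetDom := inter_subset_left.trans baseDom_subset
  refine ⟨sheet s '' O, (isChart_sheet hs).isOpen_image _ hOs hO, ⟨p₀, ⟨hp₀, ?_⟩, rfl⟩, ?_⟩
  · show p₀.2 / p₀.2 ∈ slitPlane
    rw [div_self hp₀.1]
    exact one_mem_slitPlane
  intro P Q _ _ δ hδ
  obtain ⟨g, hg, hgs⟩ := ((isChart_sheet hs).mono hOs hO).exists_inverse
  have hgO : ∀ t, g (δ t) ∈ O ∧ sheet s (g (δ t)) = δ t := fun t => by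
    obtain ⟨p, hp, h⟩ := hδ t
    rw [← h, hgs p hp]
    exact ⟨hp, rfl⟩
  have hgc : Continuous fun t => g (δ t) := hg.comp_continuous δ.continuous hδ
  have he : ∀ t, expMap ((g (δ t)).1, log ((g (δ t)).2 / p₀.2) + log p₀.2) = g (δ t) := fun t => by
    refine Prod.ext rfl ?_
    show exp (log ((g (δ t)).2 / p₀.2) + log p₀.2) = _
    rw [exp_add, exp_log (slitPlane_ne_zero (hgO t).1.2), exp_log hp₀.1, div_mul_cancel₀ _ hp₀.1]
  have hc : Continuous fun t => log ((g (δ t)).2 / p₀.2) :=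
    ((continuous_snd.comp hgc).div_const p₀.2).clog fun t => (hgO t).1.2
  refine reached_of_liftsIn hs (LiftsIn.of_path
    ⟨fun t => ((g (δ t)).1, log ((g (δ t)).2 / p₀.2) + log p₀.2),
      (continuous_fst.comp hgc).prodMk (hc.add_const _)⟩ (fun t => ?_)
    (fun t => ?_) rfl rfl)
  · show expMap _ ∈ baseDom
    rw [ContinuousMap.coe_mk, he t]
    exact (hgO t).1.1
  · rw [logSheet, ContinuousMap.coe_mk, he t, (hgO t).2]

end Reached

section Cut

open Set Topology Complex
open scoped Real

/-- Points of the cut `y ^ 2 * F > 1` in logarithmic polar coordinates. -/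
def cutPt (v : ℝ × ℝ × ℝ) : ℂ × ℂ :=
  (Real.exp v.2.2 * cis v.1, (Real.exp (v.2.1 + 2 * v.2.2) : ℝ))

/-- The points over which the two sheets are defined, in the coordinates `y` and `y ^ 2 * F`,
where the latter has real part greater than one. -/
def cutDom : Set (ℂ × ℂ) :=
  {p | p.1 ≠ 0 ∧ 1 < p.2.re ∧ 3 + 2 * p.1 - p.2 / p.1 ^ 2 ∈ slitPlane}

/-- Logarithmic polar coordinates of points of the cut. -/
def CutGood (v : ℝ × ℝ × ℝ) : Prop :=
  0 < v.2.1 + 2 * v.2.2 ∧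
    (0 < 3 - Real.exp v.2.1 * (2 * Real.cos v.1 ^ 2 - 1) + 2 * Real.exp v.2.2 * Real.cos v.1 ∨
      Real.sin v.1 * (Real.exp v.2.1 * Real.cos v.1 + Real.exp v.2.2) ≠ 0)

theorem cutPt_mem_iff (v : ℝ × ℝ × ℝ) :
    cutPt v ∈ {p ∈ cutDom | p.2.im = 0} ↔ CutGood v := by
  obtain ⟨θ, U, R⟩ := v
  have hy : (Real.exp R * cis θ : ℂ) ≠ 0 :=
    mul_ne_zero (by exact_mod_cast (Real.exp_pos R).ne') (cis_ne_zero θ)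
  have hd : ((Real.exp (U + 2 * R) : ℝ) : ℂ) / (Real.exp R * cis θ) ^ 2 =
      (Real.exp U : ℝ) * cis (-(2 * θ)) := by
    rw [div_eq_iff (pow_ne_zero 2 hy), mul_pow, Real.exp_add, two_mul R, Real.exp_add]
    have : cis (-(2 * θ)) * cis θ ^ 2 = 1 := by
      rw [sq, ← cis_add, ← cis_add, ← cis_zero]
      congr 1
      ring
    push_cast
    linear_combination (-(exp U * exp R ^ 2) : ℂ) * this
  have hre : (3 + 2 * (Real.exp R * cis θ) - (Real.exp U : ℝ) * cis (-(2 * θ)) : ℂ).re =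
      3 - Real.exp U * (2 * Real.cos θ ^ 2 - 1) + 2 * Real.exp R * Real.cos θ := by
    have e : (3 + 2 * (Real.exp R * cis θ) - (Real.exp U : ℝ) * cis (-(2 * θ)) : ℂ) =
      (3 : ℝ) + ((2 * Real.exp R : ℝ) : ℂ) * cis θ - (Real.exp U : ℝ) * cis (-(2 * θ)) := by
      push_cast
      ring
    rw [e, sub_re, add_re, re_ofReal_mul, re_ofReal_mul, cis_re, cis_re, Real.cos_neg,
      Real.cos_two_mul, ofReal_re]
    ring
  have him : (3 + 2 * (Real.exp R * cis θ) - (Real.exp U : ℝ) * cis (-(2 * θ)) : ℂ).im =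
      2 * (Real.sin θ * (Real.exp U * Real.cos θ + Real.exp R)) := by
    have e : (3 + 2 * (Real.exp R * cis θ) - (Real.exp U : ℝ) * cis (-(2 * θ)) : ℂ) =
      (3 : ℝ) + ((2 * Real.exp R : ℝ) : ℂ) * cis θ - (Real.exp U : ℝ) * cis (-(2 * θ)) := by
      push_cast
      ring
    rw [e, sub_im, add_im, im_ofReal_mul, im_ofReal_mul, cis_im, cis_im, Real.sin_neg,
      Real.sin_two_mul, ofReal_im]
    ring
  show ((_ ≠ (0 : ℂ)) ∧ _ ∧ _ ∈ slitPlane) ∧ _ ↔ _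
  simp only [cutPt, CutGood, ofReal_re, ofReal_im, hd, mem_slitPlane_iff, hre, him, and_true]
  rw [Real.one_lt_exp_iff]
  refine ⟨fun h => ⟨h.2.1, h.2.2.imp_right fun h h0 => h (by rw [h0, mul_zero])⟩,
    fun h => ⟨hy, h.1, h.2.imp_right fun h => mul_ne_zero two_ne_zero h⟩⟩

theorem exists_cutPt {p : ℂ × ℂ} (hp : p ∈ {p ∈ cutDom | p.2.im = 0}) :
    ∃ σ α U R : ℝ, σ ^ 2 = 1 ∧ 0 ≤ α ∧ α ≤ π ∧ cutPt (σ * α, U, R) = p := by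
  obtain ⟨⟨h0, h1, -⟩, h2⟩ := hp
  have key : ∀ θ, ‖p.1‖ * cis θ = p.1 →
      cutPt (θ, Real.log p.2.re - 2 * Real.log ‖p.1‖, Real.log ‖p.1‖) = p := fun θ hθ => by
    refine Prod.ext ?_ ?_
    · simpa only [cutPt, Real.exp_log (norm_pos_iff.2 h0)] using hθ
    · simp only [cutPt, sub_add_cancel, Real.exp_log (zero_lt_one.trans h1)]
      exact Complex.ext rfl (by simp [h2])
  have harg : ‖p.1‖ * cis (arg p.1) = p.1 := norm_mul_exp_arg_mul_I p.1
  rcases le_total 0 (arg p.1) with h | h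
  · exact ⟨1, arg p.1, _, _, one_sq_eq, h, arg_le_pi _, by rw [one_mul]; exact key _ harg⟩
  · exact ⟨-1, -arg p.1, _, _, neg_one_sq_eq, by linarith, by linarith [neg_pi_lt_arg p.1],
      by rw [neg_one_mul, neg_neg]; exact key _ harg⟩

theorem joinedIn_cut {v w : ℝ × ℝ × ℝ}
    (h : ∀ t ∈ Icc (0 : ℝ) 1, CutGood (AffineMap.lineMap v w t)) :
    JoinedIn {p ∈ cutDom | p.2.im = 0} (cutPt v) (cutPt w) := by
  have hc : Continuous cutPt := by
    unfold cutPt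
    fun_prop
  refine JoinedIn.ofLine (f := fun t : ℝ => cutPt (AffineMap.lineMap v w t))
    (hc.comp AffineMap.lineMap_continuous).continuousOn (by simp) (by simp) ?_
  rintro _ ⟨t, ht, rfl⟩
  exact (cutPt_mem_iff _).2 (h t ht)

theorem joinedIn_cut_rotate {σ α U R : ℝ} (h : ∀ β : ℝ, (α ≤ β ∧ β ≤ π / 2 ∨ π / 2 ≤ β ∧ β ≤ α) →
    CutGood (σ * β, U, R)) :
    JoinedIn {p ∈ cutDom | p.2.im = 0} (cutPt (σ * α, U, R)) (cutPt (σ * (π / 2), U, R)) := by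
  refine joinedIn_cut fun t ht => ?_
  have e : AffineMap.lineMap (k := ℝ) (σ * α, U, R) (σ * (π / 2), U, R) t =
      (σ * (α + t * (π / 2 - α)), U, R) := by
    simp only [AffineMap.lineMap_apply_module]
    refine Prod.ext ?_ (Prod.ext ?_ ?_) <;> simp <;> ring
  rw [e]
  refine h _ ?_
  rcases le_total α (π / 2) with h1 | h1
  · exact Or.inl ⟨by nlinarith [ht.1], by nlinarith [ht.2]⟩
  · exact Or.inr ⟨by nlinarith [ht.2], by nlinarith [ht.1]⟩

theorem joinedIn_cut_translate {θ U R U' R' : ℝ} (h : ∀ t : ℝ, 0 ≤ t → t ≤ 1 →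
    CutGood (θ, U + t * (U' - U), R + t * (R' - R))) :
    JoinedIn {p ∈ cutDom | p.2.im = 0} (cutPt (θ, U, R)) (cutPt (θ, U', R')) := by
  refine joinedIn_cut fun t ht => ?_
  have e : AffineMap.lineMap (k := ℝ) (θ, U, R) (θ, U', R') t =
      (θ, U + t * (U' - U), R + t * (R' - R)) := by
    simp only [AffineMap.lineMap_apply_module]
    refine Prod.ext ?_ (Prod.ext ?_ ?_) <;> simp <;> ring
  rw [e]
  exact h t ht.1 ht.2

theorem cos_sign_mul {σ : ℝ} (hσ : σ ^ 2 = 1) (α : ℝ) : Real.cos (σ * α) = Real.cos α := by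
  have h4 : σ = 1 ∨ σ = -1 := mul_self_eq_one_iff.1 (by rwa [← sq])
  rcases h4 with rfl | rfl
  · rw [one_mul]
  · rw [neg_one_mul, Real.cos_neg]

theorem sin_sign_mul {σ : ℝ} (hσ : σ ^ 2 = 1) (α : ℝ) : Real.sin (σ * α) = σ * Real.sin α := by
  have h4 : σ = 1 ∨ σ = -1 := mul_self_eq_one_iff.1 (by rwa [← sq])
  rcases h4 with rfl | rfl
  · rw [one_mul, one_mul]
  · rw [neg_one_mul, neg_one_mul, Real.sin_neg]

theorem cutGood_iff {σ α U R : ℝ} (hσ : σ ^ 2 = 1) : CutGood (σ * α, U, R) ↔ 0 < U + 2 * R ∧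
    (0 < 3 - Real.exp U * (2 * Real.cos α ^ 2 - 1) + 2 * Real.exp R * Real.cos α ∨
      Real.sin α * (Real.exp U * Real.cos α + Real.exp R) ≠ 0) := by
  have h0 : σ ≠ 0 := fun h => by simp [h] at hσ
  simp only [CutGood, cos_sign_mul hσ, sin_sign_mul hσ, mul_assoc, mul_ne_zero_iff, ne_eq, h0,
    not_false_eq_true, true_and]

theorem joinedIn_cut_of_pos {σ α U R : ℝ} (hσ : σ ^ 2 = 1) (hα : 0 < α) (hα' : α < π)
    (h0 : 0 < U + 2 * R) (h : 0 < Real.exp U * Real.cos α + Real.exp R) :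
    JoinedIn {p ∈ cutDom | p.2.im = 0} (cutPt (σ * α, U, R)) (cutPt (σ * (π / 2), U, R)) := by
  refine joinedIn_cut_rotate fun β hβ => (cutGood_iff hσ).2 ⟨h0, Or.inr (mul_ne_zero ?_ ?_)⟩
  · exact (Real.sin_pos_of_pos_of_lt_pi
      (by rcases hβ with h | h <;> linarith [h.1, h.2, Real.pi_pos])
      (by rcases hβ with h | h <;> linarith [h.1, h.2, Real.pi_pos])).ne'
  · rcases hβ with hb | hb
    · have : 0 ≤ Real.cos β := Real.cos_nonneg_of_neg_pi_div_two_le_of_le (by linarith) hb.2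
      positivity
    · have : Real.cos α ≤ Real.cos β :=
        Real.cos_le_cos_of_nonneg_of_le_pi (by linarith [Real.pi_pos]) hα'.le hb.2
      nlinarith [Real.exp_pos U]

theorem joinedIn_cut_zero {σ U R : ℝ} (hσ : σ ^ 2 = 1) (h0 : 0 < U + 2 * R)
    (h : 0 < 3 - Real.exp U + 2 * Real.exp R) :
    JoinedIn {p ∈ cutDom | p.2.im = 0} (cutPt (0, U, R)) (cutPt (σ * (π / 2), U, R)) := by
  have := joinedIn_cut_rotate (σ := σ) (α := 0) (U := U) (R := R) fun β hβ => by
    rw [cutGood_iff hσ]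
    refine ⟨h0, ?_⟩
    have hb : 0 ≤ β ∧ β ≤ π / 2 := by
      rcases hβ with h | h
      · exact h
      · exact ⟨by linarith [Real.pi_pos], by linarith [Real.pi_pos]⟩
    rcases hb.1.eq_or_lt with rfl | h1
    · left
      rw [Real.cos_zero]
      linarith
    · right
      have h2 := Real.sin_pos_of_pos_of_lt_pi h1 (by linarith [Real.pi_pos])
      have : 0 ≤ Real.cos β := Real.cos_nonneg_of_neg_pi_div_two_le_of_le (by linarith) hb.2
      positivity
  rwa [mul_zero] at this

theorem joinedIn_cut_half_pi {σ U R : ℝ} (hσ : σ ^ 2 = 1) (h0 : 0 < U + 2 * R) :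
    JoinedIn {p ∈ cutDom | p.2.im = 0} (cutPt (0, 1, 0)) (cutPt (σ * (π / 2), U, R)) := by
  refine (joinedIn_cut_zero hσ (by norm_num) ?_).trans (joinedIn_cut_translate fun t ht ht' => ?_)
  · have := Real.exp_one_lt_d9
    rw [Real.exp_zero]
    linarith
  · rw [cutGood_iff hσ, Real.sin_pi_div_two, Real.cos_pi_div_two]
    refine ⟨?_, Or.inr (by positivity)⟩
    rcases ht'.eq_or_lt with rfl | h
    · linarith
    · nlinarith [mul_nonneg ht h0.le]

theorem joinedIn_cut_of_neg {σ α U R : ℝ} (hσ : σ ^ 2 = 1) (hα : 0 < α) (hα' : α < π)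
    (h0 : 0 < U + 2 * R) (h : Real.exp U * Real.cos α + Real.exp R < 0) :
    ∃ U' R', 0 < U' + 2 * R' ∧ JoinedIn {p ∈ cutDom | p.2.im = 0} (cutPt (σ * α, U, R))
      (cutPt (σ * (π / 2), U', R')) := by
  have hs := Real.sin_pos_of_pos_of_lt_pi hα hα'
  have hc : Real.cos α < 0 := by
    by_contra! h1
    have : 0 ≤ Real.exp U * Real.cos α + Real.exp R := by positivity
    linarith
  have hα2 : π / 2 ≤ α := by
    by_contra! h1
    exact hc.not_ge (Real.cos_nonneg_of_neg_pi_div_two_le_of_le (by linarith) h1.le)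
  obtain ⟨s, hs0, hs1⟩ : ∃ s : ℝ, 0 ≤ s ∧ 2 * Real.exp (R - s) < Real.exp (U + 2 * s) := by
    refine ⟨|R| + |U| + 1, by positivity, ?_⟩
    have h1 : Real.exp (R - (|R| + |U| + 1)) ≤ Real.exp (-1) :=
      Real.exp_le_exp.2 (by linarith [le_abs_self R, abs_nonneg U])
    have h2 : Real.exp 1 ≤ Real.exp (U + 2 * (|R| + |U| + 1)) :=
      Real.exp_le_exp.2 (by linarith [neg_abs_le U, abs_nonneg U, abs_nonneg R])
    have h3 := Real.exp_one_gt_d9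
    have h4 : Real.exp (-1) < 1 := by
      rw [← Real.exp_zero]
      exact Real.exp_lt_exp.2 (by norm_num)
    linarith
  refine ⟨U + 2 * s, R - s, by linarith, (joinedIn_cut_translate (U' := U + 2 * s)
    (R' := R - s) fun t ht ht' => ?_).trans (joinedIn_cut_rotate fun β hβ => ?_)⟩
  · rw [cutGood_iff hσ]
    refine ⟨by linarith, Or.inr (mul_ne_zero hs.ne' (ne_of_lt ?_))⟩
    have h1 : Real.exp U ≤ Real.exp (U + t * (U + 2 * s - U)) :=
      Real.exp_le_exp.2 (by nlinarith)
    have h2 : Real.exp (R + t * (R - s - R)) ≤ Real.exp R := Real.exp_le_exp.2 (by nlinarith)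
    nlinarith
  · rw [cutGood_iff hσ]
    refine ⟨by linarith, ?_⟩
    have hb : π / 2 ≤ β ∧ β ≤ α := by
      rcases hβ with h | h
      · exact ⟨by linarith, by linarith⟩
      · exact h
    by_cases h1 : Real.exp (U + 2 * s) * Real.cos β + Real.exp (R - s) = 0
    · left
      have h2 := Real.exp_pos (R - s)
      have h3 := Real.exp_pos (U + 2 * s)
      set u := Real.exp (U + 2 * s)
      set c := Real.cos β
      have h4 : -(1 / 2) < c := by nlinarith
      have h5 : c < 0 := by nlinarith
      have h6 : 3 - u * (2 * c ^ 2 - 1) + 2 * Real.exp (R - s) * c = 3 + u * (1 - 4 * c ^ 2) := by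
        linear_combination 2 * c * h1
      rw [h6]
      have h7 : 0 < 1 - 4 * c ^ 2 := by nlinarith
      positivity
    · exact Or.inr (mul_ne_zero (Real.sin_pos_of_pos_of_lt_pi (by linarith)
        (by linarith)).ne' h1)

theorem isPreconnected_cut : IsPreconnected {p ∈ cutDom | p.2.im = 0} := by
  refine IsPathConnected.isConnected ?_ |>.isPreconnected
  refine ⟨cutPt (0, 1, 0), (cutPt_mem_iff _).2 ⟨by norm_num, Or.inl ?_⟩, fun {p} hp => ?_⟩
  · have := Real.exp_one_lt_d9
    simp only [Real.cos_zero, Real.exp_zero]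
    linarith
  obtain ⟨σ, α, U, R, hσ, hα, hα', rfl⟩ := exists_cutPt hp
  suffices ∃ U' R', 0 < U' + 2 * R' ∧ JoinedIn {p ∈ cutDom | p.2.im = 0} (cutPt (σ * α, U, R))
      (cutPt (σ * (π / 2), U', R')) by
    obtain ⟨U', R', h0, h⟩ := this
    exact (joinedIn_cut_half_pi hσ h0).trans h.symm
  obtain ⟨h0, h1⟩ := (cutGood_iff hσ).1 ((cutPt_mem_iff _).1 hp)
  rcases hα.eq_or_lt with rfl | hα
  · rw [Real.cos_zero, Real.sin_zero] at h1
    refine ⟨U, R, h0, ?_⟩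
    rw [mul_zero]
    refine joinedIn_cut_zero hσ h0 ?_
    rcases h1 with h1 | h1
    · linarith
    · simp at h1
  rcases hα'.eq_or_lt with rfl | hα'
  · rw [Real.cos_pi, Real.sin_pi] at h1
    exfalso
    rcases h1 with h1 | h1
    · have h2 : 1 < Real.exp U * Real.exp R ^ 2 := by
        rw [← Real.exp_nat_mul, ← Real.exp_add, Real.one_lt_exp_iff]
        exact_mod_cast h0
      have h3 := Real.exp_pos U
      have h4 := Real.exp_pos R
      have h5 : Real.exp U < 3 - 2 * Real.exp R := by linarith
      have h6 : Real.exp U * Real.exp R ^ 2 ≤ (3 - 2 * Real.exp R) * Real.exp R ^ 2 := by gcongr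
      nlinarith [mul_nonneg (by positivity : 0 ≤ 2 * Real.exp R + 1) (sq_nonneg (Real.exp R - 1))]
    · simp at h1
  rcases lt_trichotomy (Real.exp U * Real.cos α + Real.exp R) 0 with h | h | h
  · exact joinedIn_cut_of_neg hσ hα hα' h0 h
  · have hpos : ∀ t : ℝ, 0 < t → 0 < Real.exp U * Real.cos α + Real.exp (R + t) := fun t ht => by
      have : Real.exp R < Real.exp (R + t) := Real.exp_lt_exp.2 (by linarith)
      linarith
    refine ⟨U, R + 1, by linarith, (joinedIn_cut_translate (U' := U) (R' := R + 1)
      fun t ht ht' => ?_).trans (joinedIn_cut_of_pos hσ hα hα' (by linarith) (hpos 1 one_pos))⟩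
    rw [sub_self, mul_zero, add_zero, add_sub_cancel_left, mul_one, cutGood_iff hσ]
    rcases ht.eq_or_lt with rfl | ht
    · rw [add_zero]
      exact ⟨h0, h1⟩
    · exact ⟨by linarith, Or.inr (mul_ne_zero (Real.sin_pos_of_pos_of_lt_pi hα hα').ne'
        (hpos t ht).ne')⟩
  · exact ⟨U, R, h0, joinedIn_cut_of_pos hσ hα hα' h0 h⟩

end Cut

section Generation

open Set Topology Complex
open scoped Real

theorem IsChart.image_subset_closure {E T : Type*} [TopologicalSpace T] [NormedAddCommGroup E]
    [NormedSpace ℝ E] {φ : E → T} {O : Set E} {V : Set T} (h : IsChart φ O) {f : E →L[ℝ] ℝ}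
    (hf : f ≠ 0) (hV : ∀ p ∈ O, f p ≠ 0 → φ p ∈ closure V) : φ '' O ⊆ closure V := by
  rintro _ ⟨p, hp, rfl⟩
  by_cases hfp : f p = 0
  · refine isClosed_closure.closure_subset (mem_closure_iff.2 fun N hN hpN => ?_)
    obtain ⟨a, ha, ha'⟩ := ContinuousLinearMap.exists_near_pos hf hfp
      (h.continuousOn.isOpen_inter_preimage h.isOpen hN) ⟨hp, hpN⟩
    exact ⟨φ a, ha.2, hV a ha.1 ha'.ne'⟩
  · exact hV p hp hfp

/-- A sheet in the coordinates `y` and `y ^ 2 * F`. -/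
def cutSheet (s : ℝ) (p : ℂ × ℂ) : Cpl := sheet s (p.1, p.2 / p.1 ^ 2)

theorem cutDom_mapsTo : MapsTo (fun p : ℂ × ℂ => (p.1, p.2 / p.1 ^ 2)) cutDom sheetDom := by
  rintro ⟨y, t⟩ ⟨h0, h1, h2⟩
  have ht : t ≠ 0 := fun h => by norm_num [h] at h1
  refine ⟨div_ne_zero ht (pow_ne_zero 2 h0), ?_, h2⟩
  rw [mul_div_cancel₀ _ (pow_ne_zero 2 h0)]
  intro h
  norm_num [show t = 1 from h] at h1

theorem isChart_cutSheet {s : ℝ} (hs : s ^ 2 = 1) : IsChart (cutSheet s) cutDom := by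
  have hc : ContinuousOn (fun p : ℂ × ℂ => p.2 / p.1 ^ 2) {p | p.1 ≠ 0} := fun p hp =>
    (continuousAt_snd.div (continuousAt_fst.pow 2) (pow_ne_zero 2 hp)).continuousWithinAt
  have ho : IsOpen {p : ℂ × ℂ | p.1 ≠ 0} := isOpen_ne_fun continuous_fst continuous_const
  have hO : IsOpen cutDom := by
    have h1 : ContinuousOn (fun p : ℂ × ℂ => 3 + 2 * p.1 - p.2 / p.1 ^ 2) {p | p.1 ≠ 0} :=
      (by fun_prop : Continuous fun p : ℂ × ℂ => 3 + 2 * p.1).continuousOn.sub hc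
    have h2 := (h1.isOpen_inter_preimage ho isOpen_slitPlane).inter
      (isOpen_lt (continuous_const (y := (1 : ℝ))) (continuous_re.comp continuous_snd))
    convert! h2 using 1
    ext p
    exact ⟨fun h => ⟨⟨h.1, h.2.2⟩, h.2.1⟩, fun h => ⟨h.1.1, h.2, h.1.2⟩⟩
  refine (isChart_sheet hs).comp (IsChart.of_inverse (R := {p | p.1 ≠ 0})
    (g := fun p => (p.1, p.1 ^ 2 * p.2)) hO ho (continuousOn_fst.prodMk (hc.mono fun p hp => hp.1))
    (by fun_prop) (fun p hp => hp.1) (fun p hp => ?_) fun q hq _ => ?_) cutDom_mapsTo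
  · exact Prod.ext rfl (mul_div_cancel₀ _ (pow_ne_zero 2 hp.1))
  · exact Prod.ext rfl (mul_div_cancel_left₀ _ (pow_ne_zero 2 hq))

theorem cutSheet_mem_sheets_iff {s : ℝ} (hs : s ^ 2 = 1) {p : ℂ × ℂ} (hp : p ∈ cutDom) :
    cutSheet s p ∈ sheets ↔ p.2.im ≠ 0 := by
  rw [cutSheet, sheet_mem_sheets_iff hs (cutDom_mapsTo hp)]
  rw [mul_div_cancel₀ _ (pow_ne_zero 2 hp.1), mem_slitPlane_iff, sub_re, sub_im, one_re, one_im,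
    zero_sub, neg_ne_zero]
  exact ⟨fun h => h.resolve_left (by linarith [hp.2.1]), Or.inr⟩

/-- The imaginary part of the second coordinate. -/
def imSnd : ℂ × ℂ →L[ℝ] ℝ := imCLM.comp (ContinuousLinearMap.snd ℝ ℂ ℂ)

theorem imSnd_apply (p : ℂ × ℂ) : imSnd p = p.2.im := rfl

theorem imSnd_ne_zero : imSnd ≠ 0 := fun h => by
  simpa [imSnd_apply] using congrArg (fun f => f ((0, I) : ℂ × ℂ)) h

theorem cutSheet_subset_closure {s : ℝ} (hs : s ^ 2 = 1) :
    cutSheet s '' cutDom ⊆ closure sheets :=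
  (isChart_cutSheet hs).image_subset_closure imSnd_ne_zero fun _ hp hfp =>
    subset_closure ((cutSheet_mem_sheets_iff hs hp).2 hfp)

theorem mPath_mem_sheets {s : ℝ} (hs : s ^ 2 = 1) {t : unitInterval}
    (ht : Real.sin (2 * π * t) ≠ 0 ∨ (t : ℝ) = 0 ∨ (t : ℝ) = 1) : mPath hs t ∈ sheets := by
  show sheet s (64, mF (2 * π * t)) ∈ sheets
  rw [sheet_mem_sheets_iff hs (mF_mem _)]
  have e : (1 - 64 ^ 2 * mF (2 * π * t) : ℂ) =
      ((1 : ℝ) : ℂ) + ((64 ^ 3 : ℝ) : ℂ) * cis (2 * π * t) := by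
    simp only [mF, ContinuousMap.coe_mk]
    push_cast
    ring
  rw [e, mem_slitPlane_iff, add_re, add_im, re_ofReal_mul, im_ofReal_mul, ofReal_im, ofReal_re,
    cis_re, cis_im, zero_add]
  rcases ht with h | h | h
  · exact Or.inr (mul_ne_zero (by norm_num) h)
  · left
    rw [h, mul_zero, Real.cos_zero]
    norm_num
  · left
    rw [h, mul_one, Real.cos_two_pi]
    norm_num

theorem mPath_eq_cutSheet {s : ℝ} (hs : s ^ 2 = 1) {t : unitInterval} {a : ℂ × ℂ} (ha : a ∈ cutDom)
    (h : cutSheet s a = mPath hs t) :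
    a.2.im = -(64 ^ 3 * Real.sin (2 * π * t)) ∧ 1 < -(64 ^ 3 * Real.cos (2 * π * t)) := by
  have h1 := (isChart_sheet hs).injOn (cutDom_mapsTo ha) (mF_mem (2 * π * t)) h
  have h2 : a.1 = 64 := congrArg Prod.fst h1
  have h3 : a.2 / a.1 ^ 2 = mF (2 * π * t) := congrArg Prod.snd h1
  have h4 : a.2 = -(((64 ^ 3 : ℝ) : ℂ) * cis (2 * π * t)) := by
    rw [div_eq_iff (pow_ne_zero 2 ha.1), h2] at h3
    rw [h3]
    simp only [mF, ContinuousMap.coe_mk]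
    push_cast
    ring
  have h5 := ha.2.1
  rw [h4, neg_re, re_ofReal_mul, cis_re] at h5
  rw [h4, neg_im, im_ofReal_mul, cis_im]
  exact ⟨rfl, h5⟩

theorem transportsIn_union_cutSheet {s : ℝ} (hs : s ^ 2 = 1) {W : Set Cpl}
    (hW : TransportsIn Reached sheets W) (hWo : IsOpen W) (hVW : sheets ⊆ W)
    (hWV : W ⊆ closure sheets) :
    TransportsIn Reached sheets (W ∪ cutSheet s '' cutDom) := by
  have hK : {p ∈ cutDom | (-imSnd) p = 0} = {p ∈ cutDom | p.2.im = 0} := by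
    ext p
    simp [imSnd_apply]
  have hF : ∀ t : unitInterval, mPath hs t = sheet s (64, mF (2 * π * t)) := fun _ => rfl
  let t₀ : unitInterval := ⟨1 / 2, by norm_num, by norm_num⟩
  have h64 : (((64 : ℂ), (64 ^ 3 : ℂ)) : ℂ × ℂ) ∈ cutDom :=
    ⟨by norm_num, by norm_num, Or.inl (by norm_num)⟩
  refine TransportsIn.union_chart (isChart_cutSheet hs) (f := -imSnd)
    (neg_ne_zero.2 imSnd_ne_zero) (hK ▸ isPreconnected_cut) hW hWo hWV (fun p hp h => hVW ?_)
    (fun p hp h => ?_) (cutSheet_subset_closure hs) (mPath hs) (transports_mPath hs)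
    (s₀ := t₀) (p₀ := (64, 64 ^ 3)) ?_ ?_ h64 ?_ ?_ (fun t ht => ?_) (fun t ht => ?_)
  · exact (cutSheet_mem_sheets_iff hs hp).2 (by simpa [imSnd_apply] using h)
  · simpa [imSnd_apply] using (cutSheet_mem_sheets_iff hs hp).1 h
  · exact Subtype.mk_lt_mk.2 (by norm_num)
  · exact Subtype.mk_lt_mk.2 (by norm_num)
  · rw [neg_apply, imSnd_apply, neg_eq_zero]
    norm_num
  · rw [hF, cutSheet]
    congr 2
    have : 2 * π * ((1 / 2 : ℝ)) = π := by ring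
    simp only [mF, ContinuousMap.coe_mk, t₀, this, cis_pi]
    norm_num
  · have ht : (t : ℝ) < 1 / 2 := ht
    have h0 := t.2.1
    rcases h0.eq_or_lt with h | h
    · have hm := mPath_mem_sheets hs (Or.inr (Or.inl h.symm))
      refine ⟨hm, hVW hm, fun a ha hat => ?_⟩
      have := (mPath_eq_cutSheet hs ha hat).2
      rw [← h, mul_zero, Real.cos_zero] at this
      norm_num at this
    · have hsin : 0 < Real.sin (2 * π * t) :=
        Real.sin_pos_of_pos_of_lt_pi (by positivity) (by nlinarith [Real.pi_pos])
      have hm := mPath_mem_sheets hs (Or.inl hsin.ne')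
      refine ⟨hm, hVW hm, fun a ha hat => ?_⟩
      rw [neg_apply, imSnd_apply, (mPath_eq_cutSheet hs ha hat).1]
      linarith
  · have ht : 1 / 2 < (t : ℝ) := ht
    have h0 := t.2.2
    rcases h0.eq_or_lt with h | h
    · have hm := mPath_mem_sheets hs (Or.inr (Or.inr h))
      refine ⟨hm, hVW hm, fun a ha hat => ?_⟩
      have := (mPath_eq_cutSheet hs ha hat).2
      rw [h, mul_one, Real.cos_two_pi] at this
      norm_num at this
    · have hsin : 0 < Real.sin (2 * π * t - π) :=
        Real.sin_pos_of_pos_of_lt_pi (by nlinarith [Real.pi_pos]) (by nlinarith [Real.pi_pos])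
      rw [Real.sin_sub_pi] at hsin
      have hm := mPath_mem_sheets hs (t := t) (Or.inl (by linarith))
      refine ⟨hm, hVW hm, fun a ha hat => ?_⟩
      rw [neg_apply, imSnd_apply, (mPath_eq_cutSheet hs ha hat).1]
      linarith

end Generation

section HalfSpaces

open Set Topology Complex
open scoped Real

/-- The points of the affine chart `x ≠ 0` off the hypersurface `im z = 0`. -/
def halves : Set Cpl := sheet 1 '' sheetDom ∪ sheet (-1) '' sheetDom

theorem sheet_image_subset {s : ℝ} (hs : s ^ 2 = 1) :
    sheet s '' sheetDom ⊆ sheets ∪ cutSheet s '' cutDom := by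
  rintro _ ⟨p, hp, rfl⟩
  by_cases h : sheet s p ∈ sheets
  · exact Or.inl h
  right
  rw [sheet_mem_sheets_iff hs hp, mem_slitPlane_iff, not_or, not_not, sub_re, one_re, sub_im,
    one_im, zero_sub, neg_eq_zero] at h
  have h1 : p.1 ^ 2 * p.2 ≠ 1 := hp.2.1
  have h2 : 1 < (p.1 ^ 2 * p.2).re := by
    refine lt_of_le_of_ne (by linarith [h.1]) fun h' => h1 ?_
    exact Complex.ext h'.symm h.2
  have h0 : p.1 ≠ 0 := fun h0 => by norm_num [h0] at h2
  have h3 : p.1 ^ 2 * p.2 / p.1 ^ 2 = p.2 := mul_div_cancel_left₀ _ (pow_ne_zero 2 h0)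
  refine ⟨(p.1, p.1 ^ 2 * p.2), ⟨h0, h2, ?_⟩, ?_⟩
  · rw [h3]
    exact hp.2.2
  · rw [cutSheet, h3]

theorem isOpen_halves : IsOpen halves :=
  ((isChart_sheet one_sq_eq).isOpen_image _ subset_rfl isOpen_sheetDom).union
    ((isChart_sheet neg_one_sq_eq).isOpen_image _ subset_rfl isOpen_sheetDom)

theorem mem_halves {q : ℂ × ℂ} (hq : q ∈ dom₁) (h : q.2.im ≠ 0) : aff₁ q ∈ halves := by
  rcases lt_or_gt_of_ne h with h | h
  · obtain ⟨p, hp, rfl⟩ := exists_sheet neg_one_sq_eq hq (by linarith)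
    exact Or.inr ⟨p, hp, rfl⟩
  · obtain ⟨p, hp, rfl⟩ := exists_sheet one_sq_eq hq (by linarith)
    exact Or.inl ⟨p, hp, rfl⟩

theorem halves_subset_closure : halves ⊆ closure sheets :=
  union_subset
    ((sheet_image_subset one_sq_eq).trans
      (union_subset subset_closure (cutSheet_subset_closure one_sq_eq)))
    ((sheet_image_subset neg_one_sq_eq).trans
      (union_subset subset_closure (cutSheet_subset_closure neg_one_sq_eq)))

theorem transportsIn_halves : TransportsIn Reached sheets halves := by
  have h1 := transportsIn_union_cutSheet one_sq_eq transportsIn_sheets isOpen_sheets subset_rfl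
    subset_closure
  have h2 := transportsIn_union_cutSheet neg_one_sq_eq h1
    (isOpen_sheets.union ((isChart_cutSheet one_sq_eq).isOpen_image _ subset_rfl
      (isChart_cutSheet one_sq_eq).isOpen)) subset_union_left
    (union_subset subset_closure (cutSheet_subset_closure one_sq_eq))
  refine h2.mono subset_rfl (union_subset ?_ ?_)
  · exact (sheet_image_subset one_sq_eq).trans subset_union_left
  · exact (sheet_image_subset neg_one_sq_eq).trans
      (union_subset_union_left _ subset_union_left)

theorem isPreconnected_real_slice :
    IsPreconnected {p ∈ dom₁ | imSnd p = 0} := by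
  have hslice : ∀ z : ℝ, IsPreconnected {p ∈ dom₁ | p.2 = (z : ℂ)} := fun z => by
    let P : Polynomial ℂ := (Polynomial.C (3 + (z : ℂ) ^ 2) + 2 * Polynomial.X) *
      (Polynomial.X ^ 2 * (Polynomial.C (3 + (z : ℂ) ^ 2) + 2 * Polynomial.X) - 1)
    have hP : ∀ y : ℂ, P.eval y = (3 + 2 * y + (z : ℂ) ^ 2) *
        (y ^ 2 * (3 + 2 * y + (z : ℂ) ^ 2) - 1) := fun y => by
      simp [P]
      ring
    have hP0 : P ≠ 0 := fun h => by
      have h0 := hP 0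
      rw [h, Polynomial.eval_zero] at h0
      have h1 : ((3 + z ^ 2 : ℝ) : ℂ) = 0 := by
        push_cast
        linear_combination h0
      have := ofReal_eq_zero.1 h1
      nlinarith [sq_nonneg z]
    have hfin : {y | P.IsRoot y}.Countable :=
      (Polynomial.finite_setOfPred_isRoot hP0).countable
    have hc := (hfin.isPathConnected_compl_of_one_lt_rank (by simp)).isConnected.isPreconnected
    convert hc.image (fun y : ℂ => ((y, (z : ℂ)) : ℂ × ℂ)) (by fun_prop) using 1
    ext ⟨y, w⟩
    constructor
    · rintro ⟨h, h'⟩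
      obtain rfl : w = z := h'
      refine ⟨y, fun h0 => ?_, rfl⟩
      have h0 : P.eval y = 0 := h0
      rw [hP, mul_eq_zero, sub_eq_zero] at h0
      exact h0.elim (mem_dom₁.1 h).1 (mem_dom₁.1 h).2
    · rintro ⟨y', h, h'⟩
      obtain ⟨rfl, rfl⟩ := Prod.ext_iff.1 h'
      refine ⟨mem_dom₁.2 ⟨fun h0 => h ?_, fun h0 => h ?_⟩, rfl⟩
      · show P.eval y' = 0
        rw [hP]
        exact mul_eq_zero_of_left h0 _
      · show P.eval y' = 0
        rw [hP]
        exact mul_eq_zero_of_right _ (sub_eq_zero.2 h0)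
  let γ : ℝ → ℂ × ℂ := fun z => (((5 * (1 + z ^ 2) : ℝ) : ℂ) * I, (z : ℂ))
  have hγ : ∀ z, γ z ∈ dom₁ := fun z => by
    have him : (3 + 2 * (γ z).1 + (γ z).2 ^ 2).im = 10 * (1 + z ^ 2) := by
      simp [γ, sq, -ofReal_mul, -ofReal_add]
      ring
    have hz := sq_nonneg z
    have hn : 10 * (1 + z ^ 2) ≤ ‖3 + 2 * (γ z).1 + (γ z).2 ^ 2‖ :=
      him ▸ (le_abs_self _).trans (abs_im_le_norm _)
    have hn1 : ‖(γ z).1‖ = 5 * (1 + z ^ 2) := by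
      rw [show (γ z).1 = ((5 * (1 + z ^ 2) : ℝ) : ℂ) * I from rfl, norm_mul, norm_I, mul_one,
        norm_real, Real.norm_eq_abs]
      exact abs_of_pos (by positivity)
    refine mem_dom₁.2 ⟨fun h => ?_, fun h => ?_⟩
    · rw [h, zero_im] at him
      linarith
    · have := congrArg norm h
      rw [norm_mul, norm_pow, hn1, norm_one] at this
      nlinarith [mul_le_mul (by nlinarith : (25 : ℝ) ≤ (5 * (1 + z ^ 2)) ^ 2)
        (by nlinarith : (10 : ℝ) ≤ ‖3 + 2 * (γ z).1 + (γ z).2 ^ 2‖) (by norm_num) (by positivity)]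
  have hrange : IsPreconnected (range γ) := isPreconnected_range (by fun_prop)
  have hreal : ∀ p : ℂ × ℂ, imSnd p = 0 → p.2 = ((p.2.re : ℝ) : ℂ) := fun p h =>
    Complex.ext rfl h
  refine isPreconnected_of_forall (γ 0) fun p hp => ?_
  refine ⟨{q ∈ dom₁ | q.2 = ((p.2.re : ℝ) : ℂ)} ∪ range γ, ?_, Or.inr ⟨0, rfl⟩,
    Or.inl ⟨hp.1, hreal p hp.2⟩, ?_⟩
  · rintro q (hq | ⟨z, rfl⟩)
    · exact ⟨hq.1, by rw [imSnd_apply, hq.2, ofReal_im]⟩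
    · exact ⟨hγ z, ofReal_im z⟩
  · exact (hslice p.2.re).union (γ p.2.re) ⟨hγ _, rfl⟩ ⟨_, rfl⟩ hrange

theorem transportsIn_aff₁ : TransportsIn Reached sheets (aff₁ '' dom₁) := by
  have hb : ∀ t : unitInterval, bridge t = aff₁ (bridge₀ (2 * π * t) (-64)) := fun _ => rfl
  let t₀ : unitInterval := ⟨1 / 2, by norm_num, by norm_num⟩
  have hmem : ∀ t : unitInterval, bridge₀ (2 * π * t) (-64) ∈ dom₁ := fun t =>
    bridge₀_mem base_mem_sheetDom _
  have hne : ∀ t : unitInterval, (bridge₀ (2 * π * t) (-64)).2.im ≠ 0 →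
      bridge t ∈ sheets ∧ bridge t ∈ halves ∧ ∀ a ∈ dom₁, aff₁ a = bridge t →
        imSnd a = (bridge₀ (2 * π * t) (-64)).2.im := fun t ht => by
    refine ⟨bridge₀_mem_sheets ht, mem_halves (hmem t) ht, fun a ha hat => ?_⟩
    rw [isChart_aff₁.injOn ha (hmem t) hat, imSnd_apply]
  have h := TransportsIn.union_chart isChart_aff₁ (f := imSnd) imSnd_ne_zero
    isPreconnected_real_slice transportsIn_halves isOpen_halves halves_subset_closure
    (fun p hp h => mem_halves hp h) (fun p hp h => ((aff₁_mem_sheets hp).1 h).1)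
    (isChart_aff₁.image_subset_closure imSnd_ne_zero fun p hp h =>
      halves_subset_closure (mem_halves hp h)) bridge transports_bridge
    (s₀ := t₀) (p₀ := bridge₀ π (-64)) (Subtype.mk_lt_mk.2 (by norm_num))
    (Subtype.mk_lt_mk.2 (by norm_num)) ?_ ?_ ?_ (fun t ht => ?_) (fun t ht => ?_)
  · exact h.mono subset_rfl subset_union_right
  · have := hmem t₀
    rwa [show 2 * π * (t₀ : ℝ) = π by simp [t₀]; ring] at this
  · exact bridge₀_im_pi
  · rw [hb, show 2 * π * (t₀ : ℝ) = π by simp [t₀]; ring]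
  · have ht : (t : ℝ) < 1 / 2 := ht
    have hp : 0 < (bridge₀ (2 * π * t) (-64)).2.im := bridge₀_im_pos
      (by have := t.2.1; positivity) (by nlinarith [Real.pi_pos])
    obtain ⟨h1, h2, h3⟩ := hne t hp.ne'
    exact ⟨h1, h2, fun a ha hat => (h3 a ha hat).symm ▸ hp⟩
  · have ht : 1 / 2 < (t : ℝ) := ht
    have hp : (bridge₀ (2 * π * t) (-64)).2.im < 0 := bridge₀_im_neg
      (by nlinarith [Real.pi_pos]) (by nlinarith [Real.pi_pos, t.2.2])
    obtain ⟨h1, h2, h3⟩ := hne t hp.ne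
    exact ⟨h1, h2, fun a ha hat => (h3 a ha hat).symm ▸ hp⟩

end HalfSpaces

section LineAtInfinity

open Set Topology Complex
open scoped Real

/-- A chart along the line `x = 0`, whose second coordinate is `x / z`. -/
def infChart (p : ℂ × ℂ) : Cpl := aff₂ (p.1 * p.2, p.1)

/-- The domain of `infChart`. -/
def infDom : Set (ℂ × ℂ) := {p | p.1 ≠ 0 ∧ (p.1 * p.2, p.1) ∈ dom₂}

theorem isChart_infChart : IsChart infChart infDom := by
  have hR : IsOpen {q : ℂ × ℂ | q.2 ≠ 0} := isOpen_ne_fun continuous_snd continuous_const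
  have hO : IsOpen infDom := (isOpen_ne_fun continuous_fst continuous_const).inter
    (isChart_aff₂.isOpen.preimage (by fun_prop))
  exact isChart_aff₂.comp (IsChart.of_inverse (R := {q | q.2 ≠ 0})
    (ψ := fun p : ℂ × ℂ => (p.1 * p.2, p.1)) (g := fun q => (q.2, q.1 / q.2)) hO hR
    (by fun_prop) (continuousOn_snd.prodMk (continuousOn_fst.div continuousOn_snd fun q hq => hq))
    (fun p hp => hp.1) (fun p hp => Prod.ext rfl (mul_div_cancel_left₀ _ hp.1))
    fun q hq _ => Prod.ext (mul_div_cancel₀ _ hq) rfl) fun p hp => hp.2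

theorem infChart_eq {p : ℂ × ℂ} (hp : p ∈ infDom) (h : p.2 ≠ 0) :
    infChart p = aff₁ (1 / (p.1 * p.2), p.2⁻¹) ∧ (1 / (p.1 * p.2), p.2⁻¹) ∈ dom₁ := by
  have h1 : p.1 / (p.1 * p.2) = p.2⁻¹ := by
    rw [div_mul_cancel_left₀ hp.1]
  have h2 := aff₂_eq_aff₁ (mul_ne_zero hp.1 h) hp.2
  rwa [h1] at h2

theorem inv_im_ne_zero {w : ℂ} : w⁻¹.im ≠ 0 ↔ w.im ≠ 0 := by
  rw [inv_im, div_ne_zero_iff, neg_ne_zero]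
  refine ⟨fun h => h.1, fun h => ⟨h, ?_⟩⟩
  rw [Ne, normSq_eq_zero]
  rintro rfl
  exact h zero_im

theorem closure_sheets : closure sheets = univ := by
  have h1 : aff₁ '' dom₁ ⊆ closure sheets :=
    isChart_aff₁.image_subset_closure imSnd_ne_zero fun p hp h =>
      halves_subset_closure (mem_halves hp h)
  have h2 : infChart '' infDom ⊆ closure sheets :=
    isChart_infChart.image_subset_closure imSnd_ne_zero fun p hp h => by
      have h0 : p.2 ≠ 0 := fun h0 => h (by rw [imSnd_apply, h0, zero_im])
      obtain ⟨e, he⟩ := infChart_eq hp h0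
      exact e ▸ h1 ⟨_, he, rfl⟩
  refine eq_univ_of_forall fun P => ?_
  rcases mem_image_aff P with h | ⟨z, hz, hm, rfl⟩
  · exact h1 h
  · exact h2 ⟨(z, 0), ⟨hz, by simpa using hm⟩, by simp [infChart]⟩

theorem joinedIn_slit {z : ℂ} {ε : ℝ} (hε : 0 < ε) {p : ℂ × ℂ} (hp : p ∈ Metric.ball (z, 0) ε)
    (him : p.2.im ≠ 0) :
    JoinedIn (Metric.ball ((z, 0) : ℂ × ℂ) ε ∩ {p | p.2 ≠ 0}) (z, ((ε / 2 : ℝ) : ℂ)) p := by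
  have hc : ((z, ((ε / 2 : ℝ) : ℂ)) : ℂ × ℂ) ∈ Metric.ball (z, 0) ε := by
    rw [Metric.mem_ball, Prod.dist_eq, dist_self, dist_zero_right, norm_real, Real.norm_eq_abs,
      abs_of_pos (half_pos hε)]
    exact max_lt hε (half_lt_self hε)
  refine JoinedIn.of_segment_subset fun q hq => ⟨(convex_ball _ _).segment_subset hc hp hq, ?_⟩
  obtain ⟨s, t, hs, ht, hst, rfl⟩ := hq
  intro h0
  have h0 : s • ((ε / 2 : ℝ) : ℂ) + t • p.2 = 0 := h0
  have h1 := congrArg im h0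
  rw [add_im, smul_im, smul_im, ofReal_im, smul_zero, zero_add, zero_im, smul_eq_mul,
    mul_eq_zero, or_iff_left him] at h1
  rw [h1, zero_smul, add_zero, (by linarith : s = 1), one_smul] at h0
  linarith [ofReal_eq_zero.1 h0]

theorem transportsIn_univ : TransportsIn Reached sheets univ := by
  refine TransportsIn.of_local (by rw [closure_sheets]) fun P _ => ?_
  rcases mem_image_aff P with h | ⟨z, hz, hm, rfl⟩
  · exact ⟨_, isChart_aff₁.isOpen_image _ subset_rfl isChart_aff₁.isOpen, h, transportsIn_aff₁⟩
  have hz0 : (z, 0) ∈ infDom := ⟨hz, by simpa using hm⟩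
  have h0 : infChart (z, 0) = aff₂ (0, z) := by simp [infChart]
  obtain ⟨ε, hε, hεN⟩ := Metric.isOpen_iff.1 isChart_infChart.isOpen _ hz0
  let N := Metric.ball ((z, 0) : ℂ × ℂ) ε
  have hd : infChart '' infDom ⊆ closure sheets := by rw [closure_sheets]; exact subset_univ _
  have hz' : (z, 0) ∈ N := Metric.mem_ball_self hε
  have hw : ∀ p ∈ N, p.2 ≠ 0 → infChart p ∈ aff₁ '' dom₁ := fun p hp h => by
    obtain ⟨e, he⟩ := infChart_eq (hεN hp) h
    exact ⟨_, he, e.symm⟩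
  obtain ⟨a, haN, ha, haV⟩ := isChart_infChart.exists_pos_mem imSnd_ne_zero hd (p := (z, 0))
    (by rw [imSnd_apply, zero_im]) Metric.isOpen_ball hεN hz'
  obtain ⟨b, hbN, hb, hbV⟩ := isChart_infChart.exists_pos_mem (neg_ne_zero.2 imSnd_ne_zero) hd
    (p := (z, 0)) (by rw [neg_apply, imSnd_apply, zero_im, neg_zero]) Metric.isOpen_ball hεN hz'
  rw [neg_apply] at hb
  have hb : imSnd b < 0 := by linarith
  obtain ⟨γ, hγ⟩ := (joinedIn_slit hε haN ha.ne').symm.trans (joinedIn_slit hε hbN hb.ne)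
  have hc : ContinuousOn infChart (range γ) := isChart_infChart.continuousOn.mono <| by
    rintro _ ⟨t, rfl⟩
    exact hεN (hγ t).1
  refine ⟨infChart '' N, isChart_infChart.isOpen_image _ hεN Metric.isOpen_ball,
    ⟨_, hz', h0⟩, ?_⟩
  refine TransportsIn.of_crossing isChart_infChart (N := N) (Np := N ∩ {p | 0 < imSnd p})
    (Nm := N ∩ {p | imSnd p < 0}) hεN (convex_ball _ _)
    ((convex_ball _ _).inter (convex_halfSpace_gt imSnd.isLinear 0))
    ((convex_ball _ _).inter (convex_halfSpace_lt imSnd.isLinear 0)) inter_subset_left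
    inter_subset_left transportsIn_aff₁ ?_ ?_ (fun p hp hpV => ?_) ⟨haN, ha⟩ ⟨hbN, hb⟩ haV hbV
    (δ₀ := γ.map' hc) (fun t => ⟨γ t, (hγ t).1, rfl⟩)
    (transportsIn_aff₁ haV hbV _ fun t => hw _ (hγ t).1 (hγ t).2)
  · rintro _ ⟨p, ⟨hp, hp'⟩, rfl⟩
    refine hw p hp fun h => ?_
    rw [mem_ofPred_eq, imSnd_apply, h, zero_im] at hp'
    exact hp'.false
  · rintro _ ⟨p, ⟨hp, hp'⟩, rfl⟩
    refine hw p hp fun h => ?_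
    rw [mem_ofPred_eq, imSnd_apply, h, zero_im] at hp'
    exact hp'.false
  · have h2 : p.2 ≠ 0 := by
      intro h2
      have e : infChart p = aff₂ (0, p.1) := by rw [infChart, h2, mul_zero]
      have hm' := (hεN hp).2
      rw [h2, mul_zero] at hm'
      obtain ⟨s, hs, q, hq, hq'⟩ := mem_sheets.1 hpV
      exact aff₁_ne_aff₂ (sheet₀_mem hs (baseDom_subset hq)) hm' (hq'.trans e)
    obtain ⟨e, he⟩ := infChart_eq (hεN hp) h2
    rw [e, aff₁_mem_sheets he] at hpV
    rcases lt_or_gt_of_ne (inv_im_ne_zero.1 hpV.1) with h | h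
    · exact Or.inr ⟨hp, h⟩
    · exact Or.inl ⟨hp, h⟩

theorem basePt_mem_sheets {s : ℝ} (hs : s ^ 2 = 1) : basePt s ∈ sheets := by
  rw [← logSheet_logPt s 0]
  exact mem_sheets.2 ⟨s, hs, _, logPt_mem 0, rfl⟩

theorem meridianGroup_eq_top : meridianGroup = ⊤ := by
  refine eq_top_iff.2 fun c _ => ?_
  have key : ∀ c : Path.Homotopic.Quotient (basePt 1) (basePt 1), IsWord c := fun c => by
    have h := (reached_base one_sq_eq (Path.Homotopic.Quotient.refl _)).2 (by
      rw [link_one, quotient_symm_refl, Path.Homotopic.Quotient.trans_refl]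
      exact IsWord.refl)
    induction c using Path.Homotopic.Quotient.ind with
    | mk δ =>
      have hm := basePt_mem_sheets one_sq_eq
      have h2 := (transportsIn_univ hm hm δ (fun _ => mem_univ _) _).1 h
      rw [reached_base one_sq_eq, link_one, quotient_symm_refl,
        Path.Homotopic.Quotient.trans_refl, Path.Homotopic.Quotient.refl_trans] at h2
      exact h2
  exact key _

instance : PathConnectedSpace Cpl := by
  have key : ∀ P : Cpl, Joined (basePt 1) P := fun P => by
    obtain ⟨v, hv, ε, -⟩ := exists_path_of_mem_closure (x := P) (closure_sheets ▸ mem_univ P)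
      isOpen_univ (mem_univ P)
    obtain ⟨s, hs, p, hp, rfl⟩ := mem_sheets.1 hv
    have hp0 : p.2 ≠ 0 := (baseDom_subset hp).1
    have e : expMap (p.1, log p.2) = p := Prod.ext rfl (exp_log hp0)
    obtain ⟨d, hd⟩ := LiftsIn.exists_of_mem isSimplyConnected_logDom (continuousOn_logSheet hs)
      (logPt_mem 0) (show (p.1, log p.2) ∈ logDom by show expMap _ ∈ baseDom; rwa [e])
    have hj : Joined (basePt 1) (basePt s) := by
      rcases mul_self_eq_one_iff.1 (by rwa [← sq] : s * s = 1) with rfl | rfl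
      · exact Joined.refl _
      · exact ⟨bridge⟩
    have hj2 : Joined (basePt s) (sheet s p) := by
      rw [← logSheet_logPt s 0, show sheet s p = logSheet s (p.1, log p.2) by rw [logSheet, e]]
      induction d using Path.Homotopic.Quotient.ind with
      | mk δ => exact ⟨δ⟩
    exact (hj.trans hj2).trans ⟨ε.symm⟩
  exact ⟨⟨basePt 1⟩, fun P Q => (key P).symm.trans (key Q)⟩

end LineAtInfinity

section Holonomy

open Set Topology

variable {X G ι : Type*} [TopologicalSpace X] [Group G] [TopologicalSpace G] [DiscreteTopology G]

open scoped Classical in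
/-- The principal bundle glued from frames whose ratios are locally constant. -/
def frameBundle (V : ι → Set X) (hV : ∀ i, IsOpen (V i)) (hVX : ∀ x, ∃ i, x ∈ V i) (c : ι → X → G)
    (hc : ∀ i j, ∀ x ∈ V i ∩ V j, ∀ᶠ y in 𝓝 x, c j y * (c i y)⁻¹ = c j x * (c i x)⁻¹) :
    FiberBundleCore ι X G where
  baseSet := V
  isOpen_baseSet := hV
  indexAt x := (hVX x).choose
  mem_baseSet_at x := (hVX x).choose_spec
  coordChange i j x g := c j x * (c i x)⁻¹ * g
  coordChange_self i x _ v := by simp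
  continuousOn_coordChange i j := by
    rintro ⟨x, g⟩ ⟨hx, -⟩
    have h : ContinuousAt (fun y => c j y * (c i y)⁻¹) x :=
      continuousAt_const.congr ((hc i j x hx).mono fun y hy => hy.symm)
    have h2 : ContinuousAt (fun p : G × G => p.1 * p.2) (c j x * (c i x)⁻¹, g) :=
      continuous_of_discreteTopology.continuousAt
    have h3 : ContinuousAt (fun p : X × G => (c j p.1 * (c i p.1)⁻¹, p.2)) (x, g) :=
      (ContinuousAt.comp (f := fun p : X × G => p.1) (x := (x, g)) h continuousAt_fst).prodMk
        continuousAt_snd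
    exact (ContinuousAt.comp (f := fun p : X × G => (c j p.1 * (c i p.1)⁻¹, p.2))
      (x := (x, g)) h2 h3).continuousWithinAt
  coordChange_comp i j k x _ v := by
    rw [← mul_assoc]
    congr 1
    group

theorem exists_holonomy {V : ι → Set X} (hV : ∀ i, IsOpen (V i)) (hVX : ∀ x, ∃ i, x ∈ V i)
    {c : ι → X → G}
    (hc : ∀ i j, ∀ x ∈ V i ∩ V j, ∀ᶠ y in 𝓝 x, c j y * (c i y)⁻¹ = c j x * (c i x)⁻¹) (x₀ : X) :
    ∃ Φ : FundamentalGroup X x₀ →* Equiv.Perm G, ∀ (γ : Path x₀ x₀) (u : unitInterval → G),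
      (∀ t, ∃ i, γ t ∈ V i ∧ ∀ᶠ s in 𝓝 t, c i (γ s) * u s = c i (γ t) * u t) →
      Φ (FundamentalGroup.fromPath (Path.Homotopic.Quotient.mk γ)) (u 0) = u 1 := by
  let Z := frameBundle V hV hVX c hc
  have cov : IsCoveringMap Z.proj := FiberBundle.isCoveringMap (F := G) (E := Z.Fiber)
  let pt : X → G → Z.TotalSpace := fun x g => ⟨x, c (Z.indexAt x) x * g⟩
  let e : G ≃ (Z.proj ⁻¹' {x₀}) := Equiv.ofBijective (fun g => ⟨pt x₀ g, rfl⟩) <| by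
    refine ⟨fun g g' h => ?_, ?_⟩
    · have h1 : pt x₀ g = pt x₀ g' := congrArg Subtype.val h
      have h2 : c (Z.indexAt x₀) x₀ * g = c (Z.indexAt x₀) x₀ * g' :=
        eq_of_heq (Bundle.TotalSpace.mk.inj h1).2
      exact mul_left_cancel h2
    · rintro ⟨⟨x, g⟩, h⟩
      obtain rfl : x = x₀ := h
      let g' : G := g
      refine ⟨(c (Z.indexAt x) x)⁻¹ * g', Subtype.ext ?_⟩
      show (⟨x, c (Z.indexAt x) x * ((c (Z.indexAt x) x)⁻¹ * g')⟩ : Z.TotalSpace) = ⟨x, g'⟩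
      rw [mul_inv_cancel_left]
  refine ⟨(Equiv.permCongrHom e.symm).toMonoidHom.comp (cov.monodromyPerm x₀), fun γ u hu => ?_⟩
  let Γ : unitInterval → Z.TotalSpace := fun t => pt (γ t) (u t)
  have hΓ : Continuous Γ := continuous_iff_continuousAt.2 fun t => by
    obtain ⟨i, hi, hiu⟩ := hu t
    have hmem : ∀ s, Γ s ∈ (Z.localTriv i).source ↔ γ s ∈ V i := fun s =>
      Z.mem_localTriv_source i _
    have hn : Γ ⁻¹' (Z.localTriv i).source ∈ 𝓝 t :=
      Filter.mem_of_superset (((hV i).preimage γ.continuous).mem_nhds hi) fun s hs => (hmem s).2 hs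
    rw [(Z.localTriv i).toOpenPartialHomeomorph.continuousAt_iff_continuousAt_comp_left hn]
    have he : ∀ s, Z.localTriv i (Γ s) = (γ s, c i (γ s) * u s) := fun s => by
      rw [Z.localTriv_apply]
      refine Prod.ext rfl ?_
      show c i (γ s) * (c (Z.indexAt (γ s)) (γ s))⁻¹ * (c (Z.indexAt (γ s)) (γ s) * u s) = _
      group
    have : ContinuousAt (fun s => (γ s, c i (γ s) * u s)) t :=
      γ.continuous.continuousAt.prodMk
        (continuousAt_const.congr (hiu.mono fun s hs => hs.symm))
    exact this.congr (Filter.Eventually.of_forall fun s => (he s).symm)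
  let Γp : Path (e (u 0)).1 (e (u 1)).1 := ⟨⟨Γ, hΓ⟩,
    by show pt (γ 0) (u 0) = pt x₀ (u 0); rw [γ.source],
    by show pt (γ 1) (u 1) = pt x₀ (u 1); rw [γ.target]⟩
  have key : cov.monodromy (Path.Homotopic.Quotient.mk γ) (e (u 0)) = e (u 1) :=
    cov.monodromy_eq_of_map_eq (Path.Homotopic.Quotient.mk Γp) rfl
  show e.symm (cov.monodromy (Path.Homotopic.Quotient.mk γ) (e (u 0))) = u 1
  rw [key, Equiv.symm_apply_apply]

end Holonomy

section Winding

open Set Topology Complex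
open scoped Real

/-- The integer `n` with `a - b = 2πin`, when `exp a = exp b`. -/
def wind (a b : ℂ) : ℤ := round ((a - b) / (2 * π * I)).re

theorem wind_eq {a b : ℂ} {n : ℤ} (h : a = b + n * (2 * π * I)) : wind a b = n := by
  have h1 : (a - b) / (2 * π * I) = ((n : ℝ) : ℂ) := by
    rw [div_eq_iff two_pi_I_ne_zero, h]
    push_cast
    ring
  rw [wind, h1, ofReal_re, round_intCast]

theorem eq_add_wind {a b : ℂ} (h : exp a = exp b) : a = b + wind a b * (2 * π * I) := by
  obtain ⟨n, hn⟩ := exp_eq_exp_iff_exists_int.1 h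
  rwa [wind_eq hn]

theorem wind_add {a b c : ℂ} (h : exp a = exp b) (h' : exp b = exp c) :
    wind a b + wind b c = wind a c := by
  refine (wind_eq ?_).symm
  push_cast
  linear_combination eq_add_wind h + eq_add_wind h'

theorem eventually_wind_eq {X : Type*} [TopologicalSpace X] {f g : X → ℂ} {x : X}
    (hf : ContinuousAt f x) (hg : ContinuousAt g x) (h : ∀ᶠ y in 𝓝 x, exp (f y) = exp (g y)) :
    ∀ᶠ y in 𝓝 x, wind (f y) (g y) = wind (f x) (g x) := by
  have hc : ContinuousAt (fun y => ((f y - g y) / (2 * π * I)).re) x :=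
    continuous_re.continuousAt.comp ((hf.sub hg).div_const _)
  have key : ∀ y, exp (f y) = exp (g y) →
      ((f y - g y) / (2 * π * I)).re = (wind (f y) (g y) : ℝ) := fun y hy => by
    have h2 : (f y - g y) / (2 * π * I) = ((wind (f y) (g y) : ℝ) : ℂ) := by
      rw [div_eq_iff two_pi_I_ne_zero]
      push_cast
      linear_combination eq_add_wind hy
    rw [h2, ofReal_re]
  filter_upwards [h, Metric.continuousAt_iff'.1 hc 1 one_pos] with y hy hd
  rw [Real.dist_eq, key y hy, key x h.self_of_nhds, ← Int.cast_sub, ← Int.cast_abs] at hd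
  have : |wind (f y) (g y) - wind (f x) (g x)| < 1 := by exact_mod_cast hd
  rwa [Int.abs_lt_one_iff, sub_eq_zero] at this

end Winding

section Descent

open Set Topology

/-- A representative of a point of the complement. -/
def rep (P : Cpl) : ℂ × ℂ × ℂ := (pt_surjective P).choose

theorem rep_mem (P : Cpl) : rep P ∈ cone := (pt_surjective P).choose_spec.1

theorem pt_rep (P : Cpl) : pt (rep P) = P := (pt_surjective P).choose_spec.2

/-- Homogeneous functions of degree zero. -/
def DegZero (φ : ℂ × ℂ × ℂ → ℂ) : Prop := ∀ c : ℂ, c ≠ 0 → ∀ v, φ (c • v) = φ v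

theorem DegZero.rep_pt {φ : ℂ × ℂ × ℂ → ℂ} (h : DegZero φ) {v : ℂ × ℂ × ℂ} (hv : v ∈ cone) :
    φ (rep (pt v)) = φ v := by
  obtain ⟨c, hc, h1⟩ := (pt_eq_pt hv (rep_mem (pt v))).1 (pt_rep (pt v)).symm
  rw [h1, h c hc]

theorem DegZero.continuousAt {φ : ℂ × ℂ × ℂ → ℂ} (h : DegZero φ) {P : Cpl}
    (hc : ContinuousAt φ (rep P)) : ContinuousAt (fun Q => φ (rep Q)) P := by
  intro U hU
  obtain ⟨W, hWU, hWo, hW⟩ := mem_nhds_iff.1 (hc hU)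
  have ho := isOpen_image_pt (inter_subset_right : W ∩ cone ⊆ cone) (hWo.inter isOpen_cone)
  rw [Filter.mem_map]
  refine Filter.mem_of_superset (ho.mem_nhds ⟨rep P, ⟨hW, rep_mem P⟩, pt_rep P⟩) ?_
  rintro _ ⟨v, ⟨hv, hvc⟩, rfl⟩
  have := hWU hv
  rwa [mem_preimage, ← h.rep_pt hvc] at this

/-- The value of the conic, normalized by `x²` or by `y²`. -/
def conicVal : Bool → ℂ × ℂ × ℂ → ℂ
  | false, v => conic v / v.1 ^ 2
  | true, v => conic v / v.2.1 ^ 2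

/-- The ratio of the two terms of the quartic, in either order. -/
def termRatio : Bool → ℂ × ℂ × ℂ → ℂ
  | false, v => v.2.1 ^ 2 * conic v / v.1 ^ 4
  | true, v => v.1 ^ 4 / (v.2.1 ^ 2 * conic v)

/-- The ratio `x / y`. -/
def xyRatio (v : ℂ × ℂ × ℂ) : ℂ := v.1 / v.2.1

theorem degZero_conicVal (τ : Bool) : DegZero (conicVal τ) := fun c hc v => by
  cases τ <;> simp only [conicVal, conic_smul, Prod.smul_fst, Prod.smul_snd, smul_eq_mul, mul_pow]
    <;> exact mul_div_mul_left _ _ (pow_ne_zero 2 hc)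

theorem degZero_termRatio (τ : Bool) : DegZero (termRatio τ) := fun c hc v => by
  have h (a : ℂ) : (c * v.2.1) ^ 2 * (c ^ 2 * a) = c ^ 4 * (v.2.1 ^ 2 * a) := by ring
  cases τ <;> simp only [termRatio, conic_smul, Prod.smul_fst, Prod.smul_snd, smul_eq_mul, h]
    <;> rw [mul_pow] <;> exact mul_div_mul_left _ _ (pow_ne_zero 4 hc)

theorem degZero_xyRatio : DegZero xyRatio := fun _ hc _ => mul_div_mul_left _ _ hc

theorem conicVal_false_ne_zero {v : ℂ × ℂ × ℂ} (hv : v ∈ cone) :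
    conicVal false v ≠ 0 ↔ v.1 ≠ 0 := by
  simp [conicVal, hv.1]

theorem conicVal_true_ne_zero {v : ℂ × ℂ × ℂ} (hv : v ∈ cone) :
    conicVal true v ≠ 0 ↔ v.2.1 ≠ 0 := by
  simp [conicVal, hv.1]

theorem continuousAt_conicVal {τ : Bool} {v : ℂ × ℂ × ℂ} (hv : v ∈ cone) (h : conicVal τ v ≠ 0) :
    ContinuousAt (conicVal τ) v := by
  have := continuous_conic
  cases τ
  · exact ContinuousAt.div (by fun_prop) (by fun_prop)
      (pow_ne_zero 2 ((conicVal_false_ne_zero hv).1 h))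
  · exact ContinuousAt.div (by fun_prop) (by fun_prop)
      (pow_ne_zero 2 ((conicVal_true_ne_zero hv).1 h))

theorem continuousAt_termRatio {τ : Bool} {v : ℂ × ℂ × ℂ} (hv : v ∈ cone) (h : conicVal τ v ≠ 0) :
    ContinuousAt (termRatio τ) v := by
  have := continuous_conic
  cases τ
  · exact ContinuousAt.div (by fun_prop) (by fun_prop)
      (pow_ne_zero 4 ((conicVal_false_ne_zero hv).1 h))
  · exact ContinuousAt.div (by fun_prop) (by fun_prop)
      (mul_ne_zero (pow_ne_zero 2 ((conicVal_true_ne_zero hv).1 h)) hv.1)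

theorem continuousAt_xyRatio {v : ℂ × ℂ × ℂ} (hv : v ∈ cone) (h : conicVal true v ≠ 0) :
    ContinuousAt xyRatio v :=
  ContinuousAt.div (by fun_prop) (by fun_prop) ((conicVal_true_ne_zero hv).1 h)

end Descent

section Frames

open Set Topology Complex
open scoped Real

/-- `conicVal` on the complement. -/
def cVal (τ : Bool) (P : Cpl) : ℂ := conicVal τ (rep P)

/-- `termRatio` on the complement. -/
def tVal (τ : Bool) (P : Cpl) : ℂ := termRatio τ (rep P)

/-- `xyRatio` on the complement. -/
def hVal (P : Cpl) : ℂ := xyRatio (rep P)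

theorem continuousAt_cVal {τ : Bool} {P : Cpl} (h : cVal τ P ≠ 0) : ContinuousAt (cVal τ) P :=
  (degZero_conicVal τ).continuousAt (continuousAt_conicVal (rep_mem P) h)

theorem continuousAt_tVal {τ : Bool} {P : Cpl} (h : cVal τ P ≠ 0) : ContinuousAt (tVal τ) P :=
  (degZero_termRatio τ).continuousAt (continuousAt_termRatio (rep_mem P) h)

theorem continuousAt_hVal {P : Cpl} (h : cVal true P ≠ 0) : ContinuousAt hVal P :=
  degZero_xyRatio.continuousAt (continuousAt_xyRatio (rep_mem P) h)

theorem cVal_sheet {τ : Bool} {v : ℂ × ℂ × ℂ} (hv : v ∈ cone) : cVal τ (pt v) = conicVal τ v :=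
  (degZero_conicVal τ).rep_pt hv

theorem tVal_sheet {τ : Bool} {v : ℂ × ℂ × ℂ} (hv : v ∈ cone) : tVal τ (pt v) = termRatio τ v :=
  (degZero_termRatio τ).rep_pt hv

/-- The sign belonging to a branch of the logarithm. -/
def branchSign : Bool → ℂ
  | false => 1
  | true => -1

/-- The sets on which the frames are defined. -/
def patch (i : Bool × Bool) : Set Cpl :=
  {P | 1 - tVal i.1 P ∈ slitPlane ∧ branchSign i.2 * cVal i.1 P ∈ slitPlane}

theorem cVal_ne_zero {i : Bool × Bool} {P : Cpl} (h : P ∈ patch i) : cVal i.1 P ≠ 0 := fun h0 =>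
  slitPlane_ne_zero h.2 (by rw [h0, mul_zero])

theorem isOpen_patch (i : Bool × Bool) : IsOpen (patch i) := by
  refine isOpen_iff_mem_nhds.2 fun P hP => ?_
  have h0 := cVal_ne_zero hP
  have h1 : ContinuousAt (fun Q => 1 - tVal i.1 Q) P :=
    continuousAt_const.sub (continuousAt_tVal h0)
  have h2 : ContinuousAt (fun Q => branchSign i.2 * cVal i.1 Q) P :=
    continuousAt_const.mul (continuousAt_cVal h0)
  filter_upwards [h1.eventually_mem (isOpen_slitPlane.mem_nhds hP.1),
    h2.eventually_mem (isOpen_slitPlane.mem_nhds hP.2)] with Q hQ1 hQ2 using ⟨hQ1, hQ2⟩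

theorem exists_branchSign {z : ℂ} (hz : z ≠ 0) : ∃ σ, branchSign σ * z ∈ slitPlane := by
  by_cases h : z ∈ slitPlane
  · exact ⟨false, by simpa [branchSign] using h⟩
  · refine ⟨true, ?_⟩
    simp only [mem_slitPlane_iff, not_or, not_lt, not_not] at h
    have : z.re ≠ 0 := fun h0 => hz (Complex.ext h0 h.2)
    have h3 : z.re < 0 := lt_of_le_of_ne h.1 this
    simp [branchSign, mem_slitPlane_iff, h3]

theorem exists_mem_patch (P : Cpl) : ∃ i, P ∈ patch i := by
  suffices h : ∃ τ, cVal τ P ≠ 0 ∧ 1 - tVal τ P ∈ slitPlane by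
    obtain ⟨τ, h0, h1⟩ := h
    obtain ⟨σ, h2⟩ := exists_branchSign h0
    exact ⟨(τ, σ), h1, h2⟩
  have hv := rep_mem P
  have hv' : (rep P).1 ≠ 0 ∨ (rep P).2.1 ≠ 0 := by
    by_contra! h
    exact hv.2 (by rw [h.1, h.2]; ring)
  by_cases hx : (rep P).1 = 0
  · exact ⟨true, (conicVal_true_ne_zero hv).2 (hv'.resolve_left (not_not.2 hx)), by
      simp [tVal, termRatio, hx]⟩
  by_cases hy : (rep P).2.1 = 0
  · exact ⟨false, (conicVal_false_ne_zero hv).2 hx, by simp [tVal, termRatio, hy]⟩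
  by_cases ht : 1 - tVal false P ∈ slitPlane
  · exact ⟨false, (conicVal_false_ne_zero hv).2 hx, ht⟩
  refine ⟨true, (conicVal_true_ne_zero hv).2 hy, ?_⟩
  have h1 : tVal false P ≠ 1 := fun h => hv.2 (by
    rwa [tVal, termRatio, div_eq_one_iff_eq (pow_ne_zero 4 hx)] at h)
  have h2 : tVal true P = (tVal false P)⁻¹ := (inv_div _ _).symm
  rw [h2]
  generalize tVal false P = t at ht h1
  simp only [mem_slitPlane_iff, sub_re, one_re, sub_im, one_im, not_or, not_lt, not_not] at ht
  have him : t.im = 0 := by linarith [ht.2]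
  have hre : t.re ≠ 1 := fun h => h1 (Complex.ext h him)
  have hlt : 1 < t.re := lt_of_le_of_ne (by linarith [ht.1]) (Ne.symm hre)
  have h3 : t = (t.re : ℂ) := Complex.ext rfl him
  rw [h3, ← ofReal_inv, ← ofReal_one, ← ofReal_sub, ofReal_mem_slitPlane, sub_pos]
  exact inv_lt_one_of_one_lt₀ hlt

/-- The local logarithms of `cVal`. -/
def locLog (i : Bool × Bool) (P : Cpl) : ℂ :=
  log (branchSign i.2 * cVal i.1 P) + match i.2 with
    | false => 0
    | true => π * I

theorem exp_locLog {i : Bool × Bool} {P : Cpl} (h : cVal i.1 P ≠ 0) :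
    exp (locLog i P) = cVal i.1 P := by
  obtain ⟨τ, σ⟩ := i
  have h' : -cVal τ P ≠ 0 := neg_ne_zero.2 h
  cases σ <;> simp [locLog, branchSign, exp_add, exp_log h, exp_log h', exp_pi_mul_I]

theorem continuousAt_locLog {i : Bool × Bool} {P : Cpl} (h : P ∈ patch i) :
    ContinuousAt (locLog i) P := by
  have h2 : ContinuousAt (fun Q => branchSign i.2 * cVal i.1 Q) P :=
    continuousAt_const.mul (continuousAt_cVal (cVal_ne_zero h))
  exact (h2.clog h.2).add continuousAt_const

/-- The locus where both kinds of frames may be defined. -/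
def overlap : Set Cpl :=
  {P | (cVal false P ≠ 0 ∧ cVal true P ≠ 0) ∧
    1 - tVal false P ∈ slitPlane ∧ 1 - tVal true P ∈ slitPlane}

/-- The exponent of `xyRatio` in `cVal`. -/
def twist : Bool → ℤ
  | false => 2
  | true => 4

theorem hVal_ne_zero {P : Cpl} (h : P ∈ overlap) : hVal P ≠ 0 :=
  div_ne_zero ((conicVal_false_ne_zero (rep_mem P)).1 h.1.1)
    ((conicVal_true_ne_zero (rep_mem P)).1 h.1.2)

theorem neg_tVal_mem {P : Cpl} (h : P ∈ overlap) : -tVal false P ∈ slitPlane := by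
  have hv := rep_mem P
  have h2 : tVal true P = (tVal false P)⁻¹ := (inv_div _ _).symm
  have h0 : tVal false P ≠ 0 := div_ne_zero (mul_ne_zero
    (pow_ne_zero 2 ((conicVal_true_ne_zero hv).1 h.1.2)) hv.1)
    (pow_ne_zero 4 ((conicVal_false_ne_zero hv).1 h.1.1))
  have h3 := h.2
  rw [h2] at h3
  by_contra hn
  generalize tVal false P = t at *
  simp only [mem_slitPlane_iff, neg_re, neg_im, not_or, not_lt, not_not] at hn
  have h4 : t = (t.re : ℂ) := Complex.ext rfl (by simpa using hn.2)
  have h5 : 0 < t.re := lt_of_le_of_ne (by linarith [hn.1]) fun h => h0 (by rw [h4, ← h]; simp)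
  rw [h4, ← ofReal_inv, ← ofReal_one, ← ofReal_sub, ← ofReal_sub, ofReal_mem_slitPlane,
    ofReal_mem_slitPlane, sub_pos, sub_pos, inv_lt_one₀ h5] at h3
  linarith [h3.1, h3.2]

/-- The logarithm of `cVal` belonging to a logarithm of `xyRatio`. -/
def twistLog (τ : Bool) (P : Cpl) (l : ℂ) : ℂ := log (-tVal false P) + π * I + twist τ * l

theorem exp_twistLog {P : Cpl} (h : P ∈ overlap) (τ : Bool) {l : ℂ} (hl : exp l = hVal P) :
    exp (twistLog τ P l) = cVal τ P := by
  have hx := (conicVal_false_ne_zero (rep_mem P)).1 h.1.1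
  have hy := (conicVal_true_ne_zero (rep_mem P)).1 h.1.2
  rw [twistLog, exp_add, exp_add, exp_log (slitPlane_ne_zero (neg_tVal_mem h)), exp_pi_mul_I,
    exp_int_mul, hl]
  cases τ <;>
  · simp only [twist, tVal, hVal, cVal, conicVal, termRatio, xyRatio, zpow_ofNat]
    field_simp

open scoped Classical in
/-- The reference logarithm of `cVal`. -/
def refLog (τ : Bool) (P : Cpl) : ℂ :=
  if P ∈ overlap then twistLog τ P (log (hVal P)) else log (cVal τ P)

theorem exp_refLog {τ : Bool} {P : Cpl} (h : cVal τ P ≠ 0) : exp (refLog τ P) = cVal τ P := by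
  unfold refLog
  split_ifs with ho
  · exact exp_twistLog ho τ (exp_log (hVal_ne_zero ho))
  · exact exp_log h

variable {G : Type*} [Group G]

/-- The local frames. -/
def frame (e : Bool → G) (i : Bool × Bool) (P : Cpl) : G :=
  e i.1 ^ wind (locLog i P) (refLog i.1 P)

theorem frame_ratio {e : Bool → G} (he : e false ^ 2 = e true ^ 4) {P : Cpl} (h : P ∈ overlap)
    (σ ρ : Bool) {l : ℂ} (hl : exp l = hVal P) :
    frame e (true, σ) P * (frame e (false, ρ) P)⁻¹ =
      e true ^ wind (locLog (true, σ) P) (twistLog true P l) *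
        (e false ^ wind (locLog (false, ρ) P) (twistLog false P l))⁻¹ := by
  obtain ⟨n, hn⟩ := exp_eq_exp_iff_exists_int.1 ((exp_log (hVal_ne_zero h)).trans hl.symm)
  have key (τ σ : Bool) : frame e (τ, σ) P =
      e τ ^ (wind (locLog (τ, σ) P) (twistLog τ P l) - twist τ * n) := by
    have h0 : cVal τ P ≠ 0 := by cases τ; exacts [h.1.1, h.1.2]
    have h1 : refLog τ P = twistLog τ P (log (hVal P)) := if_pos h
    have h2 : wind (twistLog τ P l) (refLog τ P) = -(twist τ * n) := wind_eq (by
      rw [h1, hn]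
      simp only [twistLog]
      push_cast
      ring)
    rw [frame, ← wind_add (b := twistLog τ P l) ((exp_locLog h0).trans (exp_twistLog h τ hl).symm)
      ((exp_twistLog h τ hl).trans (exp_refLog h0).symm), h2, ← sub_eq_add_neg]
  have h2 : e true ^ (twist true * n) = e false ^ (twist false * n) := by
    simp only [twist, zpow_mul]
    norm_cast
    rw [he]
  rw [key, key, zpow_sub, zpow_sub, h2]
  group

end Frames

section FrameHolonomy

open Set Topology Complex
open scoped Real

variable {G : Type*} [Group G] {e : Bool → G}

theorem patch_inter_subset (σ ρ : Bool) : patch (false, ρ) ∩ patch (true, σ) ⊆ overlap :=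
  fun _ h => ⟨⟨cVal_ne_zero h.1, cVal_ne_zero h.2⟩, h.1.1, h.2.1⟩

theorem frame_ratio_same {P : Cpl} {τ : Bool} (h : cVal τ P ≠ 0) (σ ρ : Bool) :
    frame e (τ, σ) P * (frame e (τ, ρ) P)⁻¹ =
      e τ ^ wind (locLog (τ, σ) P) (locLog (τ, ρ) P) := by
  rw [frame, frame, ← zpow_neg, ← zpow_add]
  congr 1
  have h1 : exp (locLog (τ, σ) P) = cVal τ P := exp_locLog h
  have h2 : exp (locLog (τ, ρ) P) = cVal τ P := exp_locLog h
  have := wind_add (h1.trans h2.symm) (h2.trans (exp_refLog h).symm)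
  rw [← this]
  ring

theorem frame_locally_constant_of_overlap (he : e false ^ 2 = e true ^ 4) {σ ρ : Bool} {x : Cpl}
    (hx : x ∈ patch (false, ρ) ∩ patch (true, σ)) :
    ∀ᶠ y in 𝓝 x, frame e (true, σ) y * (frame e (false, ρ) y)⁻¹ =
      frame e (true, σ) x * (frame e (false, ρ) x)⁻¹ := by
  have ho := patch_inter_subset σ ρ hx
  have hnx : ∀ᶠ y in 𝓝 x, y ∈ patch (false, ρ) ∩ patch (true, σ) :=
    ((isOpen_patch _).inter (isOpen_patch _)).mem_nhds hx
  have hh : ContinuousAt hVal x := continuousAt_hVal ho.1.2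
  have h0 : hVal x ≠ 0 := hVal_ne_zero ho
  let l : Cpl → ℂ := fun y => log (hVal y / hVal x) + log (hVal x)
  have hl : ContinuousAt l x :=
    ((hh.div_const _).clog (by rw [div_self h0]; exact one_mem_slitPlane)).add continuousAt_const
  have hle : ∀ y ∈ overlap, exp (l y) = hVal y := fun y hy => by
    rw [exp_add, exp_log (div_ne_zero (hVal_ne_zero hy) h0), exp_log h0, div_mul_cancel₀ _ h0]
  have ht (τ : Bool) : ContinuousAt (fun y => twistLog τ y (l y)) x :=
    (((continuousAt_tVal ho.1.1).neg.clog (neg_tVal_mem ho)).add continuousAt_const).add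
      (continuousAt_const.mul hl)
  have key : ∀ τ σ, (∀ᶠ y in 𝓝 x, y ∈ patch (τ, σ)) → ∀ᶠ y in 𝓝 x,
      wind (locLog (τ, σ) y) (twistLog τ y (l y)) = wind (locLog (τ, σ) x) (twistLog τ x (l x)) :=
    fun τ σ hp => eventually_wind_eq (continuousAt_locLog hp.self_of_nhds) (ht τ) <| by
      filter_upwards [hnx, hp] with y hy hy'
      exact (exp_locLog (cVal_ne_zero hy')).trans
        (exp_twistLog (patch_inter_subset _ _ hy) τ (hle y (patch_inter_subset _ _ hy))).symm
  filter_upwards [hnx, key false ρ (hnx.mono fun y hy => hy.1),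
    key true σ (hnx.mono fun y hy => hy.2)] with y hy h1 h2
  have hy' := patch_inter_subset _ _ hy
  rw [frame_ratio he hy' σ ρ (hle y hy'), frame_ratio he ho σ ρ (hle x ho), h1, h2]

theorem frame_locally_constant (he : e false ^ 2 = e true ^ 4) (i j : Bool × Bool) (x : Cpl)
    (hx : x ∈ patch i ∩ patch j) :
    ∀ᶠ y in 𝓝 x, frame e j y * (frame e i y)⁻¹ = frame e j x * (frame e i x)⁻¹ := by
  have same : ∀ τ σ ρ, x ∈ patch (τ, ρ) ∩ patch (τ, σ) → ∀ᶠ y in 𝓝 x,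
      frame e (τ, σ) y * (frame e (τ, ρ) y)⁻¹ = frame e (τ, σ) x * (frame e (τ, ρ) x)⁻¹ := by
    intro τ σ ρ hx
    have hn : ∀ᶠ y in 𝓝 x, y ∈ patch (τ, ρ) := (isOpen_patch _).mem_nhds hx.1
    have hE : ∀ y ∈ patch (τ, ρ), exp (locLog (τ, σ) y) = exp (locLog (τ, ρ) y) := fun y hy => by
      have h0 : cVal τ y ≠ 0 := cVal_ne_zero hy
      rw [exp_locLog (i := (τ, σ)) h0, exp_locLog (i := (τ, ρ)) h0]
    filter_upwards [hn, eventually_wind_eq (continuousAt_locLog hx.2) (continuousAt_locLog hx.1)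
      (hn.mono hE)] with y hy h
    rw [frame_ratio_same (cVal_ne_zero hy), frame_ratio_same (cVal_ne_zero hx.1), h]
  obtain ⟨τ, ρ⟩ := i
  obtain ⟨τ', σ⟩ := j
  cases τ <;> cases τ'
  · exact same _ _ _ hx
  · exact frame_locally_constant_of_overlap he hx
  · filter_upwards [frame_locally_constant_of_overlap he hx.symm] with y hy
    simpa only [mul_inv_rev, inv_inv] using congrArg (·⁻¹) hy
  · exact same _ _ _ hx

/-- A holonomy representation sees a loop along which a logarithm of `cVal` grows by `2πi`. -/
theorem holonomy_loop {x₀ : Cpl} {Φ : FundamentalGroup Cpl x₀ →* Equiv.Perm G}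
    (hΦ : ∀ (γ : Path x₀ x₀) (u : unitInterval → G),
      (∀ t, ∃ i, γ t ∈ patch i ∧
        ∀ᶠ s in 𝓝 t, frame e i (γ s) * u s = frame e i (γ t) * u t) →
      Φ (FundamentalGroup.fromPath (Path.Homotopic.Quotient.mk γ)) (u 0) = u 1)
    (τ : Bool) (γ : Path x₀ x₀) (L : C(unitInterval, ℂ)) (hL : ∀ t, exp (L t) = cVal τ (γ t))
    (ht : ∀ t, 1 - tVal τ (γ t) ∈ slitPlane) (h1 : L 1 = L 0 + 2 * π * I) (v : G) :
    Φ (FundamentalGroup.fromPath (Path.Homotopic.Quotient.mk γ)) v = (e τ)⁻¹ * v := by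
  let w : unitInterval → ℤ := fun t => wind (refLog τ (γ t)) (L t)
  have h0 : ∀ t, cVal τ (γ t) ≠ 0 := fun t => by rw [← hL]; exact exp_ne_zero _
  have key := hΦ γ (fun t => e τ ^ w t * (e τ ^ (-w 0) * v)) fun t => by
    obtain ⟨σ, hσ⟩ := exists_branchSign (h0 t)
    have hp : γ t ∈ patch (τ, σ) := ⟨ht t, hσ⟩
    have hc : ContinuousAt (fun s => locLog (τ, σ) (γ s)) t :=
      ContinuousAt.comp (f := γ) (x := t) (continuousAt_locLog hp) γ.continuous.continuousAt
    have hE : ∀ s, exp (locLog (τ, σ) (γ s)) = cVal τ (γ s) := fun s => exp_locLog (h0 s)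
    have hf : ∀ s, frame e (τ, σ) (γ s) * (e τ ^ w s * (e τ ^ (-w 0) * v)) =
        e τ ^ wind (locLog (τ, σ) (γ s)) (L s) * (e τ ^ (-w 0) * v) := fun s => by
      rw [← mul_assoc, frame, ← zpow_add, wind_add ((hE s).trans (exp_refLog (h0 s)).symm)
        ((exp_refLog (h0 s)).trans (hL s).symm)]
    refine ⟨(τ, σ), hp, ?_⟩
    filter_upwards [eventually_wind_eq hc L.continuous.continuousAt
      (.of_forall fun s => (hE s).trans (hL s).symm)] with s hs
    rw [hf, hf, hs]
  have hw : w 1 = w 0 - 1 := wind_eq (by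
    have := eq_add_wind ((exp_refLog (h0 0)).trans (hL 0).symm)
    simp only [γ.source] at this
    simp only [γ.target, h1]
    rw [this]
    simp only [w, γ.source]
    push_cast
    ring)
  simp only [hw] at key
  rw [← mul_assoc, ← mul_assoc, ← zpow_add, ← zpow_add, add_neg_cancel, zpow_zero, one_mul] at key
  rw [key]
  congr 1
  rw [← zpow_neg_one]
  congr 1
  ring

end FrameHolonomy

section Presentation

open Set Topology Complex
open scoped Real

theorem vals_sheet {s : ℝ} (hs : s ^ 2 = 1) {p : ℂ × ℂ} (hp : p ∈ sheetDom) :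
    cVal false (sheet s p) = p.2 ∧ tVal false (sheet s p) = p.1 ^ 2 * p.2 ∧
      cVal true (sheet s p) = p.2 / p.1 ^ 2 ∧ tVal true (sheet s p) = (p.1 ^ 2 * p.2)⁻¹ := by
  have hm : ((1, sheet₀ s p) : ℂ × ℂ × ℂ) ∈ cone := sheet₀_mem hs hp
  have hc : conic (1, sheet₀ s p) = p.2 := by
    rw [← sheet₀_conic hs p]
    simp [conic]
  have h1 : (sheet₀ s p).1 = p.1 := rfl
  unfold sheet aff₁
  simp [cVal_sheet hm, tVal_sheet hm, conicVal, termRatio, hc, h1]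

variable {G : Type*} [Group G]

theorem exists_holonomy_meridians {b m : G} (h : b ^ 2 = m ^ 4) :
    ∃ Φ : FundamentalGroup Cpl (basePt 1) →* Equiv.Perm G, ∀ v,
      Φ (bElt one_sq_eq) v = b⁻¹ * v ∧ Φ (mElt one_sq_eq) v = m⁻¹ * v := by
  let e : Bool → G := fun τ => cond τ m b
  let _ : TopologicalSpace G := ⊥
  have : DiscreteTopology G := ⟨rfl⟩
  obtain ⟨Φ, hΦ⟩ := exists_holonomy (V := patch) isOpen_patch exists_mem_patch (c := frame e)
    (frame_locally_constant h) (basePt 1)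
  refine ⟨Φ, fun v => ⟨?_, ?_⟩⟩
  · obtain ⟨γ, hγ, δ, hδ, hb⟩ := bPath_liftsIn one_sq_eq 0
    rw [bElt, ← hb]
    have hv := fun t => vals_sheet one_sq_eq (baseDom_subset (hγ t))
    refine holonomy_loop hΦ false δ ⟨fun t => (γ t).2, by fun_prop⟩ (fun t => ?_) (fun t => ?_) ?_ v
    · rw [hδ, logSheet, (hv t).1]
      rfl
    · rw [hδ, logSheet, (hv t).2.1]
      exact (hγ t).2.1
    · show (γ 1).2 = (γ 0).2 + 2 * π * I
      rw [γ.source, γ.target]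
      simp only [logPt]
      push_cast
      ring
  · have hv := fun t : unitInterval => vals_sheet one_sq_eq (mF_mem (2 * π * t))
    have hm : ∀ t, mPath one_sq_eq t = sheet 1 (64, mF (2 * π * t)) := fun _ => rfl
    refine holonomy_loop hΦ true (mPath one_sq_eq) ⟨fun t => ((-Real.log 64 : ℝ) : ℂ) +
      ((π + 2 * π * t : ℝ) : ℂ) * I, by fun_prop⟩ (fun t => ?_) (fun t => ?_) ?_ v
    · rw [hm, (hv t).2.2.1]
      simp only [ContinuousMap.coe_mk, mF]
      rw [exp_ofReal_add, Real.exp_neg, Real.exp_log (by norm_num), cis_add, cis_pi]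
      push_cast
      ring
    · rw [hm, (hv t).2.2.2, sub_eq_add_neg]
      refine mem_slitPlane_of_norm_lt_one ?_
      rw [norm_neg, norm_inv, norm_mul, norm_mF]
      norm_num
    · simp only [ContinuousMap.coe_mk, Set.Icc.coe_zero, Set.Icc.coe_one]
      push_cast
      ring

/-- The homomorphism from `G2` given by the meridians. -/
def fromG2 : G2 →* FundamentalGroup Cpl (basePt 1) :=
  PresentedGroup.toGroup
    (f := ![mElt one_sq_eq * (bElt one_sq_eq)⁻¹, bElt one_sq_eq]) <| by
    rintro r rfl
    have h : bElt one_sq_eq ^ 2 * ((mElt one_sq_eq * (bElt one_sq_eq)⁻¹ * bElt one_sq_eq) ^ 4)⁻¹ =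
        1 := by
      rw [inv_mul_cancel_right, bElt_sq, mul_inv_cancel]
    simp only [ga, gb, map_mul, map_pow, map_inv, FreeGroup.lift_apply_of]
    exact h

/-- The generator `a` of `G2`. -/
def aG2 : G2 := PresentedGroup.of 0

/-- The generator `b` of `G2`. -/
def bG2 : G2 := PresentedGroup.of 1

theorem fromG2_b : fromG2 bG2 = bElt one_sq_eq := PresentedGroup.toGroup.of _

theorem fromG2_a : fromG2 aG2 = mElt one_sq_eq * (bElt one_sq_eq)⁻¹ := PresentedGroup.toGroup.of _

theorem bG2_sq : bG2 ^ 2 = (aG2 * bG2) ^ 4 :=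
  mul_inv_eq_one.1 (PresentedGroup.one_of_mem (rels := rels2) (mem_singleton _))

theorem fromG2_surjective : Function.Surjective fromG2 := by
  rw [← MonoidHom.range_eq_top, eq_top_iff, ← meridianGroup_eq_top, meridianGroup,
    Subgroup.closure_le]
  rintro _ (rfl | rfl)
  · exact ⟨aG2 * bG2, by rw [map_mul, fromG2_a, fromG2_b, inv_mul_cancel_right]⟩
  · exact ⟨bG2, fromG2_b⟩

theorem fromG2_injective : Function.Injective fromG2 := by
  obtain ⟨Φ, hΦ⟩ := exists_holonomy_meridians (b := bG2⁻¹) (m := (aG2 * bG2)⁻¹) (by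
    rw [inv_pow, inv_pow, bG2_sq])
  have hb : Φ (fromG2 bG2) = MulAction.toPermHom G2 G2 bG2 := by
    ext v
    rw [fromG2_b, (hΦ v).1, inv_inv]
    rfl
  have hab : Φ (fromG2 (aG2 * bG2)) = MulAction.toPermHom G2 G2 (aG2 * bG2) := by
    ext v
    rw [map_mul, fromG2_a, fromG2_b, inv_mul_cancel_right, (hΦ v).2, inv_inv]
    rfl
  have ha : Φ (fromG2 aG2) = MulAction.toPermHom G2 G2 aG2 := by
    rw [map_mul, map_mul, map_mul, hb] at hab
    exact mul_right_cancel hab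
  have h : Φ.comp fromG2 = MulAction.toPermHom G2 G2 := by
    refine PresentedGroup.ext fun i => ?_
    fin_cases i
    exacts [ha, hb]
  refine Function.Injective.of_comp (f := Φ) ?_
  rw [← MonoidHom.coe_comp, h]
  exact MulAction.toPerm_injective

end Presentation

/-- For every basepoint x₀ in the complement X₂ = ℙ² ∖ C⁽²⁾ of the sextic
C⁽²⁾ = V(F₂·Q₂), the fundamental group π₁(X₂, x₀) is isomorphic to
G₂ = ⟨a, b | b² = (ab)⁴⟩. -/
theorem stmt_6 (x₀ : ↥(VV (F₂ * Q₂))ᶜ) :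
    Nonempty (FundamentalGroup (↥(VV (F₂ * Q₂))ᶜ) x₀ ≃* G2) :=
  ⟨(FundamentalGroup.fundamentalGroupMulEquivOfPathConnected x₀ (basePt 1)).trans
    (MulEquiv.ofBijective fromG2 ⟨fromG2_injective, fromG2_surjective⟩).symm⟩
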